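/- Let G be a Smirnov domain and fix ζ ∈ G. Then for every n ∈ ℕ, ‖φ − J_{2n+1}‖_∞ ≤ 8π · (Σ_{k=n+1}^∞ |p_k(ζ)|²)^{1/2}, and the right-hand side tends to 0 as n → ∞. -/

import Mathlib

open Complex MeasureTheory Set Filter Metric

noncomputable section

/-- A bounded Jordan domain `G ⊆ ℂ` whose boundary is a rectifiable Jordan curve
of length `l`, given together with a unit-speed (arclength) parametrization `γ`
of the boundary curve `L = frontier G`. -/
structure JordanDomain where
  /-- the domain -/
  G : Set ℂ
  isOpen : IsOpen G
  nonempty : G.Nonempty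
  bounded : Bornology.IsBounded G
  connected : IsConnected G
  simplyConnected : SimplyConnectedSpace ↥G
  /-- the length of the boundary curve -/
  l : ℝ
  l_pos : 0 < l
  /-- arclength parametrization of the boundary curve -/
  γ : ℝ → ℂ
  γ_cont : Continuous γ
  γ_periodic : Function.Periodic γ l
  γ_injOn : InjOn γ (Ico 0 l)
  γ_boundary : γ '' Ico 0 l = frontier G
  /-- `γ` is a unit-speed (arclength) parametrization; in particular the boundary
  is rectifiable with length `l`. -/
  γ_unitSpeed : ∀ s t : ℝ, s ≤ t → t ≤ s + l →
    eVariationOn γ (Icc s t) = ENNReal.ofReal (t - s)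

/-- The `E₂(G)`-norm of (the boundary trace of) a function, computed through the
arclength parametrization of the boundary: `‖g‖₂ = ((1/l) ∫₀^l ‖g(s)‖² ds)^{1/2}`. -/
def JordanDomain.bnorm (D : JordanDomain) (g : ℝ → ℂ) : ℝ :=
  Real.sqrt ((1 / D.l) * ∫ s in (0:ℝ)..D.l, ‖g s‖ ^ 2)

/-- `p` is the sequence of orthonormal polynomials of `E₂(G)` obtained by Gram–Schmidt
orthonormalization of the monomials `1, z, z², …`: `deg p k = k`, the leading
coefficients are positive reals, and the polynomials are orthonormal with respect to
the arclength inner product `(f,g) = (1/l) ∫_L f conj(g) |dz|`. -/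
def JordanDomain.IsONPolys (D : JordanDomain) (p : ℕ → Polynomial ℂ) : Prop :=
  (∀ k, (p k).natDegree = k) ∧
  (∀ k, ∃ c : ℝ, 0 < c ∧ (p k).leadingCoeff = (c : ℂ)) ∧
  (∀ j k, (1 / (D.l : ℂ)) * (∫ s in (0:ℝ)..D.l,
      (p j).eval (D.γ s) * (starRingEnd ℂ) ((p k).eval (D.γ s))) =
    if j = k then 1 else 0)

/-- The `n`-th partial sum `Σ_{k=0}^n conj(p_k(ζ))·p_k(z)` of the Szegő kernel expansion. -/
def partialSum (p : ℕ → Polynomial ℂ) (ζ : ℂ) (n : ℕ) : ℂ → ℂ := fun z =>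
  ∑ k ∈ Finset.range (n + 1), (starRingEnd ℂ) ((p k).eval ζ) * (p k).eval z

/-- The Szegő kernel `K(z,ζ) = Σ_{k=0}^∞ conj(p_k(ζ))·p_k(z)`. -/
def szegoKernel (p : ℕ → Polynomial ℂ) (ζ z : ℂ) : ℂ :=
  ∑' k : ℕ, (starRingEnd ℂ) ((p k).eval ζ) * (p k).eval z

/-- The approximating polynomials
`J_{2n+1}(z) = (2π/l)·(∫_ζ^z (Σ_{k=0}^n conj(p_k(ζ))p_k(t))² dt) / (Σ_{k=0}^n |p_k(ζ)|²)`;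
the (path-independent) integral of the polynomial integrand is written out explicitly,
using `∫_ζ^z t^i dt = (z^{i+1} - ζ^{i+1})/(i+1)`. -/
def Jfun (D : JordanDomain) (p : ℕ → Polynomial ℂ) (ζ : ℂ) (n : ℕ) : ℂ → ℂ := fun z =>
  let S : Polynomial ℂ :=
    (∑ k ∈ Finset.range (n + 1), Polynomial.C ((starRingEnd ℂ) ((p k).eval ζ)) * p k) ^ 2
  (((2 * Real.pi / D.l : ℝ) : ℂ) / (∑ k ∈ Finset.range (n + 1), ((‖(p k).eval ζ‖ : ℂ)) ^ 2)) *
    ∑ i ∈ Finset.range (S.natDegree + 1),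
      S.coeff i * ((z ^ (i + 1) - ζ ^ (i + 1)) / ((i : ℂ) + 1))

/-- `Q_n(z) = ((l/2π)·Σ_{k=0}^n |p_k(ζ)|²)^{-1/2} · Σ_{k=0}^n conj(p_k(ζ))·p_k(z)`,
so that `J'_{2n+1} = Q_n²`. -/
def Qfun (D : JordanDomain) (p : ℕ → Polynomial ℂ) (ζ : ℂ) (n : ℕ) : ℂ → ℂ := fun z =>
  ((Real.sqrt ((D.l / (2 * Real.pi)) *
      ∑ k ∈ Finset.range (n + 1), ‖(p k).eval ζ‖ ^ 2) : ℝ) : ℂ)⁻¹ * partialSum p ζ n z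

/-- The sup norm `⨆_{z ∈ K} ‖f(z)‖` on a set `K ⊆ ℂ`. -/
def supNormOn (K : Set ℂ) (f : ℂ → ℂ) : ℝ := ⨆ z : K, ‖f (z : ℂ)‖

/-- `g` has nontangential limit `v` at the boundary point `w` of `G`:
`g(z) → v` as `z → w` inside every cone `{z ∈ G : ‖z - w‖ ≤ M·dist(z, ∂G)}`. -/
def NTLim (G : Set ℂ) (g : ℂ → ℂ) (w v : ℂ) : Prop :=
  ∀ M : ℝ, 1 < M →
    Tendsto g (nhdsWithin w {z | z ∈ G ∧ ‖z - w‖ ≤ M * infDist z (frontier G)}) (nhds v)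

/-- `φ` is the conformal map of `G` onto the unit disk `D` normalized by
`φ(ζ) = 0` and `φ'(ζ) > 0`. -/
structure ConformalOnto (G : Set ℂ) (φ : ℂ → ℂ) (ζ : ℂ) : Prop where
  differentiable : ∀ z ∈ G, DifferentiableAt ℂ φ z
  bijOn : BijOn φ G (ball (0 : ℂ) 1)
  map_center : φ ζ = 0
  deriv_center_pos : ∃ c : ℝ, 0 < c ∧ deriv φ ζ = (c : ℂ)

/-- `G` is a Smirnov domain: for any conformal map `ψ` of the unit disk onto `G`,
`log|ψ'|` is represented by the Poisson integral of its (radial) boundary values.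
(By the Keldysh–Lavrentiev theorem this is equivalent to polynomials being dense
in the Smirnov classes `E_p(G)`.) -/
def IsSmirnovDomain (G : Set ℂ) : Prop :=
  ∀ ψ : ℂ → ℂ,
    (∀ w ∈ ball (0 : ℂ) 1, DifferentiableAt ℂ ψ w) →
    BijOn ψ (ball (0 : ℂ) 1) G →
    ∃ h : ℝ → ℝ,
      IntervalIntegrable h volume 0 (2 * Real.pi) ∧
      (∀ᵐ (θ : ℝ) ∂(volume.restrict (Ioc (0 : ℝ) (2 * Real.pi))),
        Tendsto (fun r : ℝ => Real.log ‖deriv ψ ((r : ℂ) * Complex.exp ((θ : ℂ) * Complex.I))‖)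
          (nhdsWithin 1 (Iio 1)) (nhds (h θ))) ∧
      (∀ w ∈ ball (0 : ℂ) 1,
        Real.log ‖deriv ψ w‖ =
          (1 / (2 * Real.pi)) * ∫ θ in (0 : ℝ)..(2 * Real.pi),
            ((1 - ‖w‖ ^ 2) / ‖Complex.exp ((θ : ℂ) * Complex.I) - w‖ ^ 2) * h θ)

/-- The (interior) opening angle of `G` at the boundary point `z₀` equals `a`:
the angular measure of the set of directions in which `G` is seen from `z₀`
at distance `r` tends to `a` as `r → 0⁺`. -/
def HasCornerAngle (G : Set ℂ) (z₀ : ℂ) (a : ℝ) : Prop :=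
  Tendsto (fun r : ℝ =>
      (volume {θ : ℝ | θ ∈ Ico 0 (2 * Real.pi) ∧
        z₀ + (r : ℂ) * Complex.exp ((θ : ℂ) * Complex.I) ∈ G}).toReal)
    (nhdsWithin 0 (Ioi 0)) (nhds a)

/-- The boundary of the Jordan domain `D` is piecewise analytic: it is a union of
finitely many analytic arcs `τ i '' [0,1]` (each `τ i` is conformal, i.e. injective
and holomorphic, on an open neighborhood `U i` of the segment `[0,1]`), consecutive
arcs are joined at the junction points `τ i 1 = τ (i+1) 0`, and at the junction
point `τ i 1` the exterior angle of `G` is `extAngle i · π` (so the interior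
opening angle there is `(2 - extAngle i) · π`). -/
structure PiecewiseAnalyticBoundary (D : JordanDomain) where
  /-- number of analytic arcs -/
  m : ℕ
  m_pos : 0 < m
  /-- conformal parametrizations of the arcs -/
  τ : Fin m → ℂ → ℂ
  /-- neighborhoods of the segment `[0,1]` on which the `τ i` are conformal -/
  U : Fin m → Set ℂ
  U_open : ∀ i, IsOpen (U i)
  seg_sub : ∀ i, (Complex.ofReal '' Icc (0 : ℝ) 1) ⊆ U i
  analytic : ∀ i, DifferentiableOn ℂ (τ i) (U i)
  inj : ∀ i, InjOn (τ i) (U i)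
  cover : (⋃ i, τ i '' (Complex.ofReal '' Icc (0 : ℝ) 1)) = frontier D.G
  junction : ∀ i : Fin m,
    τ i 1 = τ (Fin.mk ((i.val + 1) % m) (Nat.mod_lt _ m_pos)) 0
  /-- `extAngle i · π` is the exterior angle at the junction point `τ i 1` -/
  extAngle : Fin m → ℝ
  extAngle_mem : ∀ i, extAngle i ∈ Ioo (0 : ℝ) 2
  extAngle_spec : ∀ i, HasCornerAngle D.G (τ i 1) ((2 - extAngle i) * Real.pi)

end

theorem aux_inv_holo {G : Set ℂ} (hG : IsOpen G) (hGc : IsPreconnected G) {φ : ℂ → ℂ}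
    (hd : ∀ z ∈ G, DifferentiableAt ℂ φ z) (hb : BijOn φ G (ball (0 : ℂ) 1)) :
    ∃ ψ : ℂ → ℂ, DifferentiableOn ℂ ψ (ball 0 1) ∧ MapsTo ψ (ball 0 1) G ∧
      (∀ w ∈ ball (0 : ℂ) 1, φ (ψ w) = w) ∧ (∀ z ∈ G, ψ (φ z) = z) := by
  have hdo : DifferentiableOn ℂ φ G := fun z hz => (hd z hz).differentiableWithinAt
  have han : AnalyticOnNhd ℂ φ G := hdo.analyticOnNhd hG
  have hinv := hb.invOn_invFunOn
  set ψ := Function.invFunOn φ G with hψ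
  have hmaps : MapsTo ψ (ball 0 1) G := hb.surjOn.mapsTo_invFunOn
  have hopen : ∀ s ⊆ G, IsOpen s → IsOpen (φ '' s) := by
    rcases han.is_constant_or_isOpen hGc with ⟨w, hw⟩ | h
    · exfalso
      have h0 := hinv.2 (show (0 : ℂ) ∈ ball (0 : ℂ) 1 by simp)
      have h1 := hinv.2 (show (1 / 2 : ℂ) ∈ ball (0 : ℂ) 1 by simp; norm_num)
      have e0 := hw _ (hmaps (show (0 : ℂ) ∈ ball (0 : ℂ) 1 by simp))
      have e1 := hw _ (hmaps (show (1 / 2 : ℂ) ∈ ball (0 : ℂ) 1 by simp; norm_num))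
      rw [h0] at e0; rw [h1, ← e0] at e1
      norm_num at e1
    · exact h
  have hcont : ∀ w ∈ ball (0 : ℂ) 1, ContinuousAt ψ w := by
    intro w hw
    rw [ContinuousAt, _root_.tendsto_nhds]
    intro s hs hws
    refine mem_of_superset ((hopen (s ∩ G) inter_subset_right (hs.inter hG)).mem_nhds
      ⟨ψ w, ⟨hws, hmaps hw⟩, hinv.2 hw⟩) ?_
    rintro _ ⟨z, ⟨hz, hzG⟩, rfl⟩
    show ψ (φ z) ∈ s
    rwa [hinv.1 hzG]
  have hder : ∀ w ∈ ball (0 : ℂ) 1, deriv φ (ψ w) ≠ 0 → DifferentiableAt ℂ ψ w := by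
    intro w hw hne
    refine (HasDerivAt.of_local_left_inverse (hcont w hw) (hd _ (hmaps hw)).hasDerivAt hne
      ?_).differentiableAt
    filter_upwards [isOpen_ball.mem_nhds hw] with y hy using hinv.2 hy
  refine ⟨ψ, ?_, hmaps, fun w hw => hinv.2 hw, fun z hz => hinv.1 hz⟩
  intro w hw
  refine (Complex.analyticAt_of_differentiable_on_punctured_nhds_of_continuousAt ?_
    (hcont w hw)).differentiableAt.differentiableWithinAt
  rcases (han _ (hmaps hw)).deriv.eventually_eq_zero_or_eventually_ne_zero with h | h
  · exfalso
    have h2 := h.and (hG.mem_nhds (hmaps hw))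
    obtain ⟨r, hr, hr2⟩ := Metric.eventually_nhds_iff_ball.1 h2
    have hz1 : ψ w ∈ ball (ψ w) r := mem_ball_self hr
    have hz2 : ψ w + (r / 2 : ℝ) ∈ ball (ψ w) r := by
      simp [abs_of_pos hr, hr]
    have := isOpen_ball.is_const_of_deriv_eq_zero (convex_ball (ψ w) r).isPreconnected
      (hdo.mono fun z hz => (hr2 z hz).2) (fun z hz => (hr2 z hz).1) hz1 hz2
    have := hb.injOn (hr2 _ hz1).2 (hr2 _ hz2).2 this
    simp at this
    exact hr.ne' this
  · have hT : Tendsto ψ (nhdsWithin w {w}ᶜ) (nhdsWithin (ψ w) {ψ w}ᶜ) := by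
      refine tendsto_nhdsWithin_iff.2 ⟨(hcont w hw).tendsto.mono_left nhdsWithin_le_nhds, ?_⟩
      filter_upwards [self_mem_nhdsWithin, nhdsWithin_le_nhds (isOpen_ball.mem_nhds hw)]
        with y hy hyb hE
      apply hy
      have := congrArg φ hE
      rwa [hinv.2 hyb, hinv.2 hw] at this
    filter_upwards [hT.eventually h, nhdsWithin_le_nhds (isOpen_ball.mem_nhds hw)]
      with y hy hyb using hder y hyb hy

theorem aux_area {S : Set ℂ} (hS : IsOpen S) {g : ℂ → ℂ} (hg : DifferentiableOn ℂ g S)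
    (hi : InjOn g S) : ∫⁻ z in S, ENNReal.ofReal (‖deriv g z‖ ^ 2) = volume (g '' S) := by
  have h := lintegral_image_eq_lintegral_abs_det_fderiv_mul volume (f := g) hS.measurableSet
    (f' := fun z => (ContinuousLinearMap.toSpanSingleton ℂ (deriv g z)).restrictScalars ℝ)
    (fun z hz => ((hg.differentiableAt (hS.mem_nhds hz)).hasDerivAt.hasFDerivAt.restrictScalars
      ℝ).hasFDerivWithinAt) hi (fun _ => 1)
  rw [lintegral_one, Measure.restrict_apply_univ] at h
  rw [h]
  congr with z
  simp [ContinuousLinearMap.det, LinearMap.det_restrictScalars, Algebra.norm_complex_apply,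
    Complex.normSq_eq_norm_sq]

theorem aux_strip {g : ℂ → ℂ} (hg : DifferentiableOn ℂ g {z | |z.im| < Real.pi / 2})
    (hi : InjOn g {z | |z.im| < Real.pi / 2})
    (hb : Bornology.IsBounded (g '' {z | |z.im| < Real.pi / 2})) (X ε : ℝ) (hε : 0 < ε) :
    ∃ x < X, ∀ δ : ℝ, 0 ≤ δ → δ < Real.pi / 2 → ‖g (⟨x, δ⟩) - g (⟨x, -δ⟩)‖ ≤ ε := by
  set S : Set ℂ := {z | |z.im| < Real.pi / 2} with hSd
  have hS : IsOpen S := isOpen_lt (by fun_prop) (by fun_prop)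
  have har := aux_area hS hg hi
  have hpi := Real.pi_pos
  set F : ℂ → ENNReal := S.indicator (fun z => ENNReal.ofReal (‖deriv g z‖ ^ 2)) with hF
  have hFm : Measurable F := by
    refine Measurable.indicator ?_ hS.measurableSet
    exact ((measurable_deriv g).norm.pow_const 2).ennreal_ofReal
  rw [← lintegral_indicator hS.measurableSet, ← hF,
    ← (Complex.volume_preserving_equiv_real_prod.symm).lintegral_comp hFm,
    Measure.volume_eq_prod, lintegral_prod _ (by fun_prop)] at har
  have hfin : volume (g '' S) < ⊤ := hb.measure_lt_top
  set η : ℝ := ε / Real.pi with hη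
  have hη0 : 0 < η := by positivity
  obtain ⟨x, hxX, hx⟩ : ∃ x < X, ∫⁻ y, F (⟨x, y⟩) < ENNReal.ofReal (ε * η) := by
    by_contra! hcon
    have h1 : ∫⁻ x in Iio X, ENNReal.ofReal (ε * η) ≤ volume (g '' S) := by
      rw [← har]
      refine (setLIntegral_mono' measurableSet_Iio (fun x hx => hcon x hx)).trans ?_
      exact setLIntegral_le_lintegral _ _
    rw [setLIntegral_const, Real.volume_Iio, ENNReal.mul_top] at h1
    · exact absurd hfin (not_lt.2 h1)
    · simp only [ne_eq, ENNReal.ofReal_eq_zero, not_le]; positivity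
  refine ⟨x, hxX, fun δ hδ hδ2 => ?_⟩
  have hmem : ∀ y ∈ Icc (-δ) δ, (⟨x, y⟩ : ℂ) ∈ S := fun y hy => by
    simp only [hSd, mem_ofPred_eq]; exact (abs_le.2 hy).trans_lt hδ2
  have hdc : ContinuousOn (deriv g) S := (hg.deriv hS).continuousOn
  have hline : Continuous (fun y : ℝ => (⟨x, y⟩ : ℂ)) := by
    have : (fun y : ℝ => (⟨x, y⟩ : ℂ)) = fun y : ℝ => (x : ℂ) + y * I := by
      ext y; simp [Complex.mk_eq_add_mul_I]
    rw [this]; fun_prop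
  have hc : ContinuousOn (fun y : ℝ => ‖deriv g ⟨x, y⟩‖) (Icc (-δ) δ) :=
    (hdc.comp hline.continuousOn hmem).norm
  have hc2 : ContinuousOn (fun y : ℝ => ‖deriv g ⟨x, y⟩‖ ^ 2) (Icc (-δ) δ) := hc.pow 2
  have hsq : ∫ y in (-δ)..δ, ‖deriv g ⟨x, y⟩‖ ^ 2 ≤ ε * η := by
    rw [intervalIntegral.integral_of_le (by linarith),
      integral_eq_lintegral_of_nonneg_ae (ae_of_all _ fun y => by positivity)
        ((hc2.mono Ioc_subset_Icc_self).aestronglyMeasurable measurableSet_Ioc)]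
    refine ENNReal.toReal_le_of_le_ofReal (by positivity) (le_trans ?_ hx.le)
    rw [← lintegral_indicator measurableSet_Ioc]
    refine lintegral_mono fun y => ?_
    by_cases hy : y ∈ Ioc (-δ) δ
    · rw [indicator_of_mem hy, hF, indicator_of_mem (hmem y (Ioc_subset_Icc_self hy))]
    · rw [indicator_of_notMem hy]; exact zero_le
  have hd : ∀ y ∈ Icc (-δ) δ, HasDerivAt (fun y : ℝ => g ⟨x, y⟩) (deriv g ⟨x, y⟩ * I) y := by
    intro y hy
    have h1 := (hg.differentiableAt (hS.mem_nhds (hmem y hy))).hasDerivAt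
    have h2 : HasDerivAt (fun y : ℝ => (⟨x, y⟩ : ℂ)) I y := by
      have : (fun y : ℝ => (⟨x, y⟩ : ℂ)) = fun y : ℝ => (x : ℂ) + y * I := by
        ext y; simp [Complex.mk_eq_add_mul_I]
      rw [this]
      simpa using ((Complex.ofRealCLM.hasDerivAt (x := y)).mul_const I).const_add (x : ℂ)
    exact h1.comp y h2
  have hint : IntervalIntegrable (fun y : ℝ => ‖deriv g ⟨x, y⟩‖ ^ 2) volume (-δ) δ :=
    (hc2.mono (by rw [uIcc_of_le (by linarith)])).intervalIntegrable
  have hI : IntervalIntegrable (fun y : ℝ => η / 2 + ‖deriv g ⟨x, y⟩‖ ^ 2 / (2 * η))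
      volume (-δ) δ := intervalIntegrable_const.add (hint.div_const _)
  have h3 := norm_sub_le_integral_of_norm_deriv_le_of_le (f := fun y : ℝ => g ⟨x, y⟩)
    (B := fun y : ℝ => η / 2 + ‖deriv g ⟨x, y⟩‖ ^ 2 / (2 * η)) (a := -δ) (b := δ)
    (by linarith) (fun y hy => (hd y hy).continuousAt.continuousWithinAt)
    (fun y hy => (hd y (Ioo_subset_Icc_self hy)).differentiableAt.differentiableWithinAt) ?_ hI
  · refine h3.trans ?_
    rw [intervalIntegral.integral_add intervalIntegrable_const (hint.div_const _),
      intervalIntegral.integral_const, intervalIntegral.integral_div, smul_eq_mul]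
    have : (∫ y in (-δ)..δ, ‖deriv g ⟨x, y⟩‖ ^ 2) / (2 * η) ≤ ε / 2 := by
      rw [div_le_iff₀ (by positivity)]; linarith
    have h5 : δ * η ≤ ε / 2 := by
      rw [hη]; rw [mul_div_assoc', div_le_iff₀ hpi]; nlinarith
    linarith
  · refine ae_of_all _ fun y hy => ?_
    rw [(hd y (Ioo_subset_Icc_self hy)).deriv, norm_mul, norm_I, mul_one]
    rw [div_add_div _ _ (by norm_num) (by positivity), le_div_iff₀ (by positivity)]
    nlinarith [sq_nonneg (‖deriv g ⟨x, y⟩‖ - η)]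

structure ConfPair (D : JordanDomain) (φ ψ : ℂ → ℂ) : Prop where
  dψ : DifferentiableOn ℂ ψ (ball 0 1)
  mψ : MapsTo ψ (ball 0 1) D.G
  r : ∀ w ∈ ball (0 : ℂ) 1, φ (ψ w) = w
  l : ∀ z ∈ D.G, ψ (φ z) = z
  mφ : MapsTo φ D.G (ball 0 1)
  cφ : ContinuousOn φ (closure D.G)

namespace ConfPair
variable {D : JordanDomain} {φ ψ : ℂ → ℂ}

theorem cK (D : JordanDomain) : IsCompact (closure D.G) := D.bounded.isCompact_closure

theorem fr_sub (D : JordanDomain) : frontier D.G ⊆ closure D.G := frontier_subset_closure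

theorem norm_le (h : ConfPair D φ ψ) {z : ℂ} (hz : z ∈ closure D.G) : ‖φ z‖ ≤ 1 := by
  have h1 : φ z ∈ closure (φ '' D.G) := h.cφ.image_closure (mem_image_of_mem _ hz)
  have h2 : φ '' D.G ⊆ closedBall 0 1 := by
    rintro _ ⟨x, hx, rfl⟩; exact ball_subset_closedBall (h.mφ hx)
  simpa using closure_minimal h2 isClosed_closedBall h1

theorem norm_fr (h : ConfPair D φ ψ) {z : ℂ} (hz : z ∈ frontier D.G) : ‖φ z‖ = 1 := by
  refine le_antisymm (h.norm_le (fr_sub D hz)) (not_lt.1 fun hlt => ?_)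
  have hb : φ z ∈ ball (0 : ℂ) 1 := by simpa using hlt
  have hc : z ∈ closure D.G := fr_sub D hz
  have : (nhdsWithin z D.G).NeBot := mem_closure_iff_nhdsWithin_neBot.1 hc
  have h1 : Tendsto φ (nhdsWithin z D.G) (nhds (φ z)) :=
    (h.cφ z hc).mono_left (nhdsWithin_mono _ subset_closure)
  have h2 : Tendsto (fun x => ψ (φ x)) (nhdsWithin z D.G) (nhds (ψ (φ z))) :=
    ((h.dψ.differentiableAt (isOpen_ball.mem_nhds hb)).continuousAt.tendsto).comp h1
  have h3 : Tendsto (fun x => ψ (φ x)) (nhdsWithin z D.G) (nhds z) := by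
    refine (tendsto_id.mono_left nhdsWithin_le_nhds).congr' ?_
    filter_upwards [self_mem_nhdsWithin] with x hx using (h.l x hx).symm
  have h4 := tendsto_nhds_unique h2 h3
  have h5 := h.mψ hb
  rw [h4] at h5
  rw [frontier, D.isOpen.interior_eq] at hz
  exact hz.2 h5

theorem subseq (h : ConfPair D φ ψ) {u : ℕ → ℂ} (hu : ∀ n, u n ∈ ball (0 : ℂ) 1) {ξ : ℂ}
    (hξ : ‖ξ‖ = 1) (ht : Tendsto u atTop (nhds ξ)) :
    ∃ z ∈ frontier D.G, φ z = ξ ∧ ∃ k : ℕ → ℕ, StrictMono k ∧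
      Tendsto (fun n => ψ (u (k n))) atTop (nhds z) := by
  obtain ⟨z, hz, k, hk, hkt⟩ := (cK D).tendsto_subseq
    (fun n => subset_closure (h.mψ (hu n)))
  have h1 : Tendsto (fun n => φ (ψ (u (k n)))) atTop (nhds (φ z)) :=
    (h.cφ z hz).tendsto.comp (tendsto_nhdsWithin_iff.2 ⟨hkt, Eventually.of_forall
      fun n => subset_closure (h.mψ (hu _))⟩)
  have h2 : Tendsto (fun n => φ (ψ (u (k n)))) atTop (nhds ξ) :=
    (ht.comp hk.tendsto_atTop).congr fun n => (h.r _ (hu _)).symm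
  have h3 := tendsto_nhds_unique h1 h2
  refine ⟨z, ?_, h3, k, hk, hkt⟩
  rw [frontier, D.isOpen.interior_eq]
  refine ⟨hz, fun hG => ?_⟩
  have := h.mφ hG
  rw [h3] at this; simp [hξ] at this

theorem crosscut (h : ConfPair D φ ψ) {ξ : ℂ} (hξ : ‖ξ‖ = 1) {ε : ℝ} (hε : 0 < ε) :
    ∃ a ∈ frontier D.G, ∃ b ∈ frontier D.G, ∃ e : ℂ, ‖a - b‖ ≤ ε ∧ φ a = ξ * e ∧
      φ b = ξ * (starRingEnd ℂ) e ∧ e.im < 0 ∧ ‖e - 1‖ ≤ ε := by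
  have hpi := Real.pi_pos
  set S : Set ℂ := {z | |z.im| < Real.pi / 2} with hSd
  set T : ℂ → ℂ := fun z => ξ * ((1 - exp z) / (1 + exp z)) with hT
  have hre : ∀ z ∈ S, 0 < (exp z).re := fun z hz => by
    rw [Complex.exp_re]
    exact mul_pos (Real.exp_pos _) (Real.cos_pos_of_mem_Ioo ⟨(abs_lt.1 hz).1, (abs_lt.1 hz).2⟩)
  have hne : ∀ z ∈ S, 1 + exp z ≠ 0 := fun z hz h0 => by
    have := congrArg Complex.re h0
    have := hre z hz
    simp at *; linarith
  have hTb : ∀ z ∈ S, T z ∈ ball (0 : ℂ) 1 := fun z hz => by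
    simp only [hT, mem_ball_zero_iff, norm_mul, hξ, one_mul, norm_div]
    rw [div_lt_one (norm_pos_iff.2 (hne z hz))]
    refine lt_of_pow_lt_pow_left₀ 2 (norm_nonneg _) ?_
    rw [← Complex.normSq_eq_norm_sq, ← Complex.normSq_eq_norm_sq, normSq_apply, normSq_apply]
    have := hre z hz
    simp only [sub_re, sub_im, add_re, add_im, one_re, one_im]
    nlinarith
  have hTd : ∀ z, 1 + exp z ≠ 0 → DifferentiableAt ℂ T z := fun z hz => by
    simp only [hT]
    exact (((differentiableAt_const _).sub differentiableAt_exp).div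
      ((differentiableAt_const _).add differentiableAt_exp) hz).const_mul _
  have hξ0 : ξ ≠ 0 := by rintro rfl; simp at hξ
  have hTi : InjOn T S := by
    intro z hz w hw hzw
    simp only [hT] at hzw
    have h1 := mul_left_cancel₀ hξ0 hzw
    rw [div_eq_div_iff (hne z hz) (hne w hw)] at h1
    have h2 : exp z = exp w := by linear_combination (-1 / 2 : ℂ) * h1
    have h3 := abs_lt.1 (show |z.im| < Real.pi / 2 from hz)
    have h4 := abs_lt.1 (show |w.im| < Real.pi / 2 from hw)
    exact Complex.exp_inj_of_neg_pi_lt_of_le_pi (by linarith) (by linarith) (by linarith)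
      (by linarith) h2
  have hg : DifferentiableOn ℂ (fun z => ψ (T z)) S := fun z hz =>
    ((h.dψ.differentiableAt (isOpen_ball.mem_nhds (hTb z hz))).comp z
      (hTd z (hne z hz))).differentiableWithinAt
  have hgi : InjOn (fun z => ψ (T z)) S := fun z hz w hw hzw => by
    refine hTi hz hw ?_
    have := congrArg φ hzw
    simpa only [h.r _ (hTb z hz), h.r _ (hTb w hw)] using this
  have hgb : Bornology.IsBounded ((fun z => ψ (T z)) '' S) := D.bounded.subset (by
    rintro _ ⟨z, hz, rfl⟩; exact h.mψ (hTb z hz))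
  obtain ⟨x, hx, hxε⟩ := aux_strip hg hgi hgb (Real.log (ε / 2)) ε hε
  have hex : Real.exp x < ε / 2 := (Real.lt_log_iff_exp_lt (by positivity)).1 hx
  set δ : ℕ → ℝ := fun n => Real.pi / 2 - Real.pi / 2 * (1 / ((n : ℝ) + 1)) with hδ
  have hδ1 : ∀ n, 0 ≤ δ n ∧ δ n < Real.pi / 2 := fun n => by
    have h1 : 1 / ((n : ℝ) + 1) ≤ 1 := by
      rw [div_le_one (by positivity)]; linarith [Nat.cast_nonneg (α := ℝ) n]
    have h2 : 0 < 1 / ((n : ℝ) + 1) := by positivity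
    constructor <;> simp only [hδ] <;> nlinarith
  have hδt : Tendsto δ atTop (nhds (Real.pi / 2)) := by
    have := (tendsto_one_div_add_atTop_nhds_zero_nat (𝕜 := ℝ)).const_mul (Real.pi / 2)
    simpa [hδ] using this.const_sub (Real.pi / 2)
  have hS1 : ∀ n, (⟨x, δ n⟩ : ℂ) ∈ S := fun n => by
    simp only [hSd, mem_ofPred_eq]; rw [abs_of_nonneg (hδ1 n).1]; exact (hδ1 n).2
  have hS2 : ∀ n, (⟨x, -δ n⟩ : ℂ) ∈ S := fun n => by
    simp only [hSd, mem_ofPred_eq]; rw [abs_neg, abs_of_nonneg (hδ1 n).1]; exact (hδ1 n).2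
  have hline : Continuous (fun y : ℝ => (⟨x, y⟩ : ℂ)) := by
    have : (fun y : ℝ => (⟨x, y⟩ : ℂ)) = fun y : ℝ => (x : ℂ) + y * I := by
      ext y; simp [Complex.mk_eq_add_mul_I]
    rw [this]; fun_prop
  set e : ℂ := (1 - Real.exp x * I) / (1 + Real.exp x * I) with he
  have hp : exp ⟨x, Real.pi / 2⟩ = Real.exp x * I := by
    apply Complex.ext <;> simp [exp_re, exp_im]
  have hm : exp ⟨x, -(Real.pi / 2)⟩ = -(Real.exp x * I) := by
    apply Complex.ext <;> simp [exp_re, exp_im]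
  have hd1 : 1 + (Real.exp x : ℂ) * I ≠ 0 := fun h0 => by
    have := congrArg Complex.re h0; simp at this
  have hd2 : 1 - (Real.exp x : ℂ) * I ≠ 0 := fun h0 => by
    have := congrArg Complex.re h0; simp at this
  have hec : (starRingEnd ℂ) e = (1 + Real.exp x * I) / (1 - Real.exp x * I) := by
    simp only [he, map_div₀, map_sub, map_add, map_mul, map_one, conj_I, conj_ofReal]
    ring
  have hen : ‖e‖ = 1 := by
    have h1 : 1 - (Real.exp x : ℂ) * I = (starRingEnd ℂ) (1 + (Real.exp x : ℂ) * I) := by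
      simp only [map_add, map_mul, map_one, conj_I, conj_ofReal]; ring
    rw [he, norm_div, h1, RCLike.norm_conj, div_self (norm_ne_zero_iff.2 hd1)]
  have ht1 : Tendsto (fun n => T ⟨x, δ n⟩) atTop (nhds (ξ * e)) := by
    have h1 := (hTd ⟨x, Real.pi / 2⟩ (by rw [hp]; exact hd1)).continuousAt.tendsto.comp
      ((hline.tendsto (Real.pi / 2)).comp hδt)
    have h2 : T ⟨x, Real.pi / 2⟩ = ξ * e := by simp only [hT, hp, he]
    rwa [h2] at h1
  have ht2 : Tendsto (fun n => T ⟨x, -δ n⟩) atTop (nhds (ξ * (starRingEnd ℂ) e)) := by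
    have h1 := (hTd ⟨x, -(Real.pi / 2)⟩ (by rw [hm]; exact hd2)).continuousAt.tendsto.comp
      ((hline.tendsto (-(Real.pi / 2))).comp hδt.neg)
    have h2 : T ⟨x, -(Real.pi / 2)⟩ = ξ * (starRingEnd ℂ) e := by
      simp only [hT, hm, hec, sub_neg_eq_add]; ring
    rwa [h2] at h1
  obtain ⟨a, ha, hae, k, hk, hkt⟩ := h.subseq (fun n => hTb _ (hS1 n))
    (by rw [norm_mul, hξ, hen, one_mul]) ht1
  obtain ⟨b, hb, hbe, j, hj, hjt⟩ := h.subseq (fun n => hTb _ (hS2 (k n)))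
    (by rw [norm_mul, hξ, RCLike.norm_conj, hen, one_mul]) (ht2.comp hk.tendsto_atTop)
  refine ⟨a, ha, b, hb, e, ?_, hae, hbe, ?_, ?_⟩
  · refine le_of_tendsto ((hkt.comp hj.tendsto_atTop).sub hjt).norm (Eventually.of_forall fun n => ?_)
    exact hxε _ (hδ1 _).1 (hδ1 _).2
  · have h1 : e = ((1 - Real.exp x ^ 2 : ℝ) - (2 * Real.exp x : ℝ) * I)
        / ((1 + Real.exp x ^ 2 : ℝ) : ℂ) := by
      rw [he, div_eq_div_iff hd1 (by exact_mod_cast (by positivity : 1 + Real.exp x ^ 2 ≠ 0))]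
      generalize Real.exp x = y
      push_cast
      linear_combination 2 * (y : ℂ) ^ 2 * I_sq
    rw [h1, div_ofReal_im]
    refine div_neg_of_neg_of_pos ?_ (by positivity)
    have := Real.exp_pos x
    generalize Real.exp x = y at *
    rw [sub_im, ofReal_im, im_ofReal_mul, I_im]; linarith
  · have h1 : e - 1 = -2 * (Real.exp x * I) / (1 + Real.exp x * I) := by
      rw [he]; field_simp; ring
    rw [h1, norm_div]
    refine (div_le_self (norm_nonneg _) ?_).trans ?_
    · refine le_trans ?_ (abs_re_le_norm _); simp
    · simp [-ofReal_exp]; linarith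

end ConfPair

namespace JordanDomain

theorem γ_image (D : JordanDomain) (s0 : ℝ) : D.γ '' Ico s0 (s0 + D.l) = frontier D.G := by
  rw [← D.γ_boundary]
  have e : ∀ a t, D.γ (toIcoMod D.l_pos a t) = D.γ t := fun a t => by
    rw [toIcoMod, D.γ_periodic.sub_zsmul_eq]
  apply Subset.antisymm
  · rintro _ ⟨t, -, rfl⟩
    exact ⟨_, by simpa using toIcoMod_mem_Ico D.l_pos 0 t, e 0 t⟩
  · rintro _ ⟨t, -, rfl⟩
    exact ⟨_, toIcoMod_mem_Ico D.l_pos s0 t, e s0 t⟩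

theorem γ_inj (D : JordanDomain) (s0 : ℝ) : InjOn D.γ (Ico s0 (s0 + D.l)) := by
  intro x hx y hy hxy
  have e : ∀ t, D.γ (toIcoMod D.l_pos 0 t) = D.γ t := fun t => by
    rw [toIcoMod, D.γ_periodic.sub_zsmul_eq]
  have hm : ∀ t, toIcoMod D.l_pos 0 t ∈ Ico 0 D.l := fun t => by
    simpa using toIcoMod_mem_Ico D.l_pos 0 t
  have h1 : toIcoMod D.l_pos 0 x = toIcoMod D.l_pos 0 y :=
    D.γ_injOn (hm x) (hm y) (by rw [e, e, hxy])
  have h2 : toIcoMod D.l_pos s0 x = toIcoMod D.l_pos s0 y := by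
    rw [toIcoMod_inj] at *; exact h1
  rwa [(toIcoMod_eq_self D.l_pos).2 hx, (toIcoMod_eq_self D.l_pos).2 hy] at h2

theorem γ_mem (D : JordanDomain) (s : ℝ) : D.γ s ∈ frontier D.G := by
  rw [← D.γ_image s]; exact ⟨s, ⟨le_refl _, by linarith [D.l_pos]⟩, rfl⟩

theorem γ_loc (D : JordanDomain) {s0 c δ : ℝ} (hc : c ∈ Ioo s0 (s0 + D.l)) (hδ : 0 < δ) :
    ∀ᶠ a in nhds (D.γ c), a ∈ frontier D.G → ∃ s ∈ Ioo (c - δ) (c + δ), D.γ s = a := by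
  have hcl : IsClosed (D.γ '' (Icc s0 (s0 + D.l) \ Ioo (c - δ) (c + δ))) :=
    ((isCompact_Icc.diff isOpen_Ioo).image D.γ_cont).isClosed
  have hn : D.γ c ∉ D.γ '' (Icc s0 (s0 + D.l) \ Ioo (c - δ) (c + δ)) := by
    rintro ⟨s, ⟨hs, hs2⟩, he⟩
    rcases eq_or_lt_of_le hs.2 with h | h
    · have : D.γ s0 = D.γ c := by rw [← he, h, D.γ_periodic]
      have := D.γ_inj s0 ⟨le_refl _, by linarith [D.l_pos]⟩ ⟨hc.1.le, hc.2⟩ this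
      exact hc.1.ne this
    · have := D.γ_inj s0 ⟨hs.1, h⟩ ⟨hc.1.le, hc.2⟩ he
      subst this
      exact hs2 ⟨by linarith, by linarith⟩
  filter_upwards [hcl.isOpen_compl.mem_nhds hn] with a ha haL
  rw [← D.γ_image s0] at haL
  obtain ⟨s, hs, rfl⟩ := haL
  refine ⟨s, ?_, rfl⟩
  by_contra hcon
  exact ha ⟨s, ⟨Ico_subset_Icc_self hs, hcon⟩, rfl⟩

end JordanDomain

namespace ConfPair
variable {D : JordanDomain} {φ ψ : ℂ → ℂ}

/-- near a boundary point of the disc, ψ is close to the fibre -/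
theorem near_fibre (h : ConfPair D φ ψ) {ξ : ℂ} (hξ : ‖ξ‖ = 1) {U : Set ℂ} (hU : IsOpen U)
    (hUf : ∀ z ∈ frontier D.G, φ z = ξ → z ∈ U) :
    ∃ ρ > 0, ∀ w ∈ ball (0 : ℂ) 1 ∩ ball ξ ρ, ψ w ∈ U := by
  by_contra! hcon
  choose! u hu using fun n : ℕ => hcon (1 / ((n : ℝ) + 1)) (by positivity)
  have ht : Tendsto u atTop (nhds ξ) := by
    rw [tendsto_iff_dist_tendsto_zero]
    refine squeeze_zero (fun _ => dist_nonneg) (fun n => (mem_ball.1 (hu n).1.2).le) ?_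
    exact tendsto_one_div_add_atTop_nhds_zero_nat
  obtain ⟨z, hz, hze, k, hk, hkt⟩ := h.subseq (fun n => (hu n).1.1) hξ ht
  have := hU.isClosed_compl.mem_of_tendsto hkt (Eventually.of_forall fun n => (hu _).2)
  exact this (hUf z hz hze)

theorem exists_near (h : ConfPair D φ ψ) {z : ℂ} (hz : z ∈ frontier D.G) {U : Set ℂ}
    (hU : IsOpen U) (hzU : z ∈ U) {ρ : ℝ} (hρ : 0 < ρ) :
    ∃ w ∈ ball (0 : ℂ) 1 ∩ ball (φ z) ρ, ψ w ∈ U := by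
  have hc := fr_sub D hz
  have : (nhdsWithin z D.G).NeBot := mem_closure_iff_nhdsWithin_neBot.1 hc
  have h1 : Tendsto φ (nhdsWithin z D.G) (nhds (φ z)) :=
    (h.cφ z hc).mono_left (nhdsWithin_mono _ subset_closure)
  obtain ⟨x, hx1, hx2, hx3⟩ : ∃ x, φ x ∈ ball (φ z) ρ ∧ x ∈ D.G ∧ x ∈ U := by
    refine Eventually.exists (f := nhdsWithin z D.G) ?_
    filter_upwards [h1.eventually (ball_mem_nhds _ hρ), self_mem_nhdsWithin,
      nhdsWithin_le_nhds (hU.mem_nhds hzU)] with x a b c using ⟨a, b, c⟩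
  exact ⟨φ x, ⟨h.mφ hx2, hx1⟩, by rw [h.l x hx2]; exact hx3⟩

theorem no_split (h : ConfPair D φ ψ) {ξ : ℂ} (hξ : ‖ξ‖ = 1) {A B : Set ℂ} (hA : IsCompact A)
    (hB : IsCompact B) (hd : Disjoint A B)
    (hAB : ∀ z ∈ frontier D.G, φ z = ξ → z ∈ A ∪ B) {a b : ℂ} (ha : a ∈ A) (hb : b ∈ B)
    (haL : a ∈ frontier D.G) (hbL : b ∈ frontier D.G) (hae : φ a = ξ) (hbe : φ b = ξ) : False := by
  obtain ⟨U, V, hU, hV, hAU, hBV, hUV⟩ := SeparatedNhds.of_isCompact_isCompact hA hB hd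
  obtain ⟨ρ, hρ, hρ2⟩ := h.near_fibre hξ (hU.union hV) (fun z hz hze =>
    (hAB z hz hze).imp (fun x => hAU x) (fun x => hBV x))
  obtain ⟨w1, hw1, hw1U⟩ := h.exists_near haL hU (hAU ha) hρ
  obtain ⟨w2, hw2, hw2V⟩ := h.exists_near hbL hV (hBV hb) hρ
  rw [hae] at hw1; rw [hbe] at hw2
  have hpre : IsPreconnected (ψ '' (ball (0 : ℂ) 1 ∩ ball ξ ρ)) :=
    (((convex_ball _ _).inter (convex_ball _ _)).isPreconnected).image _
      (h.dψ.continuousOn.mono inter_subset_left)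
  obtain ⟨z, _, hz⟩ := hpre U V hU hV (by rintro _ ⟨w, hw, rfl⟩; exact hρ2 w hw)
    ⟨_, ⟨w1, hw1, rfl⟩, hw1U⟩ ⟨_, ⟨w2, hw2, rfl⟩, hw2V⟩
  exact disjoint_left.1 hUV hz.1 hz.2

theorem inj_aux (h : ConfPair D φ ψ) {ξ : ℂ} (hξ : ‖ξ‖ = 1) {c y : ℂ} (hc : c ∈ frontier D.G)
    (hy : y ∈ frontier D.G) (hyc : y ≠ c) (hφc : φ c = ξ) (hφy : φ y = ξ)
    (hac : ∀ ε > 0, ∃ a ∈ frontier D.G, ∃ b ∈ frontier D.G, ∃ e : ℂ, ‖a - c‖ < ε ∧ ‖b - c‖ < ε ∧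
      φ a = ξ * e ∧ φ b = ξ * (starRingEnd ℂ) e ∧ e.im < 0) : False := by
  rw [← D.γ_image 0] at hy
  obtain ⟨s0, -, rfl⟩ := hy
  have hc' := hc
  rw [← D.γ_image s0] at hc'
  obtain ⟨c, hcm, rfl⟩ := hc'
  have hcs : c ≠ s0 := by rintro rfl; exact hyc rfl
  have hcI : c ∈ Ioo s0 (s0 + D.l) := ⟨lt_of_le_of_ne hcm.1 hcs.symm, hcm.2⟩
  have hfc : Continuous fun s => φ (D.γ s) :=
    h.cφ.comp_continuous D.γ_cont fun s => fr_sub D (D.γ_mem s)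
  have hξ0 : ξ ≠ 0 := by rintro rfl; simp at hξ
  obtain ⟨δ, hδ, hδ2⟩ : ∃ δ > 0, ∀ s ∈ Ioo (c - δ) (c + δ), s ∈ Ioo s0 (s0 + D.l) ∧
      ‖φ (D.γ s) - ξ‖ < 1 := by
    have h1 : ∀ᶠ s in nhds c, s ∈ Ioo s0 (s0 + D.l) ∧ ‖φ (D.γ s) - ξ‖ < 1 := by
      refine Eventually.and (isOpen_Ioo.mem_nhds hcI) ?_
      refine (((hfc.sub continuous_const).norm).tendsto c).eventually (gt_mem_nhds ?_)
      simp [hφc]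
    obtain ⟨δ, hδ, hh⟩ := Metric.eventually_nhds_iff_ball.1 h1
    exact ⟨δ, hδ, fun s hs => hh s (by rwa [Real.ball_eq_Ioo])⟩
  obtain ⟨ε, hε, hε2⟩ := Metric.eventually_nhds_iff_ball.1 (D.γ_loc hcI hδ)
  obtain ⟨a, ha, b, hb, e, hac1, hbc1, hae, hbe, hei⟩ := hac ε hε
  obtain ⟨s, hs, rfl⟩ := hε2 a (by rwa [mem_ball, dist_eq_norm]) ha
  obtain ⟨t, ht, rfl⟩ := hε2 b (by rwa [mem_ball, dist_eq_norm]) hb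
  have hst : uIcc s t ⊆ Ioo (c - δ) (c + δ) := (ordConnected_Ioo).uIcc_subset hs ht
  obtain ⟨u, hu, hu0⟩ : ∃ u ∈ uIcc s t, (φ (D.γ u) / ξ).im = 0 := by
    have h1 := intermediate_value_uIcc (f := fun u => (φ (D.γ u) / ξ).im) (a := s) (b := t)
      (continuous_im.comp (hfc.div_const ξ)).continuousOn
    have h2 : (0 : ℝ) ∈ uIcc (φ (D.γ s) / ξ).im (φ (D.γ t) / ξ).im := by
      rw [hae, hbe, mul_div_cancel_left₀ _ hξ0, mul_div_cancel_left₀ _ hξ0, conj_im, mem_uIcc]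
      left; constructor <;> linarith
    exact h1 h2
  have huξ : φ (D.γ u) = ξ := by
    have h1 : ‖φ (D.γ u) / ξ‖ = 1 := by rw [norm_div, hξ, h.norm_fr (D.γ_mem u), div_one]
    have h2 : ‖φ (D.γ u) / ξ - 1‖ < 1 := by
      have := (hδ2 u (hst hu)).2
      rw [div_sub_one hξ0, norm_div, hξ, div_one]; exact this
    set q := φ (D.γ u) / ξ with hq
    have h3 : q = (q.re : ℂ) := by apply Complex.ext <;> simp [hu0]
    have h4 : q = 1 := by
      rw [h3, norm_real, Real.norm_eq_abs] at h1
      rw [h3, ← ofReal_one, ← ofReal_sub, norm_real, Real.norm_eq_abs] at h2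
      rw [h3]
      rcases (abs_eq zero_le_one).1 h1 with h5 | h5
      · rw [h5]; simp
      · rw [h5] at h2; norm_num at h2
    rw [hq, div_eq_one_iff_eq hξ0] at h4; exact h4
  have hends : ∀ x, x = s ∨ x = t → φ (D.γ x) ≠ ξ := by
    intro x hx hxe
    have h1 : (φ (D.γ x) / ξ).im = 0 := by rw [hxe, div_self hξ0]; simp
    rcases hx with rfl | rfl
    · rw [hae, mul_div_cancel_left₀ _ hξ0] at h1; linarith
    · rw [hbe, mul_div_cancel_left₀ _ hξ0, conj_im] at h1; linarith
  have hIc : IsClosed {z | z ∈ closure D.G ∧ φ z = ξ} :=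
    h.cφ.preimage_isClosed_of_isClosed isClosed_closure isClosed_singleton
  have hl := D.l_pos
  refine h.no_split hξ (A := {z | z ∈ closure D.G ∧ φ z = ξ} ∩ D.γ '' (uIcc s t))
    (B := {z | z ∈ closure D.G ∧ φ z = ξ} ∩ D.γ '' (Icc s0 (s0 + D.l) \ uIoo s t))
    ((isCompact_uIcc.image D.γ_cont).inter_left hIc)
    (((isCompact_Icc.diff isOpen_Ioo).image D.γ_cont).inter_left hIc) ?_ ?_
    (a := D.γ u) (b := D.γ s0)
    ⟨⟨fr_sub D (D.γ_mem u), huξ⟩, u, hu, rfl⟩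
    ⟨⟨fr_sub D (D.γ_mem s0), hφy⟩, s0, ⟨⟨le_refl _, by linarith⟩, ?_⟩, rfl⟩
    (D.γ_mem u) (D.γ_mem s0) huξ hφy
  · rw [disjoint_left]
    rintro _ ⟨⟨-, hx⟩, x, hxm, rfl⟩ ⟨-, x', ⟨hx'm, hx'n⟩, hxx⟩
    have hxI := (hδ2 x (hst hxm)).1
    have hx' : x' < s0 + D.l := by
      refine lt_of_le_of_ne hx'm.2 ?_
      rintro rfl
      rw [D.γ_periodic] at hxx
      have := D.γ_inj s0 ⟨le_refl _, by linarith⟩ ⟨hxI.1.le, hxI.2⟩ hxx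
      exact hxI.1.ne this
    have := D.γ_inj s0 ⟨hx'm.1, hx'⟩ ⟨hxI.1.le, hxI.2⟩ hxx
    subst this
    refine hends x' ?_ hx
    rcases le_total s t with hle | hle
    · rw [uIcc_of_le hle] at hxm; rw [uIoo_of_le hle] at hx'n
      by_contra! hh
      exact hx'n ⟨lt_of_le_of_ne hxm.1 hh.1.symm, lt_of_le_of_ne hxm.2 hh.2⟩
    · rw [uIcc_of_ge hle] at hxm; rw [uIoo_of_ge hle] at hx'n
      by_contra! hh
      exact hx'n ⟨lt_of_le_of_ne hxm.1 hh.2.symm, lt_of_le_of_ne hxm.2 hh.1⟩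
  · intro z hz hze
    have hz' := hz
    rw [← D.γ_image s0] at hz'
    obtain ⟨x, hx, rfl⟩ := hz'
    by_cases hxu : x ∈ uIcc s t
    · exact Or.inl ⟨⟨fr_sub D hz, hze⟩, x, hxu, rfl⟩
    · exact Or.inr ⟨⟨fr_sub D hz, hze⟩, x, ⟨Ico_subset_Icc_self hx,
        fun hh => hxu (uIoo_subset_uIcc_self hh)⟩, rfl⟩
  · intro hh
    have := (hδ2 s0 (hst (uIoo_subset_uIcc_self hh))).1
    exact lt_irrefl _ this.1

theorem inj_fr (h : ConfPair D φ ψ) : InjOn φ (frontier D.G) := by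
  intro y1 h1 y2 h2 he
  by_contra hne
  have hξ := h.norm_fr h1
  have hLc : IsCompact (frontier D.G) := (cK D).of_isClosed_subset isClosed_frontier (fr_sub D)
  choose a ha b hb e hab hae hbe hei hen using
    fun n : ℕ => h.crosscut hξ (ε := 1 / ((n : ℝ) + 1)) (by positivity)
  obtain ⟨c, hc, k, hk, hkt⟩ := hLc.tendsto_subseq ha
  have h0 : Tendsto (fun n => 1 / (((k n : ℕ) : ℝ) + 1)) atTop (nhds 0) :=
    tendsto_one_div_add_atTop_nhds_zero_nat.comp hk.tendsto_atTop
  have hac : Tendsto (fun n => ‖a (k n) - c‖) atTop (nhds 0) := by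
    simpa using (hkt.sub_const c).norm
  have hbc : Tendsto (fun n => ‖b (k n) - c‖) atTop (nhds 0) := by
    refine squeeze_zero (fun _ => norm_nonneg _) (fun n => ?_) (by have := h0.add hac; rwa [add_zero] at this)
    calc ‖b (k n) - c‖ = ‖(a (k n) - c) - (a (k n) - b (k n))‖ := by congr 1; ring
      _ ≤ _ := by rw [add_comm]; exact (norm_sub_le _ _).trans (add_le_add le_rfl (hab _))
  have hφc : φ c = φ y1 := by
    have t1 : Tendsto (fun n => φ (a (k n))) atTop (nhds (φ c)) :=
      (h.cφ c (fr_sub D hc)).tendsto.comp (tendsto_nhdsWithin_iff.2 ⟨hkt, Eventually.of_forall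
        fun n => fr_sub D (ha _)⟩)
    have t2 : Tendsto (fun n => e (k n)) atTop (nhds 1) := by
      rw [tendsto_iff_norm_sub_tendsto_zero]
      exact squeeze_zero (fun _ => norm_nonneg _) (fun n => hen _) h0
    have t3 := t2.const_mul (φ y1)
    rw [mul_one] at t3
    exact tendsto_nhds_unique t1 (t3.congr fun n => (hae _).symm)
  have hex : ∀ ε > 0, ∃ a ∈ frontier D.G, ∃ b ∈ frontier D.G, ∃ e : ℂ, ‖a - c‖ < ε ∧ ‖b - c‖ < ε ∧
      φ a = φ y1 * e ∧ φ b = φ y1 * (starRingEnd ℂ) e ∧ e.im < 0 := by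
    intro ε hε
    obtain ⟨n, hn1, hn2⟩ := ((hac.eventually (gt_mem_nhds hε)).and
      (hbc.eventually (gt_mem_nhds hε))).exists
    exact ⟨_, ha (k n), _, hb (k n), _, hn1, hn2, hae _, hbe _, hei _⟩
  by_cases hy : y1 = c
  · exact h.inj_aux hξ hc h2 (fun hh => hne (hy.trans hh.symm)) hφc he.symm hex
  · exact h.inj_aux hξ hc h1 hy hφc rfl hex

end ConfPair

structure DiscModel (D : JordanDomain) (φ ψ : ℂ → ℂ) : Prop where
  cψ : ContinuousOn ψ (closedBall 0 1)
  dψ : DifferentiableOn ℂ ψ (ball 0 1)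
  mψ : MapsTo ψ (ball 0 1) D.G
  sψ : MapsTo ψ (sphere 0 1) (frontier D.G)
  mφ : MapsTo φ D.G (ball 0 1)
  sφ : MapsTo φ (frontier D.G) (sphere 0 1)
  r : ∀ w ∈ closedBall (0 : ℂ) 1, φ (ψ w) = w
  l : ∀ z ∈ closure D.G, ψ (φ z) = z
  cφ : ContinuousOn φ (closure D.G)

theorem closure_eq_union (D : JordanDomain) : closure D.G = D.G ∪ frontier D.G := by
  rw [frontier, D.isOpen.interior_eq, union_sdiff_cancel subset_closure]

theorem ConfPair.model {D : JordanDomain} {φ ψ : ℂ → ℂ} (h : ConfPair D φ ψ) :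
    ∃ ψ' : ℂ → ℂ, DiscModel D φ ψ' := by
  have hcl := closure_eq_union D
  have hsφ : MapsTo φ (frontier D.G) (sphere 0 1) := fun z hz => by simpa using h.norm_fr hz
  have hinj : InjOn φ (closure D.G) := by
    rw [hcl]
    have key : ∀ z ∈ D.G, ∀ w ∈ frontier D.G, φ z ≠ φ w := fun z hz w hw he => by
      have h1 := h.mφ hz
      have h2 := h.norm_fr hw
      rw [he] at h1; simp [h2] at h1
    rintro z (hz | hz) w (hw | hw) he
    · rw [← h.l z hz, ← h.l w hw, he]
    · exact absurd he (key z hz w hw)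
    · exact absurd he.symm (key w hw z hz)
    · exact h.inj_fr hz hw he
  have hsurj : SurjOn φ (closure D.G) (closedBall 0 1) := by
    intro w hw
    rw [← ball_union_sphere] at hw
    rcases hw with hw | hw
    · exact ⟨ψ w, subset_closure (h.mψ hw), h.r w hw⟩
    · have hw1 : ‖w‖ = 1 := by simpa using hw
      have hn : ∀ n : ℕ, (n : ℝ) / (n + 1) < 1 := fun n => by
        rw [div_lt_one (by positivity)]; linarith
      obtain ⟨z, hz, hze, -⟩ := h.subseq (u := fun n : ℕ => (((n : ℝ) / (n + 1) : ℝ) : ℂ) * w)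
        (fun n => by
          have h1 := hn n
          have h2 : 0 ≤ (n : ℝ) / (n + 1) := by positivity
          rw [mem_ball_zero_iff, norm_mul, hw1, mul_one, norm_real, Real.norm_of_nonneg h2]
          exact h1) hw1 (by
          have h1 : Tendsto (fun n : ℕ => (n : ℝ) / (n + 1)) atTop (nhds 1) :=
            tendsto_natCast_div_add_atTop (1 : ℝ)
          have h2 := ((Complex.continuous_ofReal.tendsto 1).comp h1).mul_const w
          simpa using h2)
      exact ⟨z, ConfPair.fr_sub D hz, hze⟩
  set ψ' := Function.invFunOn φ (closure D.G) with hψ'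
  have hr : ∀ w ∈ closedBall (0 : ℂ) 1, φ (ψ' w) = w := fun w hw =>
    Function.invFunOn_eq (hsurj hw)
  have hm : ∀ w ∈ closedBall (0 : ℂ) 1, ψ' w ∈ closure D.G := fun w hw =>
    Function.invFunOn_mem (hsurj hw)
  have hl : ∀ z ∈ closure D.G, ψ' (φ z) = z := fun z hz =>
    hinj.leftInvOn_invFunOn hz
  have hmc : ∀ z ∈ closure D.G, φ z ∈ closedBall (0 : ℂ) 1 := fun z hz => by
    simpa using h.norm_le hz
  have heq : EqOn ψ' ψ (ball 0 1) := fun w hw => by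
    have := hl (ψ w) (subset_closure (h.mψ hw))
    rwa [h.r w hw] at this
  refine ⟨ψ', ?_, h.dψ.congr heq, fun w hw => by rw [heq hw]; exact h.mψ hw, ?_, h.mφ, hsφ, hr,
    hl, h.cφ⟩
  · rw [continuousOn_iff_isClosed]
    intro t ht
    have hcpt : IsCompact (φ '' (closure D.G ∩ t)) :=
      ((ConfPair.cK D).inter_right ht).image_of_continuousOn (h.cφ.mono inter_subset_left)
    refine ⟨_, hcpt.isClosed, ?_⟩
    ext w
    constructor
    · rintro ⟨h1, h2⟩
      exact ⟨⟨ψ' w, ⟨hm w h2, h1⟩, hr w h2⟩, h2⟩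
    · rintro ⟨⟨z, ⟨hz1, hz2⟩, rfl⟩, h2⟩
      exact ⟨by rw [mem_preimage, hl z hz1]; exact hz2, h2⟩
  · intro w hw
    have h1 := hm w (sphere_subset_closedBall hw)
    rw [hcl] at h1
    rcases h1 with h1 | h1
    · have h2 := h.mφ h1
      rw [hr w (sphere_subset_closedBall hw)] at h2
      simp at h2 hw; linarith
    · exact h1

namespace DiscModel
variable {D : JordanDomain} {φ ψ : ℂ → ℂ}

theorem mcψ (h : DiscModel D φ ψ) : MapsTo ψ (closedBall 0 1) (closure D.G) := fun w hw => by
  rw [closure_eq_union]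
  rw [← ball_union_sphere] at hw
  exact hw.imp (fun x => h.mψ x) (fun x => h.sψ x)

theorem mcφ (h : DiscModel D φ ψ) : MapsTo φ (closure D.G) (closedBall 0 1) := fun w hw => by
  rw [← ball_union_sphere]
  rw [closure_eq_union] at hw
  exact hw.imp (fun x => h.mφ x) (fun x => h.sφ x)

/-- retraction of the plane to the closed disc -/
noncomputable def ret (w : ℂ) : ℂ := ((max 1 ‖w‖ : ℝ) : ℂ)⁻¹ * w

theorem ret_cont : Continuous ret := by
  refine Continuous.mul (Continuous.inv₀ (by fun_prop) fun w => ?_) continuous_id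
  exact_mod_cast (lt_of_lt_of_le one_pos (le_max_left 1 ‖w‖)).ne'

theorem ret_mem (w : ℂ) : ret w ∈ closedBall (0 : ℂ) 1 := by
  have h0 : 0 < max 1 ‖w‖ := lt_of_lt_of_le one_pos (le_max_left 1 ‖w‖)
  rw [mem_closedBall_zero_iff, ret, norm_mul, norm_inv, norm_real, Real.norm_of_nonneg h0.le,
    inv_mul_le_iff₀ h0, mul_one]
  exact le_max_right _ _

theorem ret_eq {w : ℂ} (hw : w ∈ closedBall (0 : ℂ) 1) : ret w = w := by
  rw [mem_closedBall_zero_iff] at hw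
  simp [ret, max_eq_left hw]

theorem ret_cψ (h : DiscModel D φ ψ) : Continuous fun w => ψ (ret w) :=
  h.cψ.comp_continuous ret_cont ret_mem

end DiscModel

theorem aux_log {U : Set ℂ} (hU : IsOpen U) (hc : Convex ℝ U) (hn : U.Nonempty) {g : ℂ → ℂ}
    (hg : ContinuousOn g U) (h0 : ∀ z ∈ U, g z ≠ 0) :
    ∃ f : ℂ → ℂ, ContinuousOn f U ∧ ∀ z ∈ U, exp (f z) = g z := by
  have hs : IsSimplyConnected U := by
    have := hc.contractibleSpace hn
    exact SimplyConnectedSpace.ofContractible U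
  obtain ⟨f, hf, hf2⟩ := Complex.exists_continuousOn_eqOn_exp_comp hs hU hg (by
    rintro ⟨z, hz, he⟩; exact h0 z hz he)
  exact ⟨f, hf, fun z hz => hf2 hz⟩

theorem aux_nolog {a : ℂ} {R : ℝ} (hR : 0 < R) {f : ℂ → ℂ} (hf : ContinuousOn f (sphere a R))
    (he : ∀ z ∈ sphere a R, exp (f z) = z - a) : False := by
  have hm : ∀ θ : ℝ, circleMap a R θ ∈ sphere a R := fun θ => circleMap_mem_sphere a hR.le θ
  set k : ℝ → ℂ := fun θ => f (circleMap a R θ) - θ * I with hk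
  have hkc : Continuous k :=
    (hf.comp_continuous (continuous_circleMap a R) hm).sub (by fun_prop)
  have hek : ∀ θ, exp (k θ) = R := fun θ => by
    rw [hk]; simp only [exp_sub]
    rw [he _ (hm θ), circleMap_sub_center, circleMap_zero, mul_div_assoc, div_self (exp_ne_zero _),
      mul_one]
  have h1 := Complex.isCoveringMap_exp.const_of_comp hkc (fun a a' => by
    simp only [hek]) 0 (2 * Real.pi)
  simp only [hk] at h1
  have h2 : circleMap a R (2 * Real.pi) = circleMap a R 0 := by
    simp [circleMap]
  rw [h2] at h1
  have h3 : (2 * Real.pi : ℂ) * I = 0 := by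
    push_cast at h1
    linear_combination h1
  simp [Real.pi_ne_zero] at h3

theorem aux_outer (R : ℝ) (hR : 0 < R) : IsPreconnected {z : ℂ | R < ‖z‖} := by
  have h1 : {z : ℂ | R < ‖z‖} = exp '' {z : ℂ | Real.log R < z.re} := by
    ext z
    constructor
    · intro hz
      have hz0 : z ≠ 0 := by rintro rfl; simp at hz; linarith
      refine ⟨log z, ?_, exp_log hz0⟩
      simp only [mem_ofPred_eq, log_re]
      exact Real.log_lt_log hR hz
    · rintro ⟨w, hw, rfl⟩
      simp only [mem_ofPred_eq, norm_exp] at *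
      exact (Real.log_lt_iff_lt_exp hR).1 hw
  rw [h1]
  exact ((convex_halfSpace_re_gt _).isPreconnected).image _ continuous_exp.continuousOn

namespace DiscModel
variable {D : JordanDomain} {φ ψ : ℂ → ℂ}

theorem unbdd (h : DiscModel D φ ψ) {x : ℂ} (hx : x ∈ (closure D.G)ᶜ) :
    ¬ Bornology.IsBounded (connectedComponentIn (closure D.G)ᶜ x) := by
  intro hb
  set Ω := (closure D.G)ᶜ with hΩ
  have hΩo : IsOpen Ω := isClosed_closure.isOpen_compl
  set V := connectedComponentIn Ω x with hV
  have hVo : IsOpen V := hΩo.connectedComponentIn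
  have hxV : x ∈ V := mem_connectedComponentIn hx
  have hfr : frontier V ⊆ closure D.G := by
    intro y hy
    by_contra hyΩ
    have hy1 : y ∈ connectedComponentIn Ω y := mem_connectedComponentIn hyΩ
    rw [hVo.frontier_eq] at hy
    obtain ⟨z, hz1, hz2⟩ := mem_closure_iff.1 hy.1 _ hΩo.connectedComponentIn hy1
    have e1 := connectedComponentIn_eq hz1
    have e2 := connectedComponentIn_eq hz2
    rw [e1, ← e2] at hy1
    exact hy.2 hy1
  obtain ⟨F, hF, hFe⟩ := aux_log isOpen_univ convex_univ ⟨0, mem_univ _⟩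
    (g := fun w => ψ (ret w) - x) (h.ret_cψ.sub continuous_const).continuousOn (fun w _ h0 => by
      have := h.mcψ (ret_mem w)
      rw [sub_eq_zero.1 h0] at this; exact hx this)
  rw [continuousOn_univ] at hF
  obtain ⟨f, hf⟩ := ContinuousMap.exists_restrict_eq (isClosed_closure (s := D.G))
    (⟨fun z => F (φ z), hF.comp (continuousOn_iff_continuous_domRestrict.1 h.cφ)⟩ : C(closure D.G, ℂ))
  have hfK : ∀ z ∈ closure D.G, exp (f z) = z - x := by
    intro z hz
    have := DFunLike.congr_fun hf ⟨z, hz⟩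
    simp only [ContinuousMap.restrict_apply, ContinuousMap.coe_mk] at this
    rw [this, hFe _ (mem_univ _), ret_eq (h.mcφ hz), h.l z hz]
  classical
  set g : ℂ → ℂ := V.piecewise (fun z => exp (f z)) (fun z => z - x) with hg
  have hgc : Continuous g := by
    refine continuous_piecewise (fun z hz => hfK z (hfr hz)) ?_ ?_
    · exact (continuous_exp.comp f.continuous).continuousOn
    · exact (continuous_id.sub continuous_const).continuousOn
  have hg0 : ∀ z, g z ≠ 0 := by
    intro z
    by_cases hz : z ∈ V
    · rw [hg, piecewise_eq_of_mem _ _ _ hz]; exact exp_ne_zero _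
    · rw [hg, piecewise_eq_of_notMem _ _ _ hz, sub_ne_zero]; rintro rfl; exact hz hxV
  obtain ⟨q, hq, hqe⟩ := aux_log isOpen_univ convex_univ ⟨0, mem_univ _⟩ hgc.continuousOn
    (fun z _ => hg0 z)
  obtain ⟨R, hR, hRV⟩ := hb.subset_ball_lt 0 x
  refine aux_nolog hR (hq.mono (subset_univ _)) (a := x) fun z hz => ?_
  rw [hqe z (mem_univ _), hg, piecewise_eq_of_notMem]
  intro hzV
  have := hRV hzV
  rw [mem_ball] at this; rw [mem_sphere] at hz; linarith

theorem bddK (D : JordanDomain) : ∃ R > 0, ∀ z ∈ closure D.G, ‖z‖ < R := by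
  obtain ⟨R, hR, h⟩ := (ConfPair.cK D).isBounded.subset_ball_lt 0 0
  exact ⟨R, hR, fun z hz => by simpa using h hz⟩

theorem ext_conn (h : DiscModel D φ ψ) : IsPreconnected (closure D.G)ᶜ := by
  obtain ⟨R, hR, hK⟩ := bddK D
  have hout : {z : ℂ | R < ‖z‖} ⊆ (closure D.G)ᶜ := fun z hz hzK => by
    have := hK z hzK
    exact lt_irrefl _ (this.trans hz)
  have key : ∀ x ∈ (closure D.G)ᶜ, connectedComponentIn (closure D.G)ᶜ x =
      connectedComponentIn (closure D.G)ᶜ ((R + 1 : ℝ) : ℂ) := by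
    intro x hx
    have h1 : ¬ connectedComponentIn (closure D.G)ᶜ x ⊆ closedBall 0 R := fun hs =>
      h.unbdd hx (isBounded_closedBall.subset hs)
    obtain ⟨y, hy, hyR⟩ := not_subset.1 h1
    have hyR' : y ∈ {z : ℂ | R < ‖z‖} := by simpa using hyR
    have h2 : ((R + 1 : ℝ) : ℂ) ∈ {z : ℂ | R < ‖z‖} := by
      simp only [mem_ofPred_eq, norm_real, Real.norm_eq_abs]
      exact lt_of_lt_of_le (by linarith) (le_abs_self _)
    have h3 := (aux_outer R hR).subset_connectedComponentIn hyR' hout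
    rw [connectedComponentIn_eq hy, connectedComponentIn_eq (h3 h2)]
  rcases (closure D.G)ᶜ.eq_empty_or_nonempty with he | ⟨x, hx⟩
  · rw [he]; exact isPreconnected_empty
  · have : (closure D.G)ᶜ = connectedComponentIn (closure D.G)ᶜ x := by
      refine Subset.antisymm (fun y hy => ?_) (connectedComponentIn_subset _ _)
      rw [key x hx, ← key y hy]
      exact mem_connectedComponentIn hy
    rw [this]; exact isPreconnected_connectedComponentIn

theorem fr_ext (h : DiscModel D φ ψ) {a : ℂ} (ha : a ∈ frontier D.G) :
    a ∈ closure ((closure D.G)ᶜ) := by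
  by_contra hcon
  rw [closure_compl, mem_compl_iff, not_not] at hcon
  obtain ⟨r, hr, hrK⟩ := Metric.isOpen_iff.1 isOpen_interior a hcon
  have hrK' : ball a r ⊆ closure D.G := hrK.trans interior_subset
  have hξ : ‖φ a‖ = 1 := by simpa using h.sφ ha
  set ξ := φ a with hξd
  set U : Set ℂ := {w | ((starRingEnd ℂ) ξ * w).re < 1} with hU
  have hUo : IsOpen U := isOpen_lt (by fun_prop) (by fun_prop)
  have hUc : Convex ℝ U := by
    have hl : IsLinearMap ℝ (fun w : ℂ => ((starRingEnd ℂ) ξ * w).re) :=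
      ⟨fun x y => by rw [mul_add, add_re], fun c x => by
        simp [mul_left_comm]⟩
    exact convex_halfSpace_lt hl 1
  have hξξ : (starRingEnd ℂ) ξ * ξ = 1 := by
    rw [← normSq_eq_conj_mul_self, normSq_eq_norm_sq, hξ]; simp
  obtain ⟨F, hF, hFe⟩ := aux_log hUo hUc ⟨0, by simp [hU]⟩
    (g := fun w => ψ (ret w) - a) (h.ret_cψ.sub continuous_const).continuousOn (fun w hw h0 => by
      have h1 : ret w = ξ := by
        rw [← h.r _ (ret_mem w), sub_eq_zero.1 h0]
      have h2 : w = ((max 1 ‖w‖ : ℝ) : ℂ) * ξ := by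
        have h0 : 0 < max 1 ‖w‖ := lt_of_lt_of_le one_pos (le_max_left 1 ‖w‖)
        rw [← h1, ret, mul_inv_cancel_left₀]
        exact_mod_cast h0.ne'
      have h3 : ((starRingEnd ℂ) ξ * w).re < 1 := hw
      rw [h2, mul_left_comm, hξξ, mul_one, ofReal_re] at h3
      exact absurd h3 (not_lt.2 (le_max_left _ _)))
  have hsub : ∀ z ∈ sphere a (r / 2), z ∈ closure D.G ∧ φ z ∈ U := by
    intro z hz
    rw [mem_sphere] at hz
    have hzK : z ∈ closure D.G := hrK' (by rw [mem_ball]; linarith)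
    refine ⟨hzK, ?_⟩
    have h1 : ‖φ z‖ ≤ 1 := by simpa using h.mcφ hzK
    have h2 : ((starRingEnd ℂ) ξ * φ z).re ≤ 1 := (re_le_norm _).trans (by
      rw [norm_mul, RCLike.norm_conj, hξ, one_mul]; exact h1)
    refine lt_of_le_of_ne h2 fun h3 => ?_
    have h4 : φ z = ξ := by
      have h5 : ‖φ z - ξ‖ ^ 2 ≤ 0 := by
        have e1 : φ z - ξ = ξ * ((starRingEnd ℂ) ξ * φ z - 1) := by
          linear_combination (-φ z) * hξξ
        rw [e1, norm_mul, hξ, one_mul, ← normSq_eq_norm_sq, normSq_apply]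
        have h6 : normSq ((starRingEnd ℂ) ξ * φ z) ≤ 1 := by
          rw [normSq_eq_norm_sq, norm_mul, RCLike.norm_conj, hξ, one_mul]
          exact pow_le_one₀ (norm_nonneg _) h1
        rw [normSq_apply, h3] at h6
        simp only [sub_re, sub_im, one_re, one_im, h3]
        nlinarith
      have h6 : ‖φ z - ξ‖ = 0 := by
        exact pow_eq_zero_iff (two_ne_zero) |>.1 (le_antisymm h5 (by positivity))
      exact sub_eq_zero.1 (norm_eq_zero.1 h6)
    have h5 : z = a := by rw [← h.l z hzK, h4, hξd, h.l a (ConfPair.fr_sub D ha)]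
    rw [h5, dist_self] at hz; linarith
  refine aux_nolog (a := a) (R := r / 2) (by positivity) (f := fun z => F (φ z))
    (hF.comp (h.cφ.mono fun z hz => (hsub z hz).1) fun z hz => (hsub z hz).2) fun z hz => ?_
  rw [hFe _ (hsub z hz).2, ret_eq (h.mcφ (hsub z hz).1), h.l z (hsub z hz).1]

end DiscModel

noncomputable def eI (θ : ℝ) : ℂ := Complex.exp ((θ : ℂ) * Complex.I)

theorem eI_cont : Continuous eI := by unfold eI; fun_prop
theorem eI_norm (θ : ℝ) : ‖eI θ‖ = 1 := Complex.norm_exp_ofReal_mul_I θ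
theorem eI_sphere (θ : ℝ) : eI θ ∈ sphere (0 : ℂ) 1 := by simp [eI_norm]
theorem eI_cb (θ : ℝ) : eI θ ∈ closedBall (0 : ℂ) 1 := by simp [eI_norm]
theorem eI_add (a b : ℝ) : eI (a + b) = eI a * eI b := by
  simp [eI, add_mul, Complex.exp_add]
theorem eI_per (a : ℝ) : eI (a + 2 * Real.pi) = eI a := by
  rw [eI_add]; simp [eI, Complex.exp_two_pi_mul_I]
theorem eI_inj (α : ℝ) : InjOn eI (Ico α (α + 2 * Real.pi)) := by
  intro x hx y hy hxy
  obtain ⟨n, hn⟩ := Complex.exp_eq_exp_iff_exists_int.1 hxy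
  have h1 : ((x : ℂ) - y - n * (2 * Real.pi)) * I = 0 := by linear_combination hn
  have h2 : x - y - n * (2 * Real.pi) = 0 := by
    have := (mul_eq_zero.1 h1).resolve_right I_ne_zero
    exact_mod_cast this
  have hp := Real.pi_pos
  have h3 : (n : ℝ) < 1 := by
    by_contra! hc
    nlinarith [hx.1, hx.2, hy.1, hy.2]
  have h4 : (-1 : ℝ) < n := by
    by_contra! hc
    nlinarith [hx.1, hx.2, hy.1, hy.2]
  have h5 : n = 0 := by
    have a : n < 1 := by exact_mod_cast h3
    have b : -1 < n := by exact_mod_cast h4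
    omega
  rw [h5] at h2
  push_cast at h2
  linarith
theorem eI_surj (α : ℝ) {w : ℂ} (hw : ‖w‖ = 1) : ∃ θ ∈ Ico α (α + 2 * Real.pi), eI θ = w := by
  have hp := Real.two_pi_pos
  have hper : Function.Periodic eI (2 * Real.pi) := eI_per
  refine ⟨toIcoMod hp α w.arg, toIcoMod_mem_Ico hp α _, ?_⟩
  rw [toIcoMod, hper.sub_zsmul_eq]
  have := Complex.norm_mul_exp_arg_mul_I w
  rw [hw] at this
  simpa [eI] using this

/-- reversed boundary parametrization -/
def JordanDomain.rev (D : JordanDomain) : JordanDomain where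
  G := D.G
  isOpen := D.isOpen
  nonempty := D.nonempty
  bounded := D.bounded
  connected := D.connected
  simplyConnected := D.simplyConnected
  l := D.l
  l_pos := D.l_pos
  γ := fun s => D.γ (-s)
  γ_cont := D.γ_cont.comp continuous_neg
  γ_periodic := fun s => by
    have := D.γ_periodic (-(s + D.l))
    show D.γ (-(s + D.l)) = D.γ (-s)
    rw [← this]; congr 1; ring
  γ_injOn := by
    intro x hx y hy hxy
    have e : ∀ s, D.γ (-s) = D.γ (-s + D.l) := fun s => (D.γ_periodic _).symm
    rcases eq_or_lt_of_le hx.1 with h0 | h0 <;> rcases eq_or_lt_of_le hy.1 with h1 | h1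
    · rw [← h0, ← h1]
    · exfalso
      have hxy : D.γ (-x) = D.γ (-y) := hxy
      rw [← h0, neg_zero, e y] at hxy
      have := D.γ_injOn ⟨le_refl _, D.l_pos⟩ ⟨by linarith [hy.2], by linarith⟩ hxy
      linarith [hy.2]
    · exfalso
      have hxy : D.γ (-x) = D.γ (-y) := hxy
      rw [← h1, neg_zero, e x] at hxy
      have := D.γ_injOn ⟨by linarith [hx.2], by linarith⟩ ⟨le_refl _, D.l_pos⟩ hxy
      linarith [hx.2]
    · have hxy : D.γ (-x) = D.γ (-y) := hxy
      rw [e x, e y] at hxy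
      have := D.γ_injOn ⟨by linarith [hx.2], by linarith⟩ ⟨by linarith [hy.2], by linarith⟩ hxy
      linarith
  γ_boundary := by
    apply Subset.antisymm
    · rintro _ ⟨s, -, rfl⟩; exact D.γ_mem _
    · intro z hz
      rw [← D.γ_image (-D.l)] at hz
      obtain ⟨s, hs, rfl⟩ := hz
      rcases eq_or_lt_of_le hs.1 with h | h
      · refine ⟨0, ⟨le_refl _, D.l_pos⟩, ?_⟩
        have := D.γ_periodic s
        rw [← this, ← h]; simp
      · exact ⟨-s, ⟨by linarith [hs.2], by linarith⟩, by simp⟩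
  γ_unitSpeed := fun s t hst hts => by
    have h1 : eVariationOn (D.γ ∘ fun s : ℝ => -s) (Icc s t) = _ :=
      eVariationOn.comp_eq_of_antitoneOn D.γ (fun s : ℝ => -s) (fun a _ b _ hab => neg_le_neg hab)
    have h2 : (fun s : ℝ => -s) '' Icc s t = Icc (-t) (-s) := by
      rw [← image_neg_Icc]
    rw [h2, D.γ_unitSpeed (-t) (-s) (by linarith) (by linarith)] at h1
    rw [show t - s = -s - -t by ring, ← h1]; rfl

theorem JordanDomain.rev_int (D : JordanDomain) (f : ℂ → ℝ) :
    ∫ s in (0:ℝ)..D.l, f (D.rev.γ s) = ∫ s in (0:ℝ)..D.l, f (D.γ s) := by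
  have h := intervalIntegral.integral_comp_neg (fun s => f (D.γ s)) (a := 0) (b := D.l)
  have hp : Function.Periodic (fun s => f (D.γ s)) D.l := fun s => by
    simp only [D.γ_periodic s]
  have h2 := hp.intervalIntegral_add_eq (-D.l) 0
  simp only [neg_add_cancel, zero_add, neg_zero] at h2 h
  exact h.trans h2

theorem JordanDomain.int_shift (D : JordanDomain) (f : ℂ → ℝ) (s0 : ℝ) :
    ∫ s in s0..(s0 + D.l), f (D.γ s) = ∫ s in (0:ℝ)..D.l, f (D.γ s) := by
  have hp : Function.Periodic (fun s => f (D.γ s)) D.l := fun s => by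
    simp only [D.γ_periodic s]
  simpa using hp.intervalIntegral_add_eq s0 0

theorem JordanDomain.chord (D : JordanDomain) {s t : ℝ} (h : s ≤ t) (h2 : t ≤ s + D.l) :
    ‖D.γ t - D.γ s‖ ≤ t - s := by
  have h1 := eVariationOn.edist_le D.γ (right_mem_Icc.2 h) (left_mem_Icc.2 h)
  rw [D.γ_unitSpeed s t h h2, edist_dist, ENNReal.ofReal_le_ofReal_iff (by linarith), dist_eq_norm] at h1
  exact h1

namespace DiscModel
variable {D : JordanDomain} {φ ψ : ℂ → ℂ}

theorem E_cont (h : DiscModel D φ ψ) : Continuous fun θ : ℝ => ψ (eI θ) :=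
  h.cψ.comp_continuous eI_cont eI_cb

theorem E_inj (h : DiscModel D φ ψ) (α : ℝ) :
    InjOn (fun θ : ℝ => ψ (eI θ)) (Ico α (α + 2 * Real.pi)) := by
  intro x hx y hy hxy
  apply eI_inj α hx hy
  rw [← h.r _ (eI_cb x), ← h.r _ (eI_cb y)]
  exact congrArg φ hxy

theorem E_surj (h : DiscModel D φ ψ) (α : ℝ) {z : ℂ} (hz : z ∈ frontier D.G) :
    ∃ θ ∈ Ico α (α + 2 * Real.pi), ψ (eI θ) = z := by
  have h1 : ‖φ z‖ = 1 := by simpa using h.sφ hz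
  obtain ⟨θ, hθ, he⟩ := eI_surj α h1
  exact ⟨θ, hθ, by rw [he, h.l z (ConfPair.fr_sub D hz)]⟩

/-- monotone parameter change -/
structure Param (D : JordanDomain) (ψ : ℂ → ℂ) (α s0 : ℝ) (σ : ℝ → ℝ) : Prop where
  mono : StrictMonoOn σ (Icc α (α + 2 * Real.pi))
  left : σ α = s0
  right : σ (α + 2 * Real.pi) = s0 + D.l
  eq : ∀ θ ∈ Icc α (α + 2 * Real.pi), D.γ (σ θ) = ψ (eI θ)
  surj : SurjOn σ (Icc α (α + 2 * Real.pi)) (Icc s0 (s0 + D.l))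

theorem rev (h : DiscModel D φ ψ) : DiscModel D.rev φ ψ :=
  ⟨h.cψ, h.dψ, h.mψ, h.sψ, h.mφ, h.sφ, h.r, h.l, h.cφ⟩

theorem sigma (h : DiscModel D φ ψ) (α : ℝ) : ∃ s0 : ℝ, ∃ σ : ℝ → ℝ, D.γ s0 = ψ (eI α) ∧
    MapsTo σ (Ioo α (α + 2 * Real.pi)) (Ioo s0 (s0 + D.l)) ∧
    (∀ θ ∈ Ioo α (α + 2 * Real.pi), D.γ (σ θ) = ψ (eI θ)) ∧
    (StrictMonoOn σ (Ioo α (α + 2 * Real.pi)) ∨ StrictAntiOn σ (Ioo α (α + 2 * Real.pi))) := by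
  have hp := Real.two_pi_pos
  have h0 : ψ (eI α) ∈ D.γ '' Ico 0 (0 + D.l) := by rw [D.γ_image]; exact h.sψ (eI_sphere α)
  obtain ⟨s0, -, hs0⟩ := h0
  have hex : ∀ θ ∈ Ioo α (α + 2 * Real.pi), ∃ s ∈ Ioo s0 (s0 + D.l), D.γ s = ψ (eI θ) := by
    intro θ hθ
    have h1 : ψ (eI θ) ∈ D.γ '' Ico s0 (s0 + D.l) := by rw [D.γ_image]; exact h.sψ (eI_sphere θ)
    obtain ⟨s, hs, he⟩ := h1
    refine ⟨s, ⟨lt_of_le_of_ne hs.1 fun hss => ?_, hs.2⟩, he⟩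
    have h2 : ψ (eI α) = ψ (eI θ) := by rw [← hs0, ← he, hss]
    have := h.E_inj α ⟨le_refl _, by linarith⟩ ⟨hθ.1.le, hθ.2⟩ h2
    linarith [hθ.1]
  choose! σ hσ1 hσ2 using hex
  refine ⟨s0, σ, hs0, hσ1, hσ2, ?_⟩
  refine ContinuousOn.strictMonoOn_of_injOn_Ioo (by linarith) ?_ ?_
  · intro θ hθ
    apply ContinuousAt.continuousWithinAt
    rw [Metric.continuousAt_iff']
    intro ε hε
    have hI := hσ1 θ hθ
    set δ := min ε (min (σ θ - s0) (s0 + D.l - σ θ)) with hδ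
    have hδ0 : 0 < δ := lt_min hε (lt_min (by linarith [hI.1]) (by linarith [hI.2]))
    have h1 := D.γ_loc hI hδ0
    rw [hσ2 θ hθ] at h1
    have h2 := (h.E_cont.tendsto θ).eventually h1
    filter_upwards [h2, isOpen_Ioo.mem_nhds hθ] with x hx hxI
    obtain ⟨s, hs, he⟩ := hx (h.sψ (eI_sphere x))
    have hδ1 : δ ≤ ε := min_le_left _ _
    have hδ2 : δ ≤ σ θ - s0 := (min_le_right _ _).trans (min_le_left _ _)
    have hδ3 : δ ≤ s0 + D.l - σ θ := (min_le_right _ _).trans (min_le_right _ _)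
    have h3 : s = σ x := D.γ_inj s0 ⟨by linarith [hs.1], by linarith [hs.2]⟩
      ⟨(hσ1 x hxI).1.le, (hσ1 x hxI).2⟩ (by rw [he, hσ2 x hxI])
    rw [← h3, Real.dist_eq, abs_lt]
    constructor <;> linarith [hs.1, hs.2]
  · intro x hx y hy hxy
    apply h.E_inj α ⟨hx.1.le, hx.2⟩ ⟨hy.1.le, hy.2⟩
    simp only
    rw [← hσ2 x hx, ← hσ2 y hy, hxy]

theorem param_of_mono (h : DiscModel D φ ψ) {α s0 : ℝ} {σ : ℝ → ℝ} (hs0 : D.γ s0 = ψ (eI α))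
    (hm : MapsTo σ (Ioo α (α + 2 * Real.pi)) (Ioo s0 (s0 + D.l)))
    (he : ∀ θ ∈ Ioo α (α + 2 * Real.pi), D.γ (σ θ) = ψ (eI θ))
    (hmono : StrictMonoOn σ (Ioo α (α + 2 * Real.pi))) :
    ∃ τ, Param D ψ α s0 τ := by
  classical
  have hp := Real.two_pi_pos
  set τ : ℝ → ℝ := fun θ => if θ ≤ α then s0 else if α + 2 * Real.pi ≤ θ then s0 + D.l else σ θ
  have t1 : τ α = s0 := by simp [τ]
  have t2 : τ (α + 2 * Real.pi) = s0 + D.l := by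
    have : ¬ (α + 2 * Real.pi ≤ α) := by linarith
    simp only [τ, if_neg this, le_refl, if_true]
  have t3 : ∀ θ ∈ Ioo α (α + 2 * Real.pi), τ θ = σ θ := fun θ hθ => by
    simp only [τ, if_neg (not_le.2 hθ.1), if_neg (not_le.2 hθ.2)]
  have hcases : ∀ θ ∈ Icc α (α + 2 * Real.pi), θ = α ∨ θ = α + 2 * Real.pi ∨
      θ ∈ Ioo α (α + 2 * Real.pi) := fun θ hθ => by
    rcases eq_or_lt_of_le hθ.1 with a | a
    · exact Or.inl a.symm
    rcases eq_or_lt_of_le hθ.2 with b | b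
    · exact Or.inr (Or.inl b)
    exact Or.inr (Or.inr ⟨a, b⟩)
  have heq : ∀ θ ∈ Icc α (α + 2 * Real.pi), D.γ (τ θ) = ψ (eI θ) := fun θ hθ => by
    rcases hcases θ hθ with rfl | rfl | h1
    · rw [t1, hs0]
    · rw [t2, D.γ_periodic, hs0, eI_per]
    · rw [t3 _ h1, he _ h1]
  refine ⟨τ, ?_, t1, t2, heq, ?_⟩
  · intro x hx y hy hxy
    rcases hcases x hx with rfl | rfl | hx1
    · rcases hcases y hy with rfl | rfl | hy1
      · exact absurd hxy (lt_irrefl _)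
      · rw [t1, t2]; linarith [D.l_pos]
      · rw [t1, t3 _ hy1]; exact (hm hy1).1
    · exact absurd hxy (not_lt.2 hy.2)
    · rcases hcases y hy with rfl | rfl | hy1
      · exact absurd hxy (not_lt.2 hx.1)
      · rw [t2, t3 _ hx1]; exact (hm hx1).2
      · rw [t3 _ hx1, t3 _ hy1]; exact hmono hx1 hy1 hxy
  · intro s hs
    rcases eq_or_lt_of_le hs.2 with hs2 | hs2
    · exact ⟨_, right_mem_Icc.2 (by linarith), by rw [t2, hs2]⟩
    obtain ⟨θ, hθ, hθe⟩ := h.E_surj α (D.γ_mem s)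
    refine ⟨θ, Ico_subset_Icc_self hθ, ?_⟩
    refine D.γ_inj s0 ?_ ⟨hs.1, hs2⟩ (by rw [heq θ (Ico_subset_Icc_self hθ), hθe])
    rcases eq_or_lt_of_le hθ.1 with a | a
    · rw [← a, t1]; exact ⟨le_refl _, by linarith [D.l_pos]⟩
    · rw [t3 _ ⟨a, hθ.2⟩]; exact Ioo_subset_Ico_self (hm ⟨a, hθ.2⟩)

theorem param (h : DiscModel D φ ψ) (α : ℝ) : ∃ D' : JordanDomain, D'.l = D.l ∧
    (∀ f : ℂ → ℝ, ∫ s in (0:ℝ)..D.l, f (D'.γ s) = ∫ s in (0:ℝ)..D.l, f (D.γ s)) ∧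
    ∃ s0 σ, Param D' ψ α s0 σ := by
  obtain ⟨s0, σ, h1, h2, h3, h4 | h4⟩ := h.sigma α
  · exact ⟨D, rfl, fun f => rfl, s0, h.param_of_mono h1 h2 h3 h4⟩
  · refine ⟨D.rev, rfl, D.rev_int, -s0 - D.l, ?_⟩
    refine h.rev.param_of_mono (σ := fun θ => - σ θ) ?_ ?_ ?_ ?_
    · show D.γ (-(-s0 - D.l)) = _
      rw [← h1, ← D.γ_periodic s0]; congr 1; ring
    · intro θ hθ
      have := h2 hθ
      show -σ θ ∈ Ioo (-s0 - D.l) (-s0 - D.l + D.l)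
      exact ⟨by linarith [this.2], by linarith [this.1]⟩
    · intro θ hθ
      show D.γ (- - σ θ) = _
      rw [neg_neg, h3 θ hθ]
    · intro x hx y hy hxy
      exact neg_lt_neg (h4 hx hy hxy)

end DiscModel

theorem eI_lip (a b : ℝ) : ‖eI a - eI b‖ ≤ |a - b| := by
  have h1 : eI a = eI (a - b) * eI b := by rw [← eI_add]; congr 1; ring
  have h2 : eI a - eI b = (eI (a - b) - 1) * eI b := by rw [h1]; ring
  rw [h2, norm_mul, eI_norm, mul_one]
  have := Real.norm_exp_I_mul_ofReal_sub_one_le (x := a - b)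
  rw [mul_comm] at this
  simpa [eI] using this

namespace DiscModel
variable {D : JordanDomain} {φ ψ : ℂ → ℂ}

theorem Param.ex {α s0 : ℝ} {σ : ℝ → ℝ} (P : Param D ψ α s0 σ) {a b s : ℝ}
    (ha : a ∈ Icc α (α + 2 * Real.pi)) (hb : b ∈ Icc α (α + 2 * Real.pi))
    (hs : s ∈ Icc (σ a) (σ b)) : ∃ θ ∈ Icc a b, σ θ = s := by
  have hp := Real.two_pi_pos
  have h1 : s0 ≤ σ a := by
    rw [← P.left]; exact P.mono.monotoneOn (left_mem_Icc.2 (by linarith)) ha ha.1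
  have h2 : σ b ≤ s0 + D.l := by
    rw [← P.right]; exact P.mono.monotoneOn hb (right_mem_Icc.2 (by linarith)) hb.2
  obtain ⟨θ, hθ, he⟩ := P.surj (show s ∈ Icc s0 (s0 + D.l) from ⟨h1.trans hs.1, hs.2.trans h2⟩)
  refine ⟨θ, ⟨?_, ?_⟩, he⟩
  · exact (P.mono.le_iff_le ha hθ).1 (by rw [he]; exact hs.1)
  · exact (P.mono.le_iff_le hθ hb).1 (by rw [he]; exact hs.2)

theorem unif (h : DiscModel D φ ψ) {f : ℂ → ℝ} (hf : Continuous f) {ε : ℝ} (hε : 0 < ε) :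
    ∃ N0 : ℕ, 0 < N0 ∧ ∀ N ≥ N0, ∀ a b : ℝ, |a - b| ≤ 2 * Real.pi / N →
      |f (ψ (eI a)) - f (ψ (eI b))| ≤ ε := by
  have h1 : UniformContinuousOn (fun w => f (ψ w)) (closedBall (0 : ℂ) 1) :=
    (isCompact_closedBall _ _).uniformContinuousOn_of_continuous (hf.comp_continuousOn h.cψ)
  rw [Metric.uniformContinuousOn_iff_le] at h1
  obtain ⟨δ, hδ, h1⟩ := h1 ε hε
  obtain ⟨N0, hN0⟩ := exists_nat_gt (2 * Real.pi / δ)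
  have hp := Real.two_pi_pos
  have hN0' : (0 : ℝ) < N0 := lt_trans (by positivity) hN0
  refine ⟨N0, by exact_mod_cast hN0', fun N hN a b hab => ?_⟩
  have := h1 (eI a) (eI_cb a) (eI b) (eI_cb b) ?_
  · simpa [Real.dist_eq] using this
  · rw [dist_eq_norm]
    refine (eI_lip a b).trans (hab.trans ?_)
    have hNN : (N0 : ℝ) ≤ N := by exact_mod_cast hN
    rw [div_le_iff₀ (by linarith)]
    rw [div_lt_iff₀ hδ] at hN0
    nlinarith

theorem pts {α : ℝ} {N : ℕ} (hN : 0 < N) {j : ℕ} (hj : j ≤ N) :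
    α + j * (2 * Real.pi / N) ∈ Icc α (α + 2 * Real.pi) := by
  have hp := Real.two_pi_pos
  have hN' : (0 : ℝ) < N := by exact_mod_cast hN
  have hj' : (j : ℝ) ≤ N := by exact_mod_cast hj
  refine ⟨by have : 0 ≤ j * (2 * Real.pi / N) := by positivity
             linarith, ?_⟩
  have : j * (2 * Real.pi / N) ≤ N * (2 * Real.pi / N) := by gcongr
  rw [mul_div_cancel₀ _ hN'.ne'] at this
  linarith

theorem bsum (h : DiscModel D φ ψ) {f : ℂ → ℝ} (hf : Continuous f) (hf0 : ∀ z, 0 ≤ f z)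
    {ε : ℝ} (hε : 0 < ε) :
    ∃ N0 : ℕ, 0 < N0 ∧ ∀ N ≥ N0, ∀ α : ℝ,
      ∑ j ∈ Finset.range N, f (ψ (eI (α + j * (2 * Real.pi / N)))) *
        ‖ψ (eI (α + (j + 1 : ℕ) * (2 * Real.pi / N))) - ψ (eI (α + j * (2 * Real.pi / N)))‖ ≤
      (∫ s in (0:ℝ)..D.l, f (D.γ s)) + ε * D.l := by
  obtain ⟨N0, hN0, hu⟩ := h.unif hf hε
  refine ⟨N0, hN0, fun N hN α => ?_⟩
  have hNp : 0 < N := lt_of_lt_of_le hN0 hN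
  have hN' : (0 : ℝ) < N := by exact_mod_cast hNp
  have hp := Real.two_pi_pos
  obtain ⟨D', hl, hint, s0, σ, P⟩ := h.param α
  rw [← hint, ← hl, ← D'.int_shift f s0]
  set θ : ℕ → ℝ := fun j => α + j * (2 * Real.pi / N) with hθ
  have hmem : ∀ j ≤ N, θ j ∈ Icc α (α + 2 * Real.pi) := fun j hj => pts hNp hj
  have hθ1 : ∀ j, θ (j + 1) = θ j + 2 * Real.pi / N := fun j => by simp only [hθ]; push_cast; ring
  have hdl : 0 ≤ 2 * Real.pi / N := by positivity
  have hci : ∀ a b, IntervalIntegrable (fun s => f (D'.γ s) + ε) volume a b := fun a b =>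
    ((hf.comp D'.γ_cont).add continuous_const).intervalIntegrable _ _
  have hterm : ∀ j < N, f (ψ (eI (θ j))) * ‖ψ (eI (θ (j + 1))) - ψ (eI (θ j))‖ ≤
      ∫ s in σ (θ j)..σ (θ (j + 1)), (f (D'.γ s) + ε) := by
    intro j hj
    have m1 := hmem j hj.le
    have m2 := hmem (j + 1) hj
    have hle : σ (θ j) ≤ σ (θ (j + 1)) := P.mono.monotoneOn m1 m2 (by rw [hθ1]; linarith)
    have h2 : σ (θ (j + 1)) ≤ s0 + D'.l := by
      rw [← P.right]; exact P.mono.monotoneOn m2 (right_mem_Icc.2 (by linarith)) m2.2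
    have h3 : s0 ≤ σ (θ j) := by
      rw [← P.left]; exact P.mono.monotoneOn (left_mem_Icc.2 (by linarith)) m1 m1.1
    have hch := D'.chord hle (by linarith)
    rw [P.eq _ m1, P.eq _ m2] at hch
    calc _ ≤ f (ψ (eI (θ j))) * (σ (θ (j + 1)) - σ (θ j)) := by gcongr; exact hf0 _
      _ = ∫ s in σ (θ j)..σ (θ (j + 1)), f (ψ (eI (θ j))) := by simp; ring
      _ ≤ _ := by
        refine intervalIntegral.integral_mono_on hle (by simp) (hci _ _) fun s hs => ?_
        obtain ⟨t, ht, rfl⟩ := P.ex m1 m2 hs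
        have ht' : t ∈ Icc α (α + 2 * Real.pi) := ⟨m1.1.trans ht.1, ht.2.trans m2.2⟩
        rw [P.eq t ht']
        have := hu N hN (θ j) t (by
          rw [abs_le]; rw [hθ1] at ht; constructor <;> linarith [ht.1, ht.2])
        linarith [(abs_le.1 this).2]
  calc _ ≤ ∑ j ∈ Finset.range N, ∫ s in σ (θ j)..σ (θ (j + 1)), (f (D'.γ s) + ε) :=
        Finset.sum_le_sum fun j hj => hterm j (Finset.mem_range.1 hj)
    _ = ∫ s in σ (θ 0)..σ (θ N), (f (D'.γ s) + ε) :=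
        intervalIntegral.sum_integral_adjacent_intervals (a := fun j => σ (θ j)) fun k _ => hci _ _
    _ = _ := by
      have e0 : σ (θ 0) = s0 := by rw [← P.left]; simp [hθ]
      have e1 : σ (θ N) = s0 + D'.l := by
        rw [← P.right]; simp only [hθ]; rw [mul_div_cancel₀ _ hN'.ne']
      have hfi : IntervalIntegrable (fun s => f (D'.γ s)) volume s0 (s0 + D'.l) :=
        (hf.comp D'.γ_cont).intervalIntegrable _ _
      rw [e0, e1, intervalIntegral.integral_add hfi (by simp)]
      simp; ring

theorem len_le (h : DiscModel D φ ψ) {f : ℂ → ℝ} (hf : Continuous f) (hf0 : ∀ z, 0 ≤ f z)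
    {m : ℝ → ℝ} (hm0 : ∀ θ, 0 ≤ m θ) (hmi : IntervalIntegrable m volume 0 (2 * Real.pi))
    (hm : ∀ a b, 0 ≤ a → a ≤ b → b ≤ 2 * Real.pi →
      ‖ψ (eI b) - ψ (eI a)‖ ≤ ∫ θ in a..b, m θ) :
    ∫ s in (0:ℝ)..D.l, f (D.γ s) ≤ ∫ θ in (0:ℝ)..(2 * Real.pi), f (ψ (eI θ)) * m θ := by
  have hp := Real.two_pi_pos
  have hmi' : ∀ a b, 0 ≤ a → a ≤ b → b ≤ 2 * Real.pi → IntervalIntegrable m volume a b :=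
    fun a b h1 h2 h3 => hmi.mono_set (by
      rw [uIcc_of_le h2, uIcc_of_le hp.le]; exact Icc_subset_Icc h1 h3)
  obtain ⟨D', hl, hint, s0, σ, P⟩ := h.param 0
  rw [← hint, ← hl, ← D'.int_shift f s0]
  obtain ⟨M, hM⟩ : ∃ M, ∀ θ, f (ψ (eI θ)) ≤ M := by
    obtain ⟨M, hM⟩ := (isCompact_closedBall (0 : ℂ) 1).bddAbove_image (hf.comp_continuousOn h.cψ)
    exact ⟨M, fun θ => hM ⟨_, eI_cb θ, rfl⟩⟩
  have hzz : (0 : ℝ) + 2 * Real.pi = 2 * Real.pi := zero_add _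
  have hgc : Continuous fun θ => f (ψ (eI θ)) := hf.comp h.E_cont
  -- increments of σ
  have hσ : ∀ a b, 0 ≤ a → a ≤ b → b ≤ 2 * Real.pi → σ b - σ a ≤ ∫ θ in a..b, m θ := by
    intro a b h1 h2 h3
    have ma : a ∈ Icc (0 : ℝ) (0 + 2 * Real.pi) := ⟨h1, by linarith⟩
    have mb : b ∈ Icc (0 : ℝ) (0 + 2 * Real.pi) := ⟨by linarith, by linarith⟩
    have hsub : Icc a b ⊆ Icc (0 : ℝ) (0 + 2 * Real.pi) := Icc_subset_Icc h1 (by linarith)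
    have hle : σ a ≤ σ b := P.mono.monotoneOn ma mb h2
    have k1 : σ b ≤ s0 + D'.l := by
      rw [← P.right]; exact P.mono.monotoneOn mb (right_mem_Icc.2 (by linarith)) mb.2
    have k2 : s0 ≤ σ a := by
      rw [← P.left]; exact P.mono.monotoneOn (left_mem_Icc.2 (by linarith)) ma ma.1
    have himg : σ '' Icc a b = Icc (σ a) (σ b) := by
      apply Subset.antisymm
      · rintro _ ⟨t, ht, rfl⟩
        exact ⟨P.mono.monotoneOn ma (hsub ht) ht.1, P.mono.monotoneOn (hsub ht) mb ht.2⟩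
      · intro s hs
        obtain ⟨t, ht, e⟩ := P.ex ma mb hs
        exact ⟨t, ht, e⟩
    have e1 := eVariationOn.comp_eq_of_monotoneOn D'.γ σ (t := Icc a b)
      (P.mono.monotoneOn.mono hsub)
    rw [himg, D'.γ_unitSpeed _ _ hle (by linarith)] at e1
    have e2 : eVariationOn (D'.γ ∘ σ) (Icc a b) ≤ ENNReal.ofReal (∫ θ in a..b, m θ) := by
      refine iSup_le fun ⟨n, u, hu, hus⟩ => ?_
      simp only
      have hu0 : ∀ i, 0 ≤ u i := fun i => h1.trans (hus i).1
      have hu2 : ∀ i, u i ≤ 2 * Real.pi := fun i => (hus i).2.trans h3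
      calc _ ≤ ∑ i ∈ Finset.range n, ENNReal.ofReal (∫ θ in u i..u (i + 1), m θ) := by
            refine Finset.sum_le_sum fun i _ => ?_
            rw [edist_dist, dist_eq_norm]
            apply ENNReal.ofReal_le_ofReal
            simp only [Function.comp]
            rw [P.eq _ (hsub (hus i)), P.eq _ (hsub (hus (i + 1)))]
            exact hm _ _ (hu0 i) (hu (Nat.le_succ i)) (hu2 _)
        _ = ENNReal.ofReal (∑ i ∈ Finset.range n, ∫ θ in u i..u (i + 1), m θ) := by
            rw [ENNReal.ofReal_sum_of_nonneg]
            intro i _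
            exact intervalIntegral.integral_nonneg (hu (Nat.le_succ i)) fun t _ => hm0 t
        _ ≤ _ := by
            apply ENNReal.ofReal_le_ofReal
            rw [intervalIntegral.sum_integral_adjacent_intervals fun k _ =>
              hmi' _ _ (hu0 k) (hu (Nat.le_succ k)) (hu2 _)]
            exact intervalIntegral.integral_mono_interval (hus 0).1 (hu (Nat.zero_le n)) (hus n).2
              (Eventually.of_forall hm0) (hmi' _ _ h1 h2 h3)
    rw [e1] at e2
    exact (ENNReal.ofReal_le_ofReal_iff (intervalIntegral.integral_nonneg h2 fun t _ => hm0 t)).1 e2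
  refine le_of_forall_pos_le_add fun ε hε => ?_
  set I := ∫ θ in (0:ℝ)..(2 * Real.pi), m θ with hI
  have hI0 : 0 ≤ I := intervalIntegral.integral_nonneg hp.le fun t _ => hm0 t
  set ε' := ε / (2 * (I + 1)) with hε'
  have hε'0 : 0 < ε' := by positivity
  obtain ⟨N, hNp, hu⟩ := h.unif hf hε'0
  have hN' : (0 : ℝ) < N := by exact_mod_cast hNp
  set θ : ℕ → ℝ := fun j => 0 + j * (2 * Real.pi / N) with hθ
  have hmem : ∀ j ≤ N, θ j ∈ Icc (0 : ℝ) (0 + 2 * Real.pi) := fun j hj => pts hNp hj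
  have hθ1 : ∀ j, θ (j + 1) = θ j + 2 * Real.pi / N := fun j => by simp only [hθ]; push_cast; ring
  have hdl : 0 ≤ 2 * Real.pi / N := by positivity
  have hci : ∀ a b, IntervalIntegrable (fun s => f (D'.γ s)) volume a b := fun a b =>
    (hf.comp D'.γ_cont).intervalIntegrable _ _
  have hterm : ∀ j < N, ∫ s in σ (θ j)..σ (θ (j + 1)), f (D'.γ s) ≤
      ∫ t in θ j..θ (j + 1), (f (ψ (eI t)) + 2 * ε') * m t := by
    intro j hj
    have m1 := hmem j hj.le
    have m2 := hmem (j + 1) hj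
    have hlt : θ j ≤ θ (j + 1) := by rw [hθ1]; linarith
    have hle : σ (θ j) ≤ σ (θ (j + 1)) := P.mono.monotoneOn m1 m2 hlt
    have hmm := hmi' (θ j) (θ (j + 1)) m1.1 hlt (by linarith [m2.2])
    calc _ ≤ ∫ s in σ (θ j)..σ (θ (j + 1)), (f (ψ (eI (θ j))) + ε') := by
          refine intervalIntegral.integral_mono_on hle (hci _ _) (by simp) fun s hs => ?_
          obtain ⟨t, ht, rfl⟩ := P.ex m1 m2 hs
          rw [P.eq t ⟨m1.1.trans ht.1, ht.2.trans m2.2⟩]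
          have := hu N le_rfl (θ j) t (by
            rw [abs_le]; rw [hθ1] at ht; constructor <;> linarith [ht.1, ht.2])
          linarith [(abs_le.1 this).1]
      _ = (f (ψ (eI (θ j))) + ε') * (σ (θ (j + 1)) - σ (θ j)) := by simp; ring
      _ ≤ (f (ψ (eI (θ j))) + ε') * ∫ t in θ j..θ (j + 1), m t := by
          gcongr
          · linarith [hf0 (ψ (eI (θ j)))]
          · exact hσ _ _ m1.1 hlt (by linarith [m2.2])
      _ = ∫ t in θ j..θ (j + 1), (f (ψ (eI (θ j))) + ε') * m t := by simp
      _ ≤ _ := by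
          refine intervalIntegral.integral_mono_on hlt (hmm.const_mul _)
            (hmm.continuousOn_mul (hgc.add continuous_const).continuousOn) fun t ht => ?_
          have := hu N le_rfl (θ j) t (by
            rw [abs_le]; rw [hθ1] at ht; constructor <;> linarith [ht.1, ht.2])
          have h2 := (abs_le.1 this).2
          exact mul_le_mul_of_nonneg_right (by linarith) (hm0 t)
  have e0 : θ 0 = 0 := by simp [hθ]
  have e1 : θ N = 2 * Real.pi := by simp only [hθ]; rw [mul_div_cancel₀ _ hN'.ne', zero_add]
  calc ∫ s in s0..s0 + D'.l, f (D'.γ s) = ∫ s in σ (θ 0)..σ (θ N), f (D'.γ s) := by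
        rw [e0, e1, P.left, ← P.right, zero_add]
    _ = ∑ j ∈ Finset.range N, ∫ s in σ (θ j)..σ (θ (j + 1)), f (D'.γ s) :=
        (intervalIntegral.sum_integral_adjacent_intervals (a := fun j => σ (θ j))
          fun k _ => hci _ _).symm
    _ ≤ ∑ j ∈ Finset.range N, ∫ t in θ j..θ (j + 1), (f (ψ (eI t)) + 2 * ε') * m t :=
        Finset.sum_le_sum fun j hj => hterm j (Finset.mem_range.1 hj)
    _ = ∫ t in θ 0..θ N, (f (ψ (eI t)) + 2 * ε') * m t := by
        refine intervalIntegral.sum_integral_adjacent_intervals fun k hk => ?_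
        exact (hmi' _ _ (hmem k hk.le).1 (by rw [hθ1]; linarith)
          (by linarith [(hmem (k + 1) hk).2])).continuousOn_mul
            (hgc.add continuous_const).continuousOn
    _ = (∫ t in (0:ℝ)..(2 * Real.pi), f (ψ (eI t)) * m t) + 2 * ε' * I := by
        rw [e0, e1]
        simp only [add_mul]
        rw [intervalIntegral.integral_add (hmi.continuousOn_mul hgc.continuousOn) (hmi.const_mul _)]
        simp [hI]
    _ ≤ _ := by
        gcongr
        rw [hε']
        rw [show 2 * (ε / (2 * (I + 1))) * I = ε * (I / (I + 1)) by field_simp]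
        have : I / (I + 1) ≤ 1 := by rw [div_le_one (by linarith)]; linarith
        nlinarith

end DiscModel

theorem aux_maxsum (N : ℕ) (H : ℕ → ℂ → ℂ) (hH : ∀ j, DiffContOnCl ℂ (H j) (ball 0 1)) {B : ℝ}
    (hB : ∀ w ∈ sphere (0 : ℂ) 1, ∑ j ∈ Finset.range N, ‖H j w‖ ≤ B) {w : ℂ}
    (hw : w ∈ closedBall (0 : ℂ) 1) : ∑ j ∈ Finset.range N, ‖H j w‖ ≤ B := by
  set c : ℕ → ℂ := fun j => (starRingEnd ℂ) (H j w) / ‖H j w‖ with hc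
  have hc1 : ∀ j, ‖c j‖ ≤ 1 := fun j => by
    simp only [hc, norm_div, RCLike.norm_conj, Complex.norm_real, norm_norm]
    exact div_self_le_one _
  have hc2 : ∀ j, c j * H j w = ‖H j w‖ := fun j => by
    simp only [hc]
    rcases eq_or_ne (H j w) 0 with h | h
    · simp [h]
    · rw [div_mul_eq_mul_div, ← normSq_eq_conj_mul_self, normSq_eq_norm_sq]
      have : (‖H j w‖ : ℂ) ≠ 0 := by simpa using h
      push_cast; field_simp
  have hd : DiffContOnCl ℂ (fun z => ∑ j ∈ Finset.range N, c j * H j z) (ball 0 1) := by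
    refine ⟨DifferentiableOn.fun_sum fun j _ => ((hH j).1.const_mul _),
      continuousOn_finsetSum _ fun j _ => continuousOn_const.mul (hH j).2⟩
  have h1 := Complex.norm_le_of_forall_mem_frontier_norm_le (C := B) isBounded_ball hd
    (fun z hz => by
      rw [frontier_ball _ one_ne_zero] at hz
      refine (norm_sum_le _ _).trans (le_trans (Finset.sum_le_sum fun j _ => ?_) (hB z hz))
      rw [norm_mul]
      exact mul_le_of_le_one_left (norm_nonneg _) (hc1 j))
    (z := w) (by rw [closure_ball _ one_ne_zero]; exact hw)
  rw [Finset.sum_congr rfl fun j _ => hc2 j] at h1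
  rw [← ofReal_sum, Complex.norm_real] at h1
  exact (le_abs_self _).trans h1

theorem eI_hasDeriv (t : ℝ) : HasDerivAt eI (eI t * I) t := by
  have h1 : HasDerivAt (fun t : ℝ => (t : ℂ) * I) (1 * I) t :=
    (Complex.ofRealCLM.hasDerivAt (x := t)).mul_const I
  have h2 := h1.cexp
  rw [one_mul] at h2
  exact h2

theorem r_eI_mem {r : ℝ} (h0 : 0 ≤ r) (h1 : r < 1) (t : ℝ) : (r : ℂ) * eI t ∈ ball (0 : ℂ) 1 := by
  simp [eI_norm, abs_of_nonneg h0, h1]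

namespace DiscModel
variable {D : JordanDomain} {φ ψ : ℂ → ℂ}

theorem diffcont (h : DiscModel D φ ψ) : DiffContOnCl ℂ ψ (ball 0 1) :=
  ⟨h.dψ, by rw [closure_ball _ one_ne_zero]; exact h.cψ⟩

theorem dψc (h : DiscModel D φ ψ) : ContinuousOn (deriv ψ) (ball 0 1) :=
  (h.dψ.deriv isOpen_ball).continuousOn

theorem ψr_hasDeriv (h : DiscModel D φ ψ) {r : ℝ} (h0 : 0 ≤ r) (h1 : r < 1) (t : ℝ) :
    HasDerivAt (fun t : ℝ => ψ ((r : ℂ) * eI t)) (deriv ψ ((r : ℂ) * eI t) * (r * (eI t * I))) t := by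
  have hm := r_eI_mem h0 h1 t
  have hd := (h.dψ.differentiableAt (isOpen_ball.mem_nhds hm)).hasDerivAt
  exact HasDerivAt.comp t hd ((eI_hasDeriv t).const_mul (r : ℂ))

theorem ψr_dcont (h : DiscModel D φ ψ) {r : ℝ} (h0 : 0 ≤ r) (h1 : r < 1) :
    Continuous fun t : ℝ => deriv ψ ((r : ℂ) * eI t) :=
  h.dψc.comp_continuous (continuous_const.mul eI_cont) (r_eI_mem h0 h1)

theorem ψr_cont (h : DiscModel D φ ψ) {r : ℝ} (h0 : 0 ≤ r) (h1 : r < 1) :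
    Continuous fun t : ℝ => ψ ((r : ℂ) * eI t) :=
  h.dψ.continuousOn.comp_continuous (continuous_const.mul eI_cont) (r_eI_mem h0 h1)

theorem avg (h : DiscModel D φ ψ) {q : ℂ → ℂ} (hq : Differentiable ℂ q) {r : ℝ} (h0 : 0 ≤ r)
    (h1 : r < 1) {ε : ℝ} (hε : 0 < ε) : ∃ N0 : ℕ, 0 < N0 ∧ ∀ N ≥ N0,
    ∫ t in (0:ℝ)..(2 * Real.pi), ‖q (ψ (r * eI t))‖ ^ 2 *
      (‖ψ (r * eI (t + 2 * Real.pi / N)) - ψ (r * eI t)‖ / (2 * Real.pi / N)) ≤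
      (∫ s in (0:ℝ)..D.l, ‖q (D.γ s)‖ ^ 2) + ε * D.l := by
  have hp := Real.two_pi_pos
  obtain ⟨N0, hN0, hb⟩ := h.bsum (f := fun z => ‖q z‖ ^ 2) (by have := hq.continuous; fun_prop)
    (fun z => by positivity) hε
  refine ⟨N0, hN0, fun N hN => ?_⟩
  have hNp : 0 < N := lt_of_lt_of_le hN0 hN
  have hN' : (0 : ℝ) < N := by exact_mod_cast hNp
  set B := (∫ s in (0:ℝ)..D.l, ‖q (D.γ s)‖ ^ 2) + ε * D.l with hB
  set δ := 2 * Real.pi / N with hδ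
  have hδ0 : 0 < δ := by positivity
  have hrot : ∀ a : ℝ, DiffContOnCl ℂ (fun w => ψ (w * eI a)) (ball 0 1) := fun a => by
    refine h.diffcont.comp (g := fun w => w * eI a)
      (Differentiable.diffContOnCl (by fun_prop)) (fun w hw => ?_)
    simpa [eI_norm] using hw
  set H : ℕ → ℂ → ℂ := fun j w => q (ψ (w * eI (j * δ))) ^ 2 *
    (ψ (w * eI ((j + 1 : ℕ) * δ)) - ψ (w * eI (j * δ))) with hH
  have hHd : ∀ j, DiffContOnCl ℂ (H j) (ball 0 1) := fun j => by
    have e1 : DiffContOnCl ℂ (fun w => q (ψ (w * eI (j * δ)))) (ball 0 1) :=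
      ⟨hq.comp_differentiableOn (hrot _).1, hq.continuous.comp_continuousOn (hrot _).2⟩
    have e2 := (hrot ((j + 1 : ℕ) * δ)).sub (hrot (j * δ))
    exact ⟨(e1.1.pow 2).mul e2.1, (e1.2.pow 2).mul e2.2⟩
  have hbd : ∀ w ∈ sphere (0 : ℂ) 1, ∑ j ∈ Finset.range N, ‖H j w‖ ≤ B := by
    intro w hw
    obtain ⟨α, -, rfl⟩ := eI_surj 0 (w := w) (by simpa using hw)
    have := hb N hN α
    simpa [hH, eI_add] using this
  have hin : ∀ t : ℝ, ∑ j ∈ Finset.range N, ‖H j (r * eI t)‖ ≤ B := fun t =>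
    aux_maxsum N H hHd hbd (ball_subset_closedBall (r_eI_mem h0 h1 t))
  set k : ℝ → ℝ := fun t => ‖q (ψ (r * eI t))‖ ^ 2 * ‖ψ (r * eI (t + δ)) - ψ (r * eI t)‖ with hk
  have hψr := h.ψr_cont h0 h1
  have hkc : Continuous k := by
    have a1 : Continuous fun t : ℝ => ψ (r * eI (t + δ)) :=
      hψr.comp (continuous_id.add continuous_const)
    have a2 : Continuous fun t : ℝ => q (ψ (r * eI t)) := hq.continuous.comp hψr
    exact (a2.norm.pow 2).mul (a1.sub hψr).norm
  have hkp : Function.Periodic k (2 * Real.pi) := fun t => by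
    simp only [hk]
    rw [eI_per, show t + 2 * Real.pi + δ = t + δ + 2 * Real.pi by ring, eI_per]
  have hHk : ∀ (j : ℕ) (t : ℝ), ‖H j (r * eI t)‖ = k (t + j * δ) := fun j t => by
    simp only [hH, hk, norm_mul, norm_pow]
    rw [mul_assoc, ← eI_add, mul_assoc, ← eI_add]
    push_cast
    rw [show t + (↑j + 1) * δ = t + j * δ + δ by ring]
  have hsum : ∫ t in (0:ℝ)..(2 * Real.pi), ∑ j ∈ Finset.range N, ‖H j (r * eI t)‖ =
      N * ∫ t in (0:ℝ)..(2 * Real.pi), k t := by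
    simp only [hHk]
    have hii : ∀ j ∈ Finset.range N, IntervalIntegrable (fun t => k (t + j * δ)) volume 0
        (2 * Real.pi) := fun j _ =>
      (hkc.comp (continuous_id.add continuous_const)).intervalIntegrable _ _
    rw [intervalIntegral.integral_finsetSum hii]
    have : ∀ j ∈ Finset.range N, ∫ t in (0:ℝ)..(2 * Real.pi), k (t + j * δ) =
        ∫ t in (0:ℝ)..(2 * Real.pi), k t := fun j _ => by
      rw [intervalIntegral.integral_comp_add_right]
      have := hkp.intervalIntegral_add_eq (0 + j * δ) 0
      rw [zero_add (2 * Real.pi)] at this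
      rw [← this]; congr 1; ring
    rw [Finset.sum_congr rfl this]; simp
  have hle : N * ∫ t in (0:ℝ)..(2 * Real.pi), k t ≤ 2 * Real.pi * B := by
    rw [← hsum]
    calc _ ≤ ∫ t in (0:ℝ)..(2 * Real.pi), B := by
          refine intervalIntegral.integral_mono_on hp.le ?_ (by simp) fun t _ => hin t
          simp only [hHk]
          refine Continuous.intervalIntegrable ?_ _ _
          exact continuous_finsetSum _ fun j _ => hkc.comp (continuous_id.add continuous_const)
      _ = _ := by simp
  have e : ∀ t, ‖q (ψ (r * eI t))‖ ^ 2 * (‖ψ (r * eI (t + δ)) - ψ (r * eI t)‖ / δ) = k t / δ :=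
    fun t => by simp only [hk]; ring
  simp only [e]
  rw [intervalIntegral.integral_div, div_le_iff₀ hδ0, hδ, mul_div_assoc', le_div_iff₀ hN']
  linarith

theorem hardy (h : DiscModel D φ ψ) {q : ℂ → ℂ} (hq : Differentiable ℂ q) {r : ℝ} (h0 : 0 ≤ r)
    (h1 : r < 1) :
    ∫ t in (0:ℝ)..(2 * Real.pi), ‖q (ψ (r * eI t))‖ ^ 2 * (r * ‖deriv ψ (r * eI t)‖) ≤
      ∫ s in (0:ℝ)..D.l, ‖q (D.γ s)‖ ^ 2 := by
  have hp := Real.two_pi_pos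
  have hψr := h.ψr_cont h0 h1
  have hqc : Continuous fun t : ℝ => ‖q (ψ (r * eI t))‖ ^ 2 := (hq.continuous.comp hψr).norm.pow 2
  obtain ⟨M, hM⟩ : ∃ M, ∀ t : ℝ, ‖deriv ψ (r * eI t) * (r * (eI t * I))‖ ≤ M := by
    obtain ⟨M, hM⟩ := (isCompact_Icc (a := (0 : ℝ)) (b := 0 + 2 * Real.pi)).bddAbove_image
      (f := fun t : ℝ => ‖deriv ψ (r * eI t) * (r * (eI t * I))‖)
      (by have a := h.ψr_dcont h0 h1; have b := eI_cont; fun_prop)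
    refine ⟨M, fun t => ?_⟩
    obtain ⟨t', ht', he⟩ := eI_surj 0 (eI_norm t)
    rw [← he]
    exact hM ⟨t', Ico_subset_Icc_self ht', rfl⟩
  have hlip : ∀ a b : ℝ, ‖ψ (r * eI b) - ψ (r * eI a)‖ ≤ M * ‖b - a‖ := fun a b =>
    Convex.norm_image_sub_le_of_norm_hasDerivWithin_le (s := univ)
      (fun x _ => (h.ψr_hasDeriv h0 h1 x).hasDerivWithinAt) (fun x _ => hM x) convex_univ
      (mem_univ _) (mem_univ _)
  have hδt : Tendsto (fun N : ℕ => 2 * Real.pi / (N : ℝ)) atTop (nhds 0) :=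
    tendsto_const_div_atTop_nhds_zero_nat _
  have hlim : Tendsto (fun N : ℕ => ∫ t in (0:ℝ)..(2 * Real.pi), ‖q (ψ (r * eI t))‖ ^ 2 *
      (‖ψ (r * eI (t + 2 * Real.pi / N)) - ψ (r * eI t)‖ / (2 * Real.pi / N))) atTop
      (nhds (∫ t in (0:ℝ)..(2 * Real.pi), ‖q (ψ (r * eI t))‖ ^ 2 * (r * ‖deriv ψ (r * eI t)‖))) := by
    refine intervalIntegral.tendsto_integral_filter_of_dominated_convergence
      (fun t => ‖q (ψ (r * eI t))‖ ^ 2 * M) ?_ ?_ ?_ ?_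
    · refine Eventually.of_forall fun N => Continuous.aestronglyMeasurable ?_
      have a1 : Continuous fun t : ℝ => ψ (r * eI (t + 2 * Real.pi / N)) :=
        hψr.comp (continuous_id.add continuous_const)
      exact hqc.mul ((a1.sub hψr).norm.div_const _)
    · filter_upwards [eventually_gt_atTop 0] with N hN
      refine Eventually.of_forall fun t _ => ?_
      have hN' : (0 : ℝ) < N := by exact_mod_cast hN
      have hd : 0 < 2 * Real.pi / N := by positivity
      rw [norm_mul, norm_pow, norm_norm, Real.norm_of_nonneg (by positivity :
        0 ≤ ‖ψ (r * eI (t + 2 * Real.pi / N)) - ψ (r * eI t)‖ / (2 * Real.pi / N))]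
      gcongr
      rw [div_le_iff₀ hd]
      have := hlip t (t + 2 * Real.pi / N)
      rwa [add_sub_cancel_left, Real.norm_of_nonneg hd.le] at this
    · exact (hqc.mul continuous_const).intervalIntegrable _ _
    · refine Eventually.of_forall fun t _ => Tendsto.const_mul _ ?_
      have hs := (hasDerivAt_iff_tendsto_slope_zero.1 (h.ψr_hasDeriv h0 h1 t)).norm
      have hs2 := hs.comp (f := fun N : ℕ => 2 * Real.pi / (N : ℝ)) (tendsto_nhdsWithin_iff.2 ⟨hδt, by
        filter_upwards [eventually_gt_atTop 0] with N hN
        have hN' : (0 : ℝ) < N := by exact_mod_cast hN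
        have : (2 * Real.pi / N) ≠ 0 := by positivity
        exact this⟩)
      have he : ‖deriv ψ (r * eI t) * (r * (eI t * I))‖ = r * ‖deriv ψ (r * eI t)‖ := by
        simp [eI_norm, abs_of_nonneg h0]; ring
      rw [he] at hs2
      refine hs2.congr' ?_
      filter_upwards [eventually_gt_atTop 0] with N hN
      have hN' : (0 : ℝ) < N := by exact_mod_cast hN
      have hd : 0 < 2 * Real.pi / N := by positivity
      simp only [Function.comp, norm_smul, norm_inv, Real.norm_of_nonneg hd.le]
      rw [inv_mul_eq_div]
  refine le_of_forall_pos_le_add fun ε hε => ?_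
  have hl := D.l_pos
  obtain ⟨N0, -, hN⟩ := h.avg hq h0 h1 (ε := ε / D.l) (by positivity)
  rw [div_mul_cancel₀ _ hl.ne'] at hN
  exact le_of_tendsto hlim (eventually_atTop.2 ⟨N0, hN⟩)

end DiscModel

structure Smir (ψ : ℂ → ℂ) (h : ℝ → ℝ) : Prop where
  ii : IntervalIntegrable h volume 0 (2 * Real.pi)
  lim : ∀ᵐ (θ : ℝ) ∂(volume.restrict (Ioc (0 : ℝ) (2 * Real.pi))),
        Tendsto (fun r : ℝ => Real.log ‖deriv ψ ((r : ℂ) * eI θ)‖)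
          (nhdsWithin 1 (Iio 1)) (nhds (h θ))
  poi : ∀ w ∈ ball (0 : ℂ) 1, Real.log ‖deriv ψ w‖ =
          (1 / (2 * Real.pi)) * ∫ θ in (0 : ℝ)..(2 * Real.pi),
            ((1 - ‖w‖ ^ 2) / ‖eI θ - w‖ ^ 2) * h θ
  nz : ∀ w ∈ ball (0 : ℂ) 1, deriv ψ w ≠ 0

theorem eI_sub_ne {w : ℂ} (hw : w ∈ ball (0 : ℂ) 1) (θ : ℝ) : ‖eI θ - w‖ ^ 2 ≠ 0 := by
  have h1 : ‖w‖ < 1 := by simpa using hw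
  have : eI θ ≠ w := fun h => by rw [← h, eI_norm] at h1; exact lt_irrefl _ h1
  have := norm_pos_iff.2 (sub_ne_zero.2 this)
  positivity

theorem poi_cont {w : ℂ} (hw : w ∈ ball (0 : ℂ) 1) :
    Continuous fun θ : ℝ => (1 - ‖w‖ ^ 2) / ‖eI θ - w‖ ^ 2 := by
  have := eI_cont
  exact continuous_const.div (by fun_prop) (eI_sub_ne hw)

theorem poi_nonneg {w : ℂ} (hw : w ∈ ball (0 : ℂ) 1) (θ : ℝ) :
    0 ≤ (1 - ‖w‖ ^ 2) / ‖eI θ - w‖ ^ 2 := by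
  have h1 : ‖w‖ < 1 := by simpa using hw
  have : 0 ≤ 1 - ‖w‖ ^ 2 := by nlinarith [norm_nonneg w]
  positivity

theorem poi_avg {w : ℂ} (hw : w ∈ ball (0 : ℂ) 1) {f : ℂ → ℂ} (hf : DiffContOnCl ℂ f (ball 0 1)) :
    ∫ θ in (0:ℝ)..(2 * Real.pi), ((((1 - ‖w‖ ^ 2) / ‖eI θ - w‖ ^ 2 : ℝ)) : ℂ) * f (eI θ) =
      2 * Real.pi * f w := by
  have h := hf.circleAverage_poissonKernel_smul' (w := w) hw
  rw [Real.circleAverage_def] at h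
  have e : ∀ θ : ℝ, circleMap 0 1 θ = eI θ := fun θ => by simp [circleMap, eI]
  simp only [e, sub_zero, eI_norm, one_pow, Complex.real_smul] at h
  rw [← h]
  push_cast
  have := Real.pi_pos.ne'
  field_simp

theorem poi_one {w : ℂ} (hw : w ∈ ball (0 : ℂ) 1) :
    ∫ θ in (0:ℝ)..(2 * Real.pi), (1 - ‖w‖ ^ 2) / ‖eI θ - w‖ ^ 2 = 2 * Real.pi := by
  have h := poi_avg hw (f := fun _ => 1) (Differentiable.diffContOnCl (by fun_prop))
  simp only [mul_one] at h
  rw [intervalIntegral.integral_ofReal] at h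
  exact_mod_cast h

theorem poi_symm (r θ t : ℝ) : ‖eI t - r * eI θ‖ = ‖eI θ - r * eI t‖ := by
  have : eI t - r * eI θ = eI t * eI θ * (starRingEnd ℂ) (eI θ - r * eI t) := by
    have c : ∀ x : ℝ, (starRingEnd ℂ) (eI x) * eI x = 1 := fun x => by
      rw [← normSq_eq_conj_mul_self, normSq_eq_norm_sq, eI_norm]; simp
    simp only [map_sub, map_mul, conj_ofReal]
    linear_combination -(eI t) * c θ + r * eI θ * c t
  rw [this, norm_mul, norm_mul, RCLike.norm_conj, eI_norm, eI_norm, one_mul, one_mul]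

namespace Smir
variable {D : JordanDomain} {φ ψ : ℂ → ℂ} {h : ℝ → ℝ}

theorem lim' (S : Smir ψ h) : ∀ᵐ (θ : ℝ) ∂(volume.restrict (Ioc (0 : ℝ) (2 * Real.pi))),
        Tendsto (fun r : ℝ => ‖deriv ψ ((r : ℂ) * eI θ)‖)
          (nhdsWithin 1 (Iio 1)) (nhds (Real.exp (h θ))) := by
  filter_upwards [S.lim] with θ hθ
  refine ((Real.continuous_exp.tendsto _).comp hθ).congr' ?_
  have : Ioo (0:ℝ) 1 ∈ nhdsWithin (1:ℝ) (Iio 1) := Ioo_mem_nhdsLT one_pos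
  filter_upwards [this] with r hr
  exact Real.exp_log (norm_pos_iff.2 (S.nz _ (r_eI_mem hr.1.le hr.2 θ)))

theorem hm (S : Smir ψ h) : AEStronglyMeasurable (fun t => Real.exp (h t))
    (volume.restrict (Ioc (0 : ℝ) (2 * Real.pi))) :=
  Real.continuous_exp.comp_aestronglyMeasurable S.ii.aestronglyMeasurable

noncomputable def rn (n : ℕ) : ℝ := 1 - 1 / ((n : ℝ) + 2)

theorem rn_mem (n : ℕ) : 1 / 2 ≤ rn n ∧ rn n < 1 := by
  unfold rn
  have : (0:ℝ) < n + 2 := by positivity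
  have h2 : 1 / ((n:ℝ) + 2) ≤ 1 / 2 := by
    apply one_div_le_one_div_of_le <;> linarith [(Nat.cast_nonneg n : (0:ℝ) ≤ n)]
  have h3 : 0 < 1 / ((n:ℝ) + 2) := by positivity
  constructor <;> linarith

theorem rn_lim : Tendsto rn atTop (nhdsWithin 1 (Iio 1)) := by
  refine tendsto_nhdsWithin_iff.2 ⟨?_, Eventually.of_forall fun n => (rn_mem n).2⟩
  have h1 := tendsto_one_div_add_atTop_nhds_zero_nat (𝕜 := ℝ)
  have h2 := (h1.comp (tendsto_add_atTop_nat 1)).const_sub 1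
  simp only [sub_zero] at h2
  refine h2.congr fun n => ?_
  simp only [Function.comp, rn]; push_cast; ring

theorem exp_int (S : Smir ψ h) (H : DiscModel D φ ψ) :
    IntervalIntegrable (fun t => Real.exp (h t)) volume 0 (2 * Real.pi) := by
  have hp := Real.two_pi_pos
  rw [intervalIntegrable_iff_integrableOn_Ioc_of_le hp.le]
  refine ⟨S.hm, ?_⟩
  rw [hasFiniteIntegral_iff_ofReal (Eventually.of_forall fun t => (Real.exp_pos _).le)]
  set F : ℕ → ℝ → ENNReal := fun n t => ENNReal.ofReal ‖deriv ψ (rn n * eI t)‖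
  have hc : ∀ n, Continuous fun t : ℝ => ‖deriv ψ (rn n * eI t)‖ := fun n =>
    (H.ψr_dcont (by linarith [(rn_mem n).1]) (rn_mem n).2).norm
  have hb : ∀ n, ∫⁻ t in Ioc 0 (2 * Real.pi), F n t ≤ ENNReal.ofReal (2 * D.l) := fun n => by
    have h1 := H.hardy (q := fun _ => 1) (by fun_prop) (r := rn n)
      (by linarith [(rn_mem n).1]) (rn_mem n).2
    simp only [norm_one, one_pow, one_mul, intervalIntegral.integral_const_mul] at h1
    rw [← ofReal_integral_eq_lintegral_ofReal ((hc n).integrableOn_Ioc)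
      (Eventually.of_forall fun t => norm_nonneg _)]
    apply ENNReal.ofReal_le_ofReal
    rw [← intervalIntegral.integral_of_le hp.le]
    simp at h1
    have h3 : 0 ≤ ∫ t in (0:ℝ)..(2 * Real.pi), ‖deriv ψ (rn n * eI t)‖ :=
      intervalIntegral.integral_nonneg hp.le fun t _ => norm_nonneg _
    nlinarith [(rn_mem n).1]
  have hF : ∫⁻ t in Ioc 0 (2 * Real.pi), ENNReal.ofReal (Real.exp (h t)) ≤
      liminf (fun n => ∫⁻ t in Ioc 0 (2 * Real.pi), F n t) atTop := by
    refine le_trans (lintegral_mono_ae ?_) (lintegral_liminf_le fun n =>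
      (ENNReal.continuous_ofReal.comp (hc n)).measurable)
    filter_upwards [S.lim'] with t ht
    have := ((ENNReal.continuous_ofReal.tendsto _).comp (ht.comp rn_lim)).liminf_eq
    exact this.ge
  refine lt_of_le_of_lt (hF.trans (liminf_le_of_le (a := ENNReal.ofReal (2 * D.l)) ?_ ?_))
    ENNReal.ofReal_lt_top
  · isBoundedDefault
  · intro b hbb
    obtain ⟨n, hn⟩ := hbb.exists
    exact hn.trans (hb n)

theorem jensen (S : Smir ψ h) (H : DiscModel D φ ψ) {w : ℂ} (hw : w ∈ ball (0:ℂ) 1) :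
    2 * Real.pi * ‖deriv ψ w‖ ≤
      ∫ t in (0:ℝ)..(2 * Real.pi), ((1 - ‖w‖ ^ 2) / ‖eI t - w‖ ^ 2) * Real.exp (h t) := by
  have hp := Real.two_pi_pos
  have hpos := norm_pos_iff.2 (S.nz w hw)
  set m := Real.log ‖deriv ψ w‖ with hm
  have hem : Real.exp m = ‖deriv ψ w‖ := Real.exp_log hpos
  have hc := poi_cont hw
  set P : ℝ → ℝ := fun t => (1 - ‖w‖ ^ 2) / ‖eI t - w‖ ^ 2 with hP
  have i1 : IntervalIntegrable (fun t => P t * h t) volume 0 (2 * Real.pi) :=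
    S.ii.continuousOn_mul hc.continuousOn
  have i2 : IntervalIntegrable (fun t => P t * Real.exp (h t)) volume 0 (2 * Real.pi) :=
    (S.exp_int H).continuousOn_mul hc.continuousOn
  have i3 : IntervalIntegrable (fun t => P t) volume 0 (2 * Real.pi) := hc.intervalIntegrable _ _
  have i4 : IntervalIntegrable (fun t => (1 - m) * P t + P t * h t) volume 0 (2 * Real.pi) :=
    (i3.const_mul _).add i1
  have key : ∫ t in (0:ℝ)..(2 * Real.pi), Real.exp m * ((1 - m) * P t + P t * h t) =
      2 * Real.pi * ‖deriv ψ w‖ := by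
    rw [intervalIntegral.integral_const_mul, intervalIntegral.integral_add (i3.const_mul _) i1,
      intervalIntegral.integral_const_mul, poi_one hw, hem]
    have := S.poi w hw
    rw [← hm] at this
    have e : ∫ t in (0:ℝ)..(2 * Real.pi), P t * h t = 2 * Real.pi * m := by
      rw [this, ← mul_assoc, mul_one_div_cancel hp.ne', one_mul]
    rw [e]; ring
  rw [← key]
  refine intervalIntegral.integral_mono_on hp.le (i4.const_mul _) i2 fun t _ => ?_
  have h1 := Real.add_one_le_exp (h t - m)
  rw [Real.exp_sub, le_div_iff₀ (Real.exp_pos m)] at h1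
  have := mul_le_mul_of_nonneg_left h1 (poi_nonneg hw t)
  simp only [hP] at this ⊢
  linarith

theorem total (S : Smir ψ h) (H : DiscModel D φ ψ) {r : ℝ} (h0 : 0 ≤ r) (h1 : r < 1) :
    ∫ t in (0:ℝ)..(2 * Real.pi), ‖deriv ψ (r * eI t)‖ ≤
      ∫ t in (0:ℝ)..(2 * Real.pi), Real.exp (h t) := by
  have hp := Real.two_pi_pos
  set P : ℝ → ℝ → ℝ := fun θ t => (1 - ‖(r : ℂ) * eI θ‖ ^ 2) / ‖eI t - r * eI θ‖ ^ 2 with hP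
  have hPs : ∀ θ t, P θ t = P t θ := fun θ t => by
    simp only [hP, poi_symm r θ t, norm_mul, eI_norm]
  have hPc : Continuous (Function.uncurry P) := by
    have := eI_cont
    refine Continuous.div (by fun_prop) (by fun_prop) fun x => ?_
    exact eI_sub_ne (r_eI_mem h0 h1 _) _
  have he := (intervalIntegrable_iff_integrableOn_Ioc_of_le hp.le).1 (S.exp_int H)
  have hb : ∀ x : ℝ × ℝ, ‖Function.uncurry P x‖ ≤ (1 - r ^ 2) / (1 - r) ^ 2 := by
    rintro ⟨θ, t⟩
    have := poi_nonneg (r_eI_mem h0 h1 θ) t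
    simp only [Function.uncurry, hP]
    rw [Real.norm_of_nonneg this]
    have e : ‖(r : ℂ) * eI θ‖ = r := by simp [eI_norm, abs_of_nonneg h0]
    rw [e]
    have : 1 - r ≤ ‖eI t - r * eI θ‖ := by
      have := norm_sub_norm_le (eI t) (r * eI θ)
      rwa [e, eI_norm] at this
    have h2 : 0 ≤ 1 - r ^ 2 := by nlinarith
    have h3 : 0 < 1 - r := by linarith
    gcongr
  have hint : Integrable (fun x : ℝ × ℝ => P x.1 x.2 * Real.exp (h x.2))
      ((volume.restrict (Ioc 0 (2 * Real.pi))).prod (volume.restrict (Ioc 0 (2 * Real.pi)))) := by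
    have e1 : Integrable (fun x : ℝ × ℝ => Real.exp (h x.2))
      ((volume.restrict (Ioc 0 (2 * Real.pi))).prod (volume.restrict (Ioc 0 (2 * Real.pi)))) :=
      he.comp_snd _
    exact e1.bdd_mul hPc.aestronglyMeasurable (Eventually.of_forall hb)
  have hsw := integral_integral_swap (f := fun θ t => P θ t * Real.exp (h t)) hint
  simp only [← intervalIntegral.integral_of_le hp.le] at hsw
  have hR : ∀ t, ∫ θ in (0:ℝ)..(2 * Real.pi), P θ t * Real.exp (h t) =
      2 * Real.pi * Real.exp (h t) := fun t => by
    rw [intervalIntegral.integral_mul_const]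
    simp only [hPs _ t]
    rw [poi_one (r_eI_mem h0 h1 t)]
  simp only [hR, intervalIntegral.integral_const_mul] at hsw
  have hL : ∫ θ in (0:ℝ)..(2 * Real.pi), 2 * Real.pi * ‖deriv ψ (r * eI θ)‖ ≤
      ∫ θ in (0:ℝ)..(2 * Real.pi), ∫ t in (0:ℝ)..(2 * Real.pi), P θ t * Real.exp (h t) := by
    refine intervalIntegral.integral_mono_on hp.le ?_ ?_ fun θ _ =>
      S.jensen H (r_eI_mem h0 h1 θ)
    · exact ((H.ψr_dcont h0 h1).norm.const_mul _).intervalIntegrable _ _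
    · rw [intervalIntegrable_iff_integrableOn_Ioc_of_le hp.le]
      simp only [intervalIntegral.integral_of_le hp.le]
      exact hint.integral_prod_left
  rw [hsw, intervalIntegral.integral_const_mul] at hL
  exact le_of_mul_le_mul_left hL hp

theorem arc (S : Smir ψ h) (H : DiscModel D φ ψ) (a b : ℝ) (ha : 0 ≤ a) (hab : a ≤ b)
    (hb : b ≤ 2 * Real.pi) :
    ‖ψ (eI b) - ψ (eI a)‖ ≤ ∫ θ in a..b, Real.exp (h θ) := by
  have hp := Real.two_pi_pos
  have he := S.exp_int H
  set f : ℝ → ℝ := fun t => Real.exp (h t) with hf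
  set g : ℕ → ℝ → ℝ := fun n t => ‖deriv ψ (rn n * eI t)‖ with hg
  have hr0 : ∀ n, 0 ≤ rn n := fun n => by linarith [(rn_mem n).1]
  have hgc : ∀ n, Continuous (g n) := fun n => (H.ψr_dcont (hr0 n) (rn_mem n).2).norm
  have hgi : ∀ n, IntervalIntegrable (g n) volume 0 (2 * Real.pi) := fun n =>
    (hgc n).intervalIntegrable _ _
  have hsub : uIcc a b ⊆ uIcc 0 (2 * Real.pi) := by
    rw [uIcc_of_le hab, uIcc_of_le hp.le]; exact Icc_subset_Icc ha hb
  have hmi : ∀ n, IntervalIntegrable (fun t => max (f t - g n t) 0) volume 0 (2 * Real.pi) :=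
    fun n => by
      have := he.sub (hgi n)
      exact ⟨this.1.pos_part, this.2.pos_part⟩
  have hlim : Tendsto (fun n => ∫ t in (0:ℝ)..(2 * Real.pi), max (f t - g n t) 0) atTop
      (nhds 0) := by
    suffices hs : Tendsto (fun n => ∫ t in (0:ℝ)..(2 * Real.pi), max (f t - g n t) 0) atTop
        (nhds (∫ t in (0:ℝ)..(2 * Real.pi), (0:ℝ))) by
      rwa [intervalIntegral.integral_zero] at hs
    refine intervalIntegral.tendsto_integral_filter_of_dominated_convergence (l := atTop) f
      (Eventually.of_forall fun n => ?_) (Eventually.of_forall fun n =>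
        Eventually.of_forall fun t _ => ?_) he ?_
    · exact (intervalIntegrable_iff.1 (hmi n)).aestronglyMeasurable
    · rw [Real.norm_of_nonneg (le_max_right _ _)]
      exact max_le (by linarith [show 0 ≤ g n t from norm_nonneg _]) (Real.exp_pos _).le
    · rw [uIoc_of_le hp.le, ← ae_restrict_iff' measurableSet_Ioc]
      filter_upwards [S.lim'] with t ht
      have h1 : Tendsto (fun n => max (f t - g n t) 0) atTop (nhds (max (f t - f t) 0)) :=
        ((ht.comp rn_lim).const_sub _).max tendsto_const_nhds
      simpa using h1
  have hstep : ∀ n, ‖ψ (rn n * eI b) - ψ (rn n * eI a)‖ ≤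
      (∫ θ in a..b, f θ) + ∫ t in (0:ℝ)..(2 * Real.pi), max (f t - g n t) 0 := fun n => by
    have d1 : ‖ψ (rn n * eI b) - ψ (rn n * eI a)‖ ≤ ∫ t in a..b, g n t := by
      have hcd : Continuous fun t : ℝ =>
          deriv ψ ((rn n : ℂ) * eI t) * (rn n * (eI t * I)) := by
        have a1 := H.ψr_dcont (hr0 n) (rn_mem n).2
        have a2 := eI_cont
        fun_prop
      rw [← intervalIntegral.integral_eq_sub_of_hasDerivAt
        (fun t _ => H.ψr_hasDeriv (hr0 n) (rn_mem n).2 t) (hcd.intervalIntegrable _ _)]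
      refine (intervalIntegral.norm_integral_le_integral_norm hab).trans ?_
      refine intervalIntegral.integral_mono_on hab (hcd.norm.intervalIntegrable _ _)
        ((hgc n).intervalIntegrable _ _) fun t _ => ?_
      simp only [norm_mul, eI_norm, Complex.norm_I, mul_one, Complex.norm_real,
        Real.norm_of_nonneg (hr0 n), hg]
      exact mul_le_of_le_one_right (norm_nonneg _) (rn_mem n).2.le
    have d2 : ∫ t in a..b, (g n t - f t) ≤
        ∫ t in (0:ℝ)..(2 * Real.pi), max (g n t - f t) 0 := by
      have hi : IntervalIntegrable (fun t => max (g n t - f t) 0) volume 0 (2 * Real.pi) := by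
        have := (hgi n).sub he
        exact ⟨this.1.pos_part, this.2.pos_part⟩
      calc _ ≤ ∫ t in a..b, max (g n t - f t) 0 :=
            intervalIntegral.integral_mono_on hab (((hgi n).sub he).mono_set hsub)
              (hi.mono_set hsub) fun t _ => le_max_left _ _
        _ ≤ _ := intervalIntegral.integral_mono_interval ha hab hb
            (Eventually.of_forall fun t => le_max_right _ _) hi
    have d3 : ∫ t in (0:ℝ)..(2 * Real.pi), max (g n t - f t) 0 =
        (∫ t in (0:ℝ)..(2 * Real.pi), g n t) - (∫ t in (0:ℝ)..(2 * Real.pi), f t) +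
          ∫ t in (0:ℝ)..(2 * Real.pi), max (f t - g n t) 0 := by
      rw [← intervalIntegral.integral_sub (hgi n) he,
        ← intervalIntegral.integral_add ((hgi n).sub he) (hmi n)]
      congr 1; ext t
      rcases le_total (g n t) (f t) with hh | hh
      · rw [max_eq_right (by linarith), max_eq_left (by linarith)]; ring
      · rw [max_eq_left (by linarith), max_eq_right (by linarith)]; ring
    rw [intervalIntegral.integral_sub ((hgi n).mono_set hsub) (he.mono_set hsub)] at d2
    have d4 := S.total H (hr0 n) (rn_mem n).2
    linarith
  have hψ : ∀ t : ℝ, Tendsto (fun n => ψ (rn n * eI t)) atTop (nhds (ψ (eI t))) := fun t => by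
    have h1 : Tendsto (fun n => (rn n : ℂ) * eI t) atTop (nhdsWithin (eI t) (closedBall 0 1)) := by
      refine tendsto_nhdsWithin_iff.2 ⟨?_, Eventually.of_forall fun n =>
        ball_subset_closedBall (r_eI_mem (hr0 n) (rn_mem n).2 t)⟩
      have h2 : Tendsto rn atTop (nhds 1) := rn_lim.mono_right nhdsWithin_le_nhds
      have h3 := ((continuous_ofReal.tendsto _).comp h2).mul_const (eI t)
      simpa using h3
    exact (H.cψ (eI t) (eI_cb t)).tendsto.comp h1
  have hfin := le_of_tendsto_of_tendsto' ((hψ b).sub (hψ a)).norm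
    (hlim.const_add (∫ θ in a..b, f θ)) hstep
  simpa using hfin

/-- length domination -/
theorem len (S : Smir ψ h) (H : DiscModel D φ ψ) {f : ℂ → ℝ} (hf : Continuous f)
    (hf0 : ∀ z, 0 ≤ f z) :
    ∫ s in (0:ℝ)..D.l, f (D.γ s) ≤ ∫ θ in (0:ℝ)..(2 * Real.pi), f (ψ (eI θ)) * Real.exp (h θ) :=
  H.len_le hf hf0 (fun _ => (Real.exp_pos _).le) (S.exp_int H) (S.arc H)

theorem mean (S : Smir ψ h) :
    ∫ θ in (0:ℝ)..(2 * Real.pi), h θ = 2 * Real.pi * Real.log ‖deriv ψ 0‖ := by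
  have := S.poi 0 (by simp)
  simp [eI_norm] at this
  rw [this]; have := Real.pi_pos.ne'; field_simp

end Smir

/-- uniform approximability by polynomials -/
def PA (K : Set ℂ) (f : ℂ → ℂ) : Prop :=
  ∀ ε > 0, ∃ Q : Polynomial ℂ, ∀ z ∈ K, ‖f z - Q.eval z‖ ≤ ε

namespace PA
variable {K : Set ℂ}

theorem poly (Q : Polynomial ℂ) : PA K fun z => Q.eval z := fun ε hε => ⟨Q, fun z _ => by
  simpa using hε.le⟩

theorem lim {f : ℂ → ℂ} (hf : ∀ ε > 0, ∃ g, PA K g ∧ ∀ z ∈ K, ‖f z - g z‖ ≤ ε) : PA K f := by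
  intro ε hε
  obtain ⟨g, hg, h1⟩ := hf (ε / 2) (by positivity)
  obtain ⟨Q, hQ⟩ := hg (ε / 2) (by positivity)
  refine ⟨Q, fun z hz => ?_⟩
  have := norm_sub_le_norm_sub_add_norm_sub (f z) (g z) (Q.eval z)
  linarith [h1 z hz, hQ z hz]

theorem add {f g : ℂ → ℂ} (hf : PA K f) (hg : PA K g) : PA K fun z => f z + g z := by
  intro ε hε
  obtain ⟨P, hP⟩ := hf (ε / 2) (by positivity)
  obtain ⟨Q, hQ⟩ := hg (ε / 2) (by positivity)
  refine ⟨P + Q, fun z hz => ?_⟩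
  rw [Polynomial.eval_add, add_sub_add_comm]
  linarith [norm_add_le (f z - P.eval z) (g z - Q.eval z), hP z hz, hQ z hz]

theorem bdd (hK : IsCompact K) {f : ℂ → ℂ} (hf : PA K f) : ∃ M > 0, ∀ z ∈ K, ‖f z‖ ≤ M := by
  obtain ⟨P, hP⟩ := hf 1 one_pos
  obtain ⟨M, hM⟩ := hK.bddAbove_image (f := fun z => ‖P.eval z‖) (by fun_prop)
  refine ⟨|M| + 1, by positivity, fun z hz => ?_⟩
  have h1 : ‖P.eval z‖ ≤ M := hM ⟨z, hz, rfl⟩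
  have h2 := norm_sub_norm_le (f z) (P.eval z)
  linarith [hP z hz, le_abs_self M]

theorem mul (hK : IsCompact K) {f g : ℂ → ℂ} (hf : PA K f) (hg : PA K g) :
    PA K fun z => f z * g z := by
  intro ε hε
  obtain ⟨M, hM0, hM⟩ := hf.bdd hK
  obtain ⟨Q, hQ⟩ := hg (ε / 2 / M) (by positivity)
  obtain ⟨N, hN0, hN⟩ := (poly (K := K) Q).bdd hK
  obtain ⟨P, hP⟩ := hf (ε / 2 / N) (by positivity)
  refine ⟨P * Q, fun z hz => ?_⟩
  have e : f z * g z - (P * Q).eval z = f z * (g z - Q.eval z) + (f z - P.eval z) * Q.eval z := by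
    rw [Polynomial.eval_mul]; ring
  rw [e]
  refine (norm_add_le _ _).trans ?_
  rw [norm_mul, norm_mul]
  have h1 := mul_le_mul (hM z hz) (hQ z hz) (norm_nonneg _) hM0.le
  have h2 := mul_le_mul (hP z hz) (hN z hz) (norm_nonneg _) (by positivity)
  have e1 : M * (ε / 2 / M) = ε / 2 := by field_simp
  have e2 : ε / 2 / N * N = ε / 2 := by field_simp
  linarith

theorem comp_poly (hK : IsCompact K) {f : ℂ → ℂ} (hf : PA K f) (Q : Polynomial ℂ) :
    PA K fun z => Q.eval (f z) := by
  induction Q using Polynomial.induction_on' with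
  | add p q hp hq => simpa using hp.add hq
  | monomial n a =>
    simp only [Polynomial.eval_monomial]
    induction n with
    | zero => simpa using poly (K := K) (Polynomial.C a)
    | succ n ih => simpa [pow_succ, mul_assoc] using ih.mul hK hf

theorem comp (hK : IsCompact K) {f g : ℂ → ℂ} {S : Set ℂ} (hg : PA S g) (hf : PA K f)
    (hm : MapsTo f K S) : PA K fun z => g (f z) := by
  refine lim fun ε hε => ?_
  obtain ⟨Q, hQ⟩ := hg ε hε
  exact ⟨_, hf.comp_poly hK Q, fun z hz => hQ _ (hm hz)⟩

theorem of_holo {g : ℂ → ℂ} {ρ R : ℝ} (h0 : 0 ≤ ρ) (hρ : ρ < R)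
    (hg : DifferentiableOn ℂ g (ball 0 R)) : PA (closedBall 0 ρ) g := by
  obtain ⟨R1, h1, h2⟩ := exists_between hρ
  obtain ⟨R2, h3, h4⟩ := exists_between h1
  have hR1 : 0 < R1 := by linarith
  lift R1 to NNReal using hR1.le
  lift R2 to NNReal using (by linarith)
  have hps := (hg.mono (closedBall_subset_ball h2)).hasFPowerSeriesOnBall (by exact_mod_cast hR1)
  have ht := hps.tendstoUniformlyOn (r' := R2) (by exact_mod_cast h4)
  intro ε hε
  rw [Metric.tendstoUniformlyOn_iff] at ht
  obtain ⟨n, hn⟩ := (ht ε hε).exists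
  set p := cauchyPowerSeries g 0 R1
  refine ⟨∑ k ∈ Finset.range n, Polynomial.C (p.coeff k) * Polynomial.X ^ k, fun z hz => ?_⟩
  have hz' : z ∈ ball (0:ℂ) R2 := closedBall_subset_ball h3 hz
  have := (hn z hz').le
  rw [zero_add, dist_eq_norm, FormalMultilinearSeries.partialSum] at this
  simp only [Polynomial.eval_finsetSum, Polynomial.eval_mul, Polynomial.eval_C,
    Polynomial.eval_pow, Polynomial.eval_X]
  simpa only [FormalMultilinearSeries.apply_eq_pow_smul_coeff, smul_eq_mul, mul_comm] using this

theorem ball_inv : PA (closedBall 0 (1/2)) fun y => (1 - y)⁻¹ :=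
  of_holo (R := 1) (by norm_num) (by norm_num) fun y hy => by
    refine DifferentiableAt.differentiableWithinAt (DifferentiableAt.inv (by fun_prop) ?_)
    rintro h
    have : y = 1 := by linear_combination -h
    simp [this] at hy

theorem ball_log : PA (closedBall 0 (1/2)) fun y => Complex.log (1 - y) :=
  of_holo (R := 1) (by norm_num) (by norm_num) fun y hy => by
    refine DifferentiableAt.differentiableWithinAt (DifferentiableAt.clog (by fun_prop) ?_)
    left
    have h1 := Complex.abs_re_le_norm y
    have h2 : ‖y‖ < 1 := by simpa using hy
    simp; linarith [le_abs_self y.re]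

theorem exp (hK : IsCompact K) {f : ℂ → ℂ} (hf : PA K f) : PA K fun z => Complex.exp (f z) := by
  obtain ⟨M, hM0, hM⟩ := hf.bdd hK
  exact comp hK (S := closedBall 0 M) (of_holo (R := M + 1) hM0.le (by linarith)
    (by fun_prop)) hf fun z hz => by simpa using hM z hz

end PA

theorem conn_prop {Ω : Set ℂ} (hΩ : IsPreconnected Ω) {P : ℂ → Prop}
    (h0 : ∃ b ∈ Ω, P b) (hloc : ∀ b ∈ Ω, ∀ᶠ b' in nhds b, P b' ↔ P b) : ∀ b ∈ Ω, P b := by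
  have hs : Ω ⊆ {b | ∀ᶠ b' in nhds b, P b'} := by
    refine hΩ.subset_of_closure_inter_subset (isOpen_setOfPred_eventually_nhds) ?_ ?_
    · obtain ⟨b, hb, hP⟩ := h0
      refine ⟨b, hb, ?_⟩
      filter_upwards [hloc b hb] with b' h using h.2 hP
    · rintro b ⟨h1, h2⟩
      have := hloc b h2
      obtain ⟨b', h3, h4⟩ := mem_closure_iff_nhds.1 h1 _ this
      have h5 : P b := h3.1 h4.self_of_nhds
      filter_upwards [this] with c hc using hc.2 h5
  exact fun b hb => (hs hb).self_of_nhds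

theorem eI_dist {K : Set ℂ} (hK : IsClosed K) {b : ℂ} (hb : b ∈ Kᶜ) :
    ∃ d > 0, ∀ z ∈ K, d ≤ ‖z - b‖ := by
  obtain ⟨d, hd, h⟩ := Metric.isOpen_iff.1 hK.isOpen_compl b hb
  refine ⟨d, hd, fun z hz => ?_⟩
  by_contra hc
  exact h (show z ∈ ball b d by rw [mem_ball, dist_eq_norm]; linarith) hz

namespace DiscModel
variable {D : JordanDomain} {φ ψ : ℂ → ℂ}

theorem cptK (D : JordanDomain) : IsCompact (closure D.G) := D.bounded.isCompact_closure

theorem far (H : DiscModel D φ ψ) : ∃ b ∈ (closure D.G)ᶜ, b ≠ 0 ∧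
    ∀ z ∈ closure D.G, ‖z / b‖ ≤ 1 / 2 := by
  obtain ⟨R, hR, hb⟩ := DiscModel.bddK D
  refine ⟨((2 * R : ℝ) : ℂ), fun h => ?_, by simp [hR.ne'], fun z hz => ?_⟩
  · have := hb _ h
    simp [abs_of_pos hR] at this
    linarith
  · have := hb z hz
    rw [norm_div, Complex.norm_real, Real.norm_of_nonneg (by positivity), div_le_iff₀ (by positivity)]
    linarith

theorem near {b : ℂ} (hb : b ∈ (closure D.G)ᶜ) : ∀ᶠ b' in nhds b, b' ∈ (closure D.G)ᶜ ∧
    (∀ z ∈ closure D.G, ‖(b' - b) / (z - b)‖ ≤ 1 / 2) ∧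
    (∀ z ∈ closure D.G, ‖(b - b') / (z - b')‖ ≤ 1 / 2) := by
  obtain ⟨d, hd, h⟩ := eI_dist isClosed_closure hb
  filter_upwards [ball_mem_nhds b (show 0 < d / 4 by positivity)] with b' hb'
  rw [mem_ball, dist_eq_norm] at hb'
  have h2 : ∀ z ∈ closure D.G, 3 * d / 4 ≤ ‖z - b'‖ := fun z hz => by
    have := norm_sub_le_norm_sub_add_norm_sub z b' b
    linarith [h z hz]
  refine ⟨fun hh => ?_, fun z hz => ?_, fun z hz => ?_⟩
  · have := h2 b' hh; simp at this; linarith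
  · have h3 := h z hz
    rw [norm_div, div_le_iff₀ (by linarith)]; linarith
  · have h3 := h2 z hz
    rw [norm_div, div_le_iff₀ (by linarith), norm_sub_rev b b']; linarith

theorem pa_inv (H : DiscModel D φ ψ) : ∀ b ∈ (closure D.G)ᶜ, PA (closure D.G) fun z => (z - b)⁻¹ := by
  have hK := cptK D
  have key : ∀ b b', b ∈ (closure D.G)ᶜ → b' ∈ (closure D.G)ᶜ →
      (∀ z ∈ closure D.G, ‖(b' - b) / (z - b)‖ ≤ 1 / 2) → PA (closure D.G) (fun z => (z - b)⁻¹) →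
      PA (closure D.G) fun z => (z - b')⁻¹ := by
    intro b b' hb hb' h1 h2
    have h3 : PA (closure D.G) fun z => (b' - b) / (z - b) := by
      simpa [div_eq_mul_inv] using (PA.poly (Polynomial.C (b' - b))).mul hK h2
    have h4 := h2.mul hK (PA.comp hK PA.ball_inv h3 fun z hz => by simpa using h1 z hz)
    refine PA.lim fun ε hε => ⟨_, h4, fun z hz => ?_⟩
    have n1 : z - b ≠ 0 := fun h => hb (by rwa [← sub_eq_zero.1 h])
    have n2 : z - b' ≠ 0 := fun h => hb' (by rwa [← sub_eq_zero.1 h])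
    have e : 1 - (b' - b) / (z - b) = (z - b') / (z - b) := by field_simp; ring
    rw [e, inv_div, ← mul_div_assoc, inv_mul_cancel₀ n1, one_div, sub_self, norm_zero]
    exact hε.le
  refine conn_prop H.ext_conn ?_ fun b hb => ?_
  · obtain ⟨b, hb, hb0, h1⟩ := H.far
    refine ⟨b, hb, ?_⟩
    have h3 : PA (closure D.G) fun z => z / b := by
      have := PA.poly (K := closure D.G) (Polynomial.C (b⁻¹) * Polynomial.X)
      simp only [Polynomial.eval_C_mul, Polynomial.eval_X] at this
      simpa only [div_eq_inv_mul] using this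
    have h4 := (PA.poly (Polynomial.C (-b⁻¹))).mul hK
      (PA.comp hK PA.ball_inv h3 fun z hz => by simpa using h1 z hz)
    refine PA.lim fun ε hε => ⟨_, h4, fun z hz => ?_⟩
    have n1 : z - b ≠ 0 := fun h => hb (by rwa [← sub_eq_zero.1 h])
    have n2 : b - z ≠ 0 := fun h => n1 (by linear_combination -h)
    have e : 1 - z / b = (b - z) / b := by field_simp
    rw [Polynomial.eval_C, e, inv_div]
    have : (z - b)⁻¹ - -b⁻¹ * (b / (b - z)) = 0 := by field_simp; ring
    rw [this, norm_zero]
    exact hε.le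
  · filter_upwards [near hb] with b' h
    exact ⟨key b' b h.1 hb h.2.2, key b b' hb h.1 h.2.1⟩

end DiscModel

/-- representing measures on the boundary -/
structure RepM (D : JordanDomain) (a : ℂ) (ν : Measure ℂ) : Prop where
  prob : IsProbabilityMeasure ν
  supp : ∀ᵐ z ∂ν, z ∈ frontier D.G
  rep : ∀ Q : Polynomial ℂ, ∫ z, Q.eval z ∂ν = Q.eval a

namespace RepM
variable {D : JordanDomain} {φ ψ : ℂ → ℂ} {a : ℂ} {ν : Measure ℂ}

theorem suppK (R : RepM D a ν) : ∀ᵐ z ∂ν, z ∈ closure D.G := by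
  filter_upwards [R.supp] with z hz using frontier_subset_closure hz

theorem int_of_bdd (R : RepM D a ν) {f : ℂ → ℂ} (hm : AEStronglyMeasurable f ν) {M : ℝ}
    (hM : ∀ z ∈ closure D.G, ‖f z‖ ≤ M) : Integrable f ν := by
  have := R.prob
  refine Integrable.of_bound hm M ?_
  filter_upwards [R.suppK] with z hz using hM z hz

theorem int_pa (R : RepM D a ν) {f : ℂ → ℂ} (hm : AEStronglyMeasurable f ν)
    (hf : PA (closure D.G) f) : Integrable f ν := by
  obtain ⟨M, -, hM⟩ := hf.bdd (DiscModel.cptK D)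
  exact R.int_of_bdd hm hM

theorem pa (R : RepM D a ν) (ha : a ∈ closure D.G) {f : ℂ → ℂ} (hm : AEStronglyMeasurable f ν)
    (hf : PA (closure D.G) f) : ∫ z, f z ∂ν = f a := by
  have := R.prob
  refine eq_of_forall_dist_le fun ε hε => ?_
  obtain ⟨Q, hQ⟩ := hf (ε / 2) (by positivity)
  have hQm : AEStronglyMeasurable (fun z => Q.eval z) ν := Q.continuous.aestronglyMeasurable
  have h1 : ‖∫ z, (f z - Q.eval z) ∂ν‖ ≤ ε / 2 := by
    have := norm_integral_le_of_norm_le_const (μ := ν) (f := fun z => f z - Q.eval z) (C := ε / 2)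
      (by filter_upwards [R.suppK] with z hz using hQ z hz)
    simpa using this
  rw [integral_sub (R.int_pa hm hf) (R.int_pa hQm (PA.poly Q)), R.rep] at h1
  rw [dist_eq_norm]
  have h2 := hQ a ha
  have := norm_sub_le_norm_sub_add_norm_sub (∫ z, f z ∂ν) (Q.eval a) (f a)
  rw [norm_sub_rev (Q.eval a) (f a)] at this
  linarith

theorem log_pa (R : RepM D a ν) (ha : a ∈ closure D.G) {x : ℂ → ℂ} (hm : Measurable x)
    (hx : PA (closure D.G) x) (hb : ∀ z ∈ closure D.G, ‖x z‖ ≤ 1 / 2) :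
    Integrable (fun z => Real.log ‖1 - x z‖) ν ∧
    ∫ z, Real.log ‖1 - x z‖ ∂ν = Real.log ‖1 - x a‖ := by
  have h1 := PA.comp (DiscModel.cptK D) PA.ball_log hx fun z hz => by simpa using hb z hz
  have hm' : AEStronglyMeasurable (fun z => Complex.log (1 - x z)) ν :=
    (Complex.measurable_log.comp (measurable_const.sub hm)).aestronglyMeasurable
  have h2 := R.pa ha hm' h1
  have h3 := R.int_pa hm' h1
  have h4 := reCLM.integral_comp_comm h3
  rw [h2] at h4
  simp only [reCLM_apply, Complex.log_re] at h4
  refine ⟨?_, h4⟩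
  have := reCLM.integrable_comp h3
  simpa [Complex.log_re] using this

/-- potentials off K -/
theorem pot (R : RepM D a ν) (H : DiscModel D φ ψ) (ha : a ∈ closure D.G) :
    ∀ b ∈ (closure D.G)ᶜ, Integrable (fun z => Real.log ‖z - b‖) ν ∧
      ∫ z, Real.log ‖z - b‖ ∂ν = Real.log ‖a - b‖ := by
  have := R.prob
  have hne : ∀ b ∈ (closure D.G)ᶜ, ∀ z ∈ closure D.G, z - b ≠ 0 := fun b hb z hz h =>
    hb (by rwa [← sub_eq_zero.1 h])
  have key : ∀ b b', b ∈ (closure D.G)ᶜ → b' ∈ (closure D.G)ᶜ →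
      (∀ z ∈ closure D.G, ‖(b' - b) / (z - b)‖ ≤ 1 / 2) →
      (Integrable (fun z => Real.log ‖z - b‖) ν ∧
      ∫ z, Real.log ‖z - b‖ ∂ν = Real.log ‖a - b‖) →
      Integrable (fun z => Real.log ‖z - b'‖) ν ∧
      ∫ z, Real.log ‖z - b'‖ ∂ν = Real.log ‖a - b'‖ := by
    rintro b b' hb hb' h1 ⟨h2, h3⟩
    have h4 : PA (closure D.G) fun z => (b' - b) / (z - b) := by
      simpa [div_eq_mul_inv] using (PA.poly (Polynomial.C (b' - b))).mul (DiscModel.cptK D)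
        (H.pa_inv b hb)
    obtain ⟨h5, h6⟩ := R.log_pa ha (by fun_prop) h4 h1
    have e : ∀ z ∈ closure D.G, Real.log ‖z - b'‖ =
        Real.log ‖z - b‖ + Real.log ‖1 - (b' - b) / (z - b)‖ := fun z hz => by
      have n1 := hne b hb z hz
      have n2 := hne b' hb' z hz
      have e1 : 1 - (b' - b) / (z - b) = (z - b') / (z - b) := by field_simp; ring
      rw [e1, norm_div, Real.log_div (norm_ne_zero_iff.2 n2) (norm_ne_zero_iff.2 n1)]; ring
    have hae : (fun z => Real.log ‖z - b'‖) =ᵐ[ν] fun z =>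
        Real.log ‖z - b‖ + Real.log ‖1 - (b' - b) / (z - b)‖ := by
      filter_upwards [R.suppK] with z hz using e z hz
    refine ⟨(h2.add h5).congr hae.symm, ?_⟩
    rw [integral_congr_ae hae, integral_add h2 h5, h3, h6, e a ha]
  refine conn_prop H.ext_conn ?_ fun b hb => ?_
  · obtain ⟨b, hb, hb0, h1⟩ := H.far
    have h3 : PA (closure D.G) fun z => z / b := by
      have := PA.poly (K := closure D.G) (Polynomial.C (b⁻¹) * Polynomial.X)
      simp only [Polynomial.eval_C_mul, Polynomial.eval_X] at this
      simpa only [div_eq_inv_mul] using this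
    obtain ⟨h5, h6⟩ := R.log_pa ha (by fun_prop) h3 h1
    have e : ∀ z ∈ closure D.G, Real.log ‖z - b‖ = Real.log ‖b‖ + Real.log ‖1 - z / b‖ :=
      fun z hz => by
        have n1 := hne b hb z hz
        have e1 : 1 - z / b = (b - z) / b := by field_simp
        rw [e1, norm_div, norm_sub_rev b z,
          Real.log_div (norm_ne_zero_iff.2 n1) (norm_ne_zero_iff.2 hb0)]; ring
    have hae : (fun z => Real.log ‖z - b‖) =ᵐ[ν] fun z =>
        Real.log ‖b‖ + Real.log ‖1 - z / b‖ := by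
      filter_upwards [R.suppK] with z hz using e z hz
    refine ⟨b, hb, ((integrable_const _).add h5).congr hae.symm, ?_⟩
    rw [integral_congr_ae hae, integral_add (integrable_const _) h5, h6, e a ha]
    simp
  · filter_upwards [DiscModel.near hb] with b' h
    exact ⟨key b' b h.1 hb h.2.2, key b b' hb h.1 h.2.1⟩

end RepM

noncomputable def lam (C x : ℝ) : ENNReal := if x ≤ 0 then ⊤ else ENNReal.ofReal (Real.log C - Real.log x)

theorem lam_pos (C : ℝ) {x : ℝ} (hx : 0 < x) : lam C x = ENNReal.ofReal (Real.log C - Real.log x) :=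
  if_neg (not_le.2 hx)

theorem lam_anti (C : ℝ) : Antitone (lam C) := by
  intro x y hxy
  rcases le_or_gt x 0 with h | h
  · simp [lam, h]
  · rw [lam_pos C h, lam_pos C (h.trans_le hxy)]
    exact ENNReal.ofReal_le_ofReal (by linarith [Real.log_le_log h hxy])

theorem lam_cont {C : ℝ} (hC : 0 < C) : Continuous (lam C) := by
  rw [continuous_iff_continuousAt]
  intro x
  rcases le_or_gt x 0 with h | h
  · unfold ContinuousAt
    rw [show lam C x = ⊤ by simp [lam, h], ENNReal.tendsto_nhds_top_iff_nat]
    intro n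
    have : x < C * Real.exp (-(n + 1)) := h.trans_lt (by positivity)
    filter_upwards [Iio_mem_nhds this] with y hy
    rcases le_or_gt y 0 with h2 | h2
    · simp [lam, h2]
    · rw [lam_pos C h2]
      have h3 := Real.log_lt_log h2 hy
      rw [Real.log_mul hC.ne' (Real.exp_pos _).ne', Real.log_exp] at h3
      rw [← ENNReal.ofReal_natCast, ENNReal.ofReal_lt_ofReal_iff (by linarith [(Nat.cast_nonneg n : (0:ℝ) ≤ n)])]
      linarith
  · have : (fun y => ENNReal.ofReal (Real.log C - Real.log y)) =ᶠ[nhds x] lam C := by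
      filter_upwards [Ioi_mem_nhds h] with y hy using (lam_pos C hy).symm
    refine ContinuousAt.congr ?_ this
    exact ENNReal.continuous_ofReal.continuousAt.comp
      (continuousAt_const.sub (Real.continuousAt_log h.ne'))

theorem lam_avg {C r x : ℝ} (hr : 0 < r) (hx : 0 < x) (hC : x + r ≤ C) :
    ∫⁻ t in Ioc 0 r, lam C |x - t| ≤ ENNReal.ofReal r * (lam C x + 2) := by
  have e1 : ∫⁻ t in Ioc 0 r, lam C |x - t| =
      ∫⁻ t in Ioc 0 r, ENNReal.ofReal (Real.log C - Real.log (x - t)) := by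
    refine lintegral_congr_ae ?_
    have h0 : ∀ᵐ t ∂(volume.restrict (Ioc 0 r)), t ≠ x :=
      ae_restrict_of_ae (by simp [ae_iff])
    filter_upwards [h0] with t ht
    rw [lam_pos C (abs_pos.2 (sub_ne_zero.2 ht.symm)), Real.log_abs]
  have hi : IntervalIntegrable (fun t => Real.log (x - t)) volume 0 r := by
    have := (intervalIntegral.intervalIntegrable_log' (a := x) (b := x - r)).comp_sub_left x
    simpa using this
  have hi2 : IntervalIntegrable (fun t => Real.log C - Real.log (x - t)) volume 0 r :=
    intervalIntegrable_const.sub hi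
  rw [e1, ← ofReal_integral_eq_lintegral_ofReal
    ((intervalIntegrable_iff_integrableOn_Ioc_of_le hr.le).1 hi2), 
    ← intervalIntegral.integral_of_le hr.le, intervalIntegral.integral_sub intervalIntegrable_const hi,
    intervalIntegral.integral_comp_sub_left (fun t => Real.log t), integral_log, lam_pos C hx]
  · have hA : 0 ≤ Real.log C - Real.log x := by linarith [Real.log_le_log hx (show x ≤ C by linarith)]
    rw [show (2 : ENNReal) = ENNReal.ofReal 2 by simp, ← ENNReal.ofReal_add hA (by norm_num),
      ← ENNReal.ofReal_mul hr.le]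
    apply ENNReal.ofReal_le_ofReal
    simp only [intervalIntegral.integral_const, smul_eq_mul, sub_zero]
    have key : (x - r) * (Real.log (x - r) - Real.log x) ≤ r := by
      rcases lt_trichotomy (x - r) 0 with h | h | h
      · rw [← Real.log_neg_eq_log]
        have h1 := Real.log_le_sub_one_of_pos (x := x / (-(x - r))) (div_pos hx (by linarith))
        rw [Real.log_div hx.ne' (by linarith)] at h1
        have h2 := mul_le_mul_of_nonneg_left h1 (show 0 ≤ -(x - r) by linarith)
        have h3 : -(x - r) * (x / -(x - r) - 1) = x + (x - r) := by
          rw [mul_sub, mul_div_cancel₀ _ (show -(x - r) ≠ 0 by linarith)]; ring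
        linarith
      · rw [h]; simp [hr.le]
      · have := Real.log_le_log h (show x - r ≤ x by linarith)
        have := mul_nonneg h.le (sub_nonneg.2 this)
        nlinarith
    nlinarith
  · have h0 : ∀ᵐ t : ℝ, t ≠ x := by simp [ae_iff]
    refine (ae_restrict_iff' measurableSet_Ioc).2 ?_
    filter_upwards [h0] with t h0 ht
    have h1 : |x - t| ≤ C := abs_le.2 ⟨by linarith [ht.2], by linarith [ht.1]⟩
    simp only [Pi.zero_apply, sub_nonneg]
    rw [← Real.log_abs (x - t)]
    exact Real.log_le_log (abs_pos.2 (sub_ne_zero.2 h0.symm)) h1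

namespace DiscModel
variable {D : JordanDomain} {φ ψ : ℂ → ℂ}

theorem circ (H : DiscModel D φ ψ) {R : ℝ} (hR : ∀ z ∈ closure D.G, ‖z‖ < R) {b : ℂ}
    (hb : b ∈ frontier D.G) {t : ℝ} (h0 : 0 < t) (h1 : t < R) :
    ∃ c ∈ (closure D.G)ᶜ, ‖c - b‖ = t ∧ ‖c‖ < 2 * R := by
  have hbR := hR b (frontier_subset_closure hb)
  obtain ⟨c1, hc1, hd1⟩ := Metric.mem_closure_iff.1 (H.fr_ext hb) t h0
  have hc2 : ((4 * R : ℝ) : ℂ) ∈ (closure D.G)ᶜ := fun h => by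
    have := hR _ h
    rw [Complex.norm_real, Real.norm_of_nonneg (by linarith)] at this; linarith
  have hi := H.ext_conn.intermediate_value hc1 hc2 (f := fun c => ‖c - b‖) (by fun_prop)
  rw [dist_comm, dist_eq_norm] at hd1
  have h4 := norm_sub_norm_le ((4 * R : ℝ) : ℂ) b
  rw [Complex.norm_real, Real.norm_of_nonneg (by linarith)] at h4
  obtain ⟨c, hc, hct⟩ := hi ⟨hd1.le, show t ≤ ‖((4 * R : ℝ) : ℂ) - b‖ by linarith⟩
  refine ⟨c, hc, hct, ?_⟩
  have := norm_sub_norm_le c b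
  simp only at hct
  linarith

end DiscModel

namespace RepM
variable {D : JordanDomain} {φ ψ : ℂ → ℂ} {a : ℂ} {ν : Measure ℂ}

theorem Eext (P : RepM D a ν) (H : DiscModel D φ ψ) (ha : a ∈ closure D.G) {R : ℝ}
    (hR : ∀ z ∈ closure D.G, ‖z‖ < R) {b : ℂ} (hb : b ∈ (closure D.G)ᶜ) (hb2 : ‖b‖ < 2 * R) :
    ∫⁻ z, lam (3 * R) ‖z - b‖ ∂ν = lam (3 * R) ‖a - b‖ := by
  have := P.prob
  obtain ⟨h1, h2⟩ := P.pot H ha b hb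
  have hne : ∀ z ∈ closure D.G, 0 < ‖z - b‖ := fun z hz => norm_pos_iff.2 fun h =>
    hb (by rwa [← sub_eq_zero.1 h])
  have hle : ∀ z ∈ closure D.G, ‖z - b‖ ≤ 3 * R := fun z hz => by
    linarith [norm_sub_le z b, hR z hz]
  rw [lam_pos _ (hne a ha), ← h2]
  have e : ∫ z, (Real.log (3 * R) - Real.log ‖z - b‖) ∂ν =
      Real.log (3 * R) - ∫ z, Real.log ‖z - b‖ ∂ν := by
    rw [integral_sub (integrable_const _) h1]; simp
  have hI : Integrable (fun z => Real.log (3 * R) - Real.log ‖z - b‖) ν :=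
    (integrable_const _).sub h1
  rw [← e, ofReal_integral_eq_lintegral_ofReal hI]
  · refine lintegral_congr_ae ?_
    filter_upwards [P.suppK] with z hz using lam_pos _ (hne z hz)
  · filter_upwards [P.suppK] with z hz
    have := Real.log_le_log (hne z hz) (hle z hz)
    simpa using this

theorem Efr (P : RepM D a ν) (H : DiscModel D φ ψ) (ha : a ∈ D.G) {R : ℝ}
    (hR : ∀ z ∈ closure D.G, ‖z‖ < R) {b : ℂ} (hb : b ∈ frontier D.G) :
    ∫⁻ z, lam (3 * R) ‖z - b‖ ∂ν = lam (3 * R) ‖a - b‖ := by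
  have := P.prob
  have haK := subset_closure ha
  have hbK := frontier_subset_closure hb
  have hbR := hR b hbK
  have hR0 : 0 < R := (norm_nonneg _).trans_lt hbR
  have hlc := lam_cont (show 0 < 3 * R by linarith)
  have hab : 0 < ‖a - b‖ := norm_pos_iff.2 fun h => by
    rw [sub_eq_zero.1 h] at ha
    rw [frontier, D.isOpen.interior_eq] at hb
    exact hb.2 ha
  have hle : ∀ z ∈ closure D.G, ‖z - b‖ ≤ 2 * R := fun z hz => by
    linarith [norm_sub_le z b, hR z hz]
  have low : ∫⁻ z, lam (3 * R) ‖z - b‖ ∂ν ≤ lam (3 * R) ‖a - b‖ := by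
    obtain ⟨u, hu, hul⟩ := mem_closure_iff_seq_limit.1 (H.fr_ext hb)
    have hu2 : ∀ᶠ n in atTop, ‖u n‖ < 2 * R :=
      (hul.norm).eventually_lt_const (by linarith)
    have hc : ∀ z, Tendsto (fun n => lam (3 * R) ‖z - u n‖) atTop (nhds (lam (3 * R) ‖z - b‖)) :=
      fun z => (hlc.tendsto _).comp (hul.const_sub z).norm
    calc ∫⁻ z, lam (3 * R) ‖z - b‖ ∂ν
        = ∫⁻ z, liminf (fun n => lam (3 * R) ‖z - u n‖) atTop ∂ν := by
          refine lintegral_congr fun z => (hc z).liminf_eq.symm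
      _ ≤ liminf (fun n => ∫⁻ z, lam (3 * R) ‖z - u n‖ ∂ν) atTop :=
          lintegral_liminf_le fun n => (hlc.comp (by fun_prop)).measurable
      _ = lam (3 * R) ‖a - b‖ := by
          refine Tendsto.liminf_eq ((hc a).congr' ?_)
          filter_upwards [hu2] with n hn using (P.Eext H haK hR (hu n) hn).symm
  refine le_antisymm low ?_
  set r : ℕ → ℝ := fun n => R / (n + 2) with hr
  have hr0 : ∀ n, 0 < r n := fun n => by positivity
  have hrR : ∀ n, r n < R := fun n => by
    rw [hr]; simp only
    rw [div_lt_iff₀ (by positivity)]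
    nlinarith [(Nat.cast_nonneg n : (0:ℝ) ≤ n)]
  have hrl : Tendsto r atTop (nhds 0) := by
    refine tendsto_const_nhds.div_atTop ?_
    exact tendsto_natCast_atTop_atTop.atTop_add tendsto_const_nhds
  set A : ℕ → ℂ → ENNReal := fun n z =>
    (ENNReal.ofReal (r n))⁻¹ * ∫⁻ t in Ioc 0 (r n), lam (3 * R) |‖z - b‖ - t| with hA
  have hor : ∀ n, ENNReal.ofReal (r n) ≠ 0 := fun n => by simpa using hr0 n
  have hjm : Measurable (fun q : ℂ × ℝ => lam (3 * R) |‖q.1 - b‖ - q.2|) :=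
    (hlc.comp (by fun_prop)).measurable
  have hAm : ∀ n, Measurable (A n) := fun n =>
    (hjm.lintegral_prod_right' (ν := volume.restrict (Ioc 0 (r n)))).const_mul _
  have up : ∀ n, lam (3 * R) (‖a - b‖ + r n) ≤ ∫⁻ z, A n z ∂ν := fun n => by
    rw [hA]
    simp only
    rw [lintegral_const_mul' _ _ (ENNReal.inv_ne_top.2 (hor n)),
      lintegral_lintegral_swap hjm.aemeasurable]
    have : ENNReal.ofReal (r n) * lam (3 * R) (‖a - b‖ + r n) ≤
        ∫⁻ t in Ioc 0 (r n), ∫⁻ z, lam (3 * R) |‖z - b‖ - t| ∂ν := by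
      calc _ = ∫⁻ t in Ioc 0 (r n), lam (3 * R) (‖a - b‖ + r n) := by
            rw [setLIntegral_const]; simp [mul_comm]
        _ ≤ _ := by
            refine setLIntegral_mono' measurableSet_Ioc fun t ht => ?_
            obtain ⟨c, hc, hct, hcR⟩ := H.circ hR hb ht.1 (ht.2.trans_lt (hrR n))
            calc lam (3 * R) (‖a - b‖ + r n) ≤ lam (3 * R) ‖a - c‖ := by
                  apply lam_anti
                  have := norm_sub_le_norm_sub_add_norm_sub a b c
                  rw [norm_sub_rev b c] at this
                  linarith [ht.2]
              _ = ∫⁻ z, lam (3 * R) ‖z - c‖ ∂ν := (P.Eext H haK hR hc hcR).symm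
              _ ≤ _ := lintegral_mono fun z => by
                  apply lam_anti
                  have := abs_norm_sub_norm_le (z - b) (c - b)
                  rwa [sub_sub_sub_cancel_right, hct] at this
    calc _ = (ENNReal.ofReal (r n))⁻¹ * (ENNReal.ofReal (r n) * lam (3 * R) (‖a - b‖ + r n)) := by
          rw [← mul_assoc, ENNReal.inv_mul_cancel (hor n) ENNReal.ofReal_ne_top, one_mul]
      _ ≤ _ := by gcongr
  have dom : ∀ n, A n ≤ᵐ[ν] fun z => lam (3 * R) ‖z - b‖ + 2 := fun n => by
    filter_upwards [P.suppK] with z hz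
    rcases (norm_nonneg (z - b)).eq_or_lt with h | h
    · simp [← h, lam]
    · have := lam_avg (hr0 n) h (C := 3 * R) (by linarith [hle z hz, hrR n])
      calc A n z ≤ (ENNReal.ofReal (r n))⁻¹ * (ENNReal.ofReal (r n) * (lam (3 * R) ‖z - b‖ + 2)) := by
            simp only [hA]; gcongr
        _ = _ := by
          rw [← mul_assoc, ENNReal.inv_mul_cancel (hor n) ENNReal.ofReal_ne_top, one_mul]
  have hfin : ∫⁻ z, (lam (3 * R) ‖z - b‖ + 2) ∂ν ≠ ⊤ := by
    rw [lintegral_add_right _ measurable_const]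
    refine ENNReal.add_ne_top.2 ⟨ne_top_of_le_ne_top ?_ low, by simp⟩
    rw [lam_pos _ hab]; exact ENNReal.ofReal_ne_top
  have hls : ∀ z, limsup (fun n => A n z) atTop ≤ lam (3 * R) ‖z - b‖ := fun z => by
    rcases (norm_nonneg (z - b)).eq_or_lt with h | h
    · simp [← h, lam]
    · have h1 : Tendsto (fun n => lam (3 * R) (‖z - b‖ - r n)) atTop
          (nhds (lam (3 * R) ‖z - b‖)) := by
        have := (hlc.tendsto (‖z - b‖ - 0)).comp (hrl.const_sub ‖z - b‖)
        rwa [sub_zero] at this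
      rw [← h1.limsup_eq]
      refine limsup_le_limsup ?_
      have : ∀ᶠ n in atTop, r n < ‖z - b‖ := hrl.eventually_lt_const h
      filter_upwards [this] with n hn
      calc A n z ≤ (ENNReal.ofReal (r n))⁻¹ *
            (ENNReal.ofReal (r n) * lam (3 * R) (‖z - b‖ - r n)) := by
            simp only [hA]
            gcongr
            calc _ ≤ ∫⁻ t in Ioc 0 (r n), lam (3 * R) (‖z - b‖ - r n) := by
                  refine setLIntegral_mono' measurableSet_Ioc fun t ht => lam_anti _ ?_
                  exact le_trans (by linarith [ht.2]) (le_abs_self _)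
              _ = _ := by rw [setLIntegral_const]; simp [mul_comm]
        _ = _ := by
          rw [← mul_assoc, ENNReal.inv_mul_cancel (hor n) ENNReal.ofReal_ne_top, one_mul]
  have hfinal : Tendsto (fun n => lam (3 * R) (‖a - b‖ + r n)) atTop
      (nhds (lam (3 * R) ‖a - b‖)) := by
    have := (hlc.tendsto (‖a - b‖ + 0)).comp (hrl.const_add ‖a - b‖)
    rwa [add_zero] at this
  rw [← hfinal.limsup_eq]
  calc _ ≤ limsup (fun n => ∫⁻ z, A n z ∂ν) atTop := limsup_le_limsup (Eventually.of_forall up)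
    _ ≤ ∫⁻ z, limsup (fun n => A n z) atTop ∂ν := limsup_lintegral_le _ hAm dom hfin
    _ ≤ _ := lintegral_mono hls

end RepM

namespace DiscModel
variable {D : JordanDomain} {φ ψ : ℂ → ℂ}

/-- harmonic measure -/
noncomputable def om (ψ : ℂ → ℂ) (w : ℂ) : Measure ℂ :=
  ((volume.restrict (Ioc 0 (2 * Real.pi))).withDensity fun θ =>
    ENNReal.ofReal (((1 - ‖w‖ ^ 2) / ‖eI θ - w‖ ^ 2) / (2 * Real.pi))).map fun θ => ψ (eI θ)

theorem om_dens {w : ℂ} (hw : w ∈ ball (0:ℂ) 1) : Measurable fun θ : ℝ =>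
    ENNReal.ofReal (((1 - ‖w‖ ^ 2) / ‖eI θ - w‖ ^ 2) / (2 * Real.pi)) := by
  have := (poi_cont hw).measurable
  fun_prop

theorem om_int (H : DiscModel D φ ψ) {w : ℂ} (hw : w ∈ ball (0:ℂ) 1) {E : Type*}
    [NormedAddCommGroup E] [NormedSpace ℝ E] [SecondCountableTopology E] {f : ℂ → E}
    (hf : Continuous f) :
    ∫ z, f z ∂(om ψ w) = ∫ θ in (0:ℝ)..(2 * Real.pi),
      (((1 - ‖w‖ ^ 2) / ‖eI θ - w‖ ^ 2) / (2 * Real.pi)) • f (ψ (eI θ)) := by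
  have hp := Real.two_pi_pos
  unfold om
  rw [integral_map H.E_cont.measurable.aemeasurable hf.aestronglyMeasurable,
    integral_withDensity_eq_integral_toReal_smul (om_dens hw)
      (Eventually.of_forall fun _ => ENNReal.ofReal_lt_top), intervalIntegral.integral_of_le hp.le]
  congr 1; ext θ
  rw [ENNReal.toReal_ofReal (div_nonneg (poi_nonneg hw θ) hp.le)]

theorem om_rep (H : DiscModel D φ ψ) {w : ℂ} (hw : w ∈ ball (0:ℂ) 1) : RepM D (ψ w) (om ψ w) := by
  have hp := Real.two_pi_pos
  refine ⟨⟨?_⟩, ?_, fun Q => ?_⟩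
  · unfold om
    rw [Measure.map_apply H.E_cont.measurable MeasurableSet.univ, preimage_univ,
      withDensity_apply _ MeasurableSet.univ, Measure.restrict_univ,
      ← ofReal_integral_eq_lintegral_ofReal]
    · rw [← intervalIntegral.integral_of_le hp.le, intervalIntegral.integral_div, poi_one hw,
        div_self hp.ne', ENNReal.ofReal_one]
    · exact ((poi_cont hw).div_const _).integrableOn_Ioc
    · exact Eventually.of_forall fun θ => div_nonneg (poi_nonneg hw θ) hp.le
  · unfold om
    refine (ae_map_iff (p := fun z => z ∈ frontier D.G) H.E_cont.measurable.aemeasurable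
      isClosed_frontier.measurableSet).2 ?_
    exact Eventually.of_forall fun θ => H.sψ (eI_sphere θ)
  · rw [H.om_int hw Q.continuous]
    have h := poi_avg hw (f := fun z => Q.eval (ψ z))
      ⟨Q.differentiable.comp_differentiableOn H.diffcont.1,
        Q.continuous.comp_continuousOn H.diffcont.2⟩
    have e : ∀ θ : ℝ, (((1 - ‖w‖ ^ 2) / ‖eI θ - w‖ ^ 2) / (2 * Real.pi)) • Q.eval (ψ (eI θ)) =
        ((2 * Real.pi : ℝ) : ℂ)⁻¹ *
          ((((1 - ‖w‖ ^ 2) / ‖eI θ - w‖ ^ 2 : ℝ) : ℂ) * Q.eval (ψ (eI θ))) := fun θ => by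
      rw [Complex.real_smul]; push_cast; ring
    simp only [e]
    rw [intervalIntegral.integral_const_mul, h, ofReal_mul, ofReal_ofNat, ← mul_assoc,
      inv_mul_cancel₀, one_mul]
    exact mul_ne_zero two_ne_zero (ofReal_ne_zero.2 Real.pi_ne_zero)

end DiscModel

noncomputable def kap (r : ℝ) (y : ℂ) : ℝ := Real.log (max (2 * r) ‖y‖) - Real.log (max r ‖y‖)

section kap
variable {r : ℝ}

theorem lm_cont (hr : 0 < r) : Continuous fun y : ℂ => Real.log (max r ‖y‖) :=
  (continuous_const.max continuous_norm).log fun y => (lt_max_of_lt_left hr).ne'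

theorem kap_cont (hr : 0 < r) : Continuous (kap r) := (lm_cont (by linarith)).sub (lm_cont hr)

theorem kap_nonneg (hr : 0 < r) (y : ℂ) : 0 ≤ kap r y := by
  unfold kap
  have := Real.log_le_log (lt_max_of_lt_left hr) (max_le_max_right ‖y‖ (show r ≤ 2 * r by linarith))
  linarith

theorem kap_le (hr : 0 < r) (y : ℂ) : kap r y ≤ Real.log 2 := by
  unfold kap
  have h1 : max (2 * r) ‖y‖ ≤ 2 * max r ‖y‖ :=
    max_le (by linarith [le_max_left r ‖y‖]) (by linarith [le_max_right r ‖y‖, norm_nonneg y])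
  have h2 := Real.log_le_log (lt_max_of_lt_left (by linarith)) h1
  rw [Real.log_mul (by norm_num) (lt_max_of_lt_left hr).ne'] at h2
  linarith

theorem kap_zero (hr : 0 < r) {y : ℂ} (hy : 2 * r ≤ ‖y‖) : kap r y = 0 := by
  unfold kap
  rw [max_eq_right hy, max_eq_right (by linarith), sub_self]

theorem kap_supp (hr : 0 < r) : HasCompactSupport (kap r) :=
  HasCompactSupport.intro (isCompact_closedBall 0 (2 * r)) fun y hy => kap_zero hr (by
    simp at hy; exact hy.le)

theorem kap_int (hr : 0 < r) : Integrable (kap r) :=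
  (kap_cont hr).integrable_of_hasCompactSupport (kap_supp hr)

theorem kap_pos (hr : 0 < r) : 0 < ∫ y, kap r y := by
  refine (kap_cont hr).integral_pos_of_hasCompactSupport_nonneg_nonzero (kap_supp hr)
    (kap_nonneg hr) (x := 0) ?_
  unfold kap
  rw [norm_zero, max_eq_left (by linarith), max_eq_left hr.le, Real.log_mul (by norm_num) hr.ne']
  have := Real.log_pos (show (1:ℝ) < 2 by norm_num)
  linarith

end kap

theorem lam_circ {R r : ℝ} {c z : ℂ} (hc : ‖c‖ < R) (hz : ‖z‖ < R) (hr : 0 < r) (hrR : r < R) :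
    ∫⁻ θ in Ioc 0 (2 * Real.pi), lam (3 * R) ‖z - (c + r * eI θ)‖ =
      ENNReal.ofReal (2 * Real.pi * (Real.log (3 * R) - Real.log (max r ‖z - c‖))) := by
  have hp := Real.two_pi_pos
  have e : ∀ θ : ℝ, circleMap c r θ = c + r * eI θ := fun θ => by simp [circleMap, eI]
  have hi : IntervalIntegrable (fun θ => Real.log ‖c + r * eI θ - z‖) volume 0 (2 * Real.pi) := by
    have := circleIntegrable_log_norm_sub_const (a := z) (c := c) r
    unfold CircleIntegrable at this
    simpa only [e] using this
  have hv := circleAverage_log_norm_sub_const_eq_log_radius_add_posLog (a := z) (c := c) hr.ne'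
  rw [Real.circleAverage_def] at hv
  simp only [e, smul_eq_mul] at hv
  have hv2 : Real.log r + (r⁻¹ * ‖c - z‖).posLog = Real.log (max r ‖z - c‖) := by
    rw [norm_sub_rev c z]
    rcases le_total r ‖z - c‖ with h | h
    · have h1 : 1 ≤ r⁻¹ * ‖z - c‖ := by rw [inv_mul_eq_div, le_div_iff₀ hr]; linarith
      rw [max_eq_right h, Real.posLog_eq_log (by rwa [abs_of_pos (by linarith)]),
        Real.log_mul (by positivity) (by linarith), Real.log_inv]; ring
    · have h1 : r⁻¹ * ‖z - c‖ ≤ 1 := by rw [inv_mul_eq_div, div_le_iff₀ hr]; linarith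
      rw [max_eq_left h, (Real.posLog_eq_zero_iff _).2
        (by rwa [abs_of_nonneg (by positivity)]), add_zero]
  rw [hv2] at hv
  have hv3 : ∫ θ in (0:ℝ)..(2 * Real.pi), Real.log ‖c + r * eI θ - z‖ =
      2 * Real.pi * Real.log (max r ‖z - c‖) := by
    rw [← hv]; field_simp
  have hnull : ∀ᵐ θ ∂(volume.restrict (Ioc 0 (2 * Real.pi))), c + r * eI θ ≠ z := by
    rw [← restrict_Ioo_eq_restrict_Ioc, ae_restrict_iff' measurableSet_Ioo]
    have hs : ({θ : ℝ | θ ∈ Ioo 0 (2 * Real.pi) ∧ c + r * eI θ = z} : Set ℝ).Subsingleton := by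
      rintro x ⟨hx, hx2⟩ y ⟨hy, hy2⟩
      have h1 : (r:ℂ) * eI x = r * eI y := add_left_cancel (hx2.trans hy2.symm)
      refine eI_inj 0 ⟨hx.1.le, by linarith [hx.2]⟩ ⟨hy.1.le, by linarith [hy.2]⟩
        (mul_left_cancel₀ (ofReal_ne_zero.2 hr.ne') h1)
    filter_upwards [hs.finite.countable.ae_notMem volume] with θ hθ h1 h2
    exact hθ ⟨h1, h2⟩
  have hI : IntervalIntegrable (fun θ => Real.log (3 * R) - Real.log ‖c + r * eI θ - z‖) volume 0
      (2 * Real.pi) := intervalIntegrable_const.sub hi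
  have hR : ∫ θ in (0:ℝ)..(2 * Real.pi), (Real.log (3 * R) - Real.log ‖c + r * eI θ - z‖) =
      2 * Real.pi * (Real.log (3 * R) - Real.log (max r ‖z - c‖)) := by
    rw [intervalIntegral.integral_sub intervalIntegrable_const hi, hv3]
    simp; ring
  rw [← hR, intervalIntegral.integral_of_le hp.le, ofReal_integral_eq_lintegral_ofReal
    ((intervalIntegrable_iff_integrableOn_Ioc_of_le hp.le).1 hI)]
  · refine lintegral_congr_ae ?_
    filter_upwards [hnull] with θ hθ
    rw [lam_pos _ (norm_pos_iff.2 (sub_ne_zero.2 hθ.symm)), norm_sub_rev]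
  · filter_upwards [hnull] with θ hθ
    have h1 : ‖c + r * eI θ - z‖ ≤ 3 * R := by
      have h2 := norm_sub_le (c + r * eI θ) z
      have h3 := norm_add_le c (r * eI θ)
      rw [norm_mul, eI_norm, Complex.norm_real, Real.norm_of_nonneg hr.le] at h3
      linarith
    have := Real.log_le_log (norm_pos_iff.2 (sub_ne_zero.2 hθ)) h1
    simpa using this

namespace RepM
variable {D : JordanDomain} {φ ψ : ℂ → ℂ} {a : ℂ} {ν ν₁ ν₂ : Measure ℂ}

theorem Ein (P : RepM D a ν) (H : DiscModel D φ ψ) (ha : a ∈ D.G) {R : ℝ} (hR0 : 0 < R)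
    (hR : ∀ z ∈ closure D.G, ‖z‖ < R) {c : ℂ} (hc : c ∈ D.G) :
    ∫⁻ z, lam (3 * R) ‖z - c‖ ∂ν = ∫⁻ t, lam (3 * R) ‖a - t‖ ∂(DiscModel.om ψ (φ c)) := by
  have := P.prob
  have hO := H.om_rep (H.mφ hc)
  rw [H.l c (subset_closure hc)] at hO
  have := hO.prob
  have hl := lam_cont (show (0:ℝ) < 3 * R by linarith)
  have h1 : ∫⁻ z, lam (3 * R) ‖z - c‖ ∂ν =
      ∫⁻ z, ∫⁻ t, lam (3 * R) ‖t - z‖ ∂(DiscModel.om ψ (φ c)) ∂ν := by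
    refine lintegral_congr_ae ?_
    filter_upwards [P.supp] with z hz
    rw [hO.Efr H hc hR hz, norm_sub_rev]
  rw [h1, lintegral_lintegral_swap]
  · refine lintegral_congr_ae ?_
    filter_upwards [hO.supp] with t ht
    have := P.Efr H ha hR ht
    simp_rw [norm_sub_rev t]
    exact this
  · exact (hl.comp (by fun_prop)).measurable.aemeasurable

theorem Eall (P₁ : RepM D a ν₁) (P₂ : RepM D a ν₂) (H : DiscModel D φ ψ) (ha : a ∈ D.G) {R : ℝ}
    (hR0 : 0 < R) (hR : ∀ z ∈ closure D.G, ‖z‖ < R) {c : ℂ} (hc : ‖c‖ < 2 * R) :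
    ∫⁻ z, lam (3 * R) ‖z - c‖ ∂ν₁ = ∫⁻ z, lam (3 * R) ‖z - c‖ ∂ν₂ := by
  by_cases h : c ∈ closure D.G
  · rw [closure_eq_union D] at h
    rcases h with h | h
    · rw [P₁.Ein H ha hR0 hR h, P₂.Ein H ha hR0 hR h]
    · rw [P₁.Efr H ha hR h, P₂.Efr H ha hR h]
  · rw [P₁.Eext H (subset_closure ha) hR h hc, P₂.Eext H (subset_closure ha) hR h hc]

theorem lm_int (P : RepM D a ν) {r : ℝ} (hr : 0 < r) (c : ℂ) :
    Integrable (fun z => Real.log (max r ‖z - c‖)) ν := by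
  have := P.prob
  have hc : Continuous fun z => Real.log (max r ‖z - c‖) :=
    (lm_cont hr).comp (continuous_id.sub continuous_const)
  obtain ⟨M, hM⟩ := (DiscModel.cptK D).exists_bound_of_continuousOn hc.continuousOn
  refine Integrable.of_bound hc.aestronglyMeasurable M ?_
  filter_upwards [P.suppK] with z hz using hM z hz

theorem circ_lm (P : RepM D a ν) {R : ℝ} (hR0 : 0 < R)
    (hR : ∀ z ∈ closure D.G, ‖z‖ < R) {c : ℂ} (hc : ‖c‖ < R) {r : ℝ} (hr : 0 < r) (hrR : r < R) :
    ∫⁻ θ in Ioc 0 (2 * Real.pi), ∫⁻ z, lam (3 * R) ‖z - (c + r * eI θ)‖ ∂ν =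
    ENNReal.ofReal (2 * Real.pi * (Real.log (3 * R) - ∫ z, Real.log (max r ‖z - c‖) ∂ν)) ∧
    0 ≤ 2 * Real.pi * (Real.log (3 * R) - ∫ z, Real.log (max r ‖z - c‖) ∂ν) := by
  have := P.prob
  have hp := Real.two_pi_pos
  have hl := lam_cont (show (0:ℝ) < 3 * R by linarith)
  have hi : Integrable (fun z => 2 * Real.pi * (Real.log (3 * R) - Real.log (max r ‖z - c‖))) ν :=
    ((integrable_const _).sub (P.lm_int hr c)).const_mul _
  have hn : ∀ᵐ z ∂ν, 0 ≤ 2 * Real.pi * (Real.log (3 * R) - Real.log (max r ‖z - c‖)) := by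
    filter_upwards [P.suppK] with z hz
    have h1 : max r ‖z - c‖ ≤ 3 * R := max_le (by linarith) (by
      linarith [norm_sub_le z c, hR z hz])
    have := Real.log_le_log (lt_max_of_lt_left hr) h1
    exact mul_nonneg hp.le (by linarith)
  have e : ∫ z, 2 * Real.pi * (Real.log (3 * R) - Real.log (max r ‖z - c‖)) ∂ν =
      2 * Real.pi * (Real.log (3 * R) - ∫ z, Real.log (max r ‖z - c‖) ∂ν) := by
    rw [integral_const_mul, integral_sub (integrable_const _) (P.lm_int hr c)]
    simp
  rw [← e]
  refine ⟨?_, integral_nonneg_of_ae hn⟩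
  rw [ofReal_integral_eq_lintegral_ofReal hi hn, lintegral_lintegral_swap]
  · refine lintegral_congr_ae ?_
    filter_upwards [P.suppK] with z hz
    exact lam_circ hc (hR z hz) hr hrR
  · refine (hl.comp ?_).measurable.aemeasurable
    have := eI_cont
    fun_prop

theorem lm_eq (P₁ : RepM D a ν₁) (P₂ : RepM D a ν₂) (H : DiscModel D φ ψ) (ha : a ∈ D.G)
    {r : ℝ} (hr : 0 < r) (c : ℂ) :
    ∫ z, Real.log (max r ‖z - c‖) ∂ν₁ = ∫ z, Real.log (max r ‖z - c‖) ∂ν₂ := by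
  obtain ⟨R0, h0, hR0⟩ := DiscModel.bddK D
  have hp := Real.two_pi_pos
  set R := R0 + ‖c‖ + r with hRd
  have hcn := norm_nonneg c
  have hR : ∀ z ∈ closure D.G, ‖z‖ < R := fun z hz => by linarith [hR0 z hz]
  have hRp : 0 < R := by linarith
  obtain ⟨e1, n1⟩ := P₁.circ_lm hRp hR (c := c) (by linarith) hr (by linarith)
  obtain ⟨e2, n2⟩ := P₂.circ_lm hRp hR (c := c) (by linarith) hr (by linarith)
  have e3 : ∀ θ : ℝ, ∫⁻ z, lam (3 * R) ‖z - (c + r * eI θ)‖ ∂ν₁ =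
      ∫⁻ z, lam (3 * R) ‖z - (c + r * eI θ)‖ ∂ν₂ := fun θ => P₁.Eall P₂ H ha hRp hR (by
    have h3 := norm_add_le c (r * eI θ)
    rw [norm_mul, eI_norm, Complex.norm_real, Real.norm_of_nonneg hr.le] at h3
    linarith)
  simp_rw [e3] at e1
  rw [e1, ENNReal.ofReal_eq_ofReal_iff n1 n2] at e2
  have := mul_left_cancel₀ hp.ne' e2
  linarith

theorem kap_eq (P₁ : RepM D a ν₁) (P₂ : RepM D a ν₂) (H : DiscModel D φ ψ) (ha : a ∈ D.G)
    {r : ℝ} (hr : 0 < r) (c : ℂ) :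
    ∫ z, kap r (z - c) ∂ν₁ = ∫ z, kap r (z - c) ∂ν₂ := by
  unfold kap
  have h2 : 0 < 2 * r := by linarith
  rw [integral_sub (P₁.lm_int h2 c) (P₁.lm_int hr c), integral_sub (P₂.lm_int h2 c) (P₂.lm_int hr c),
    P₁.lm_eq P₂ H ha h2, P₁.lm_eq P₂ H ha hr]

end RepM

theorem kap_conv {f : ℂ → ℝ} (hf : Continuous f) (hfc : HasCompactSupport f) {ε : ℝ} (hε : 0 < ε) :
    ∃ r > 0, ∀ z, |(∫ c, f c * kap r (z - c)) - f z * ∫ y, kap r y| ≤ ε * ∫ y, kap r y := by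
  obtain ⟨δ, hδ, hd⟩ := Metric.uniformContinuous_iff.1
    (hfc.uniformContinuous_of_continuous hf) ε hε
  have hr : 0 < δ / 2 := by linarith
  refine ⟨δ / 2, hr, fun z => ?_⟩
  have ek : ∫ c, kap (δ / 2) (z - c) = ∫ y, kap (δ / 2) y := integral_sub_left_eq_self _ _ z
  have ik : Integrable fun c => kap (δ / 2) (z - c) := (kap_int hr).comp_sub_left z
  have kc := kap_cont hr
  have i1 : Integrable fun c => f c * kap (δ / 2) (z - c) :=
    Continuous.integrable_of_hasCompactSupport (by fun_prop) hfc.mul_right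
  rw [← ek, ← integral_const_mul, ← integral_const_mul, ← integral_sub i1 (ik.const_mul _)]
  rw [← Real.norm_eq_abs]
  refine (norm_integral_le_of_norm_le (ik.const_mul ε) (Eventually.of_forall fun c => ?_))
  rw [← sub_mul, norm_mul, Real.norm_of_nonneg (kap_nonneg hr _)]
  rcases le_or_gt δ ‖z - c‖ with h | h
  · rw [kap_zero hr (by linarith)]; simp
  · refine mul_le_mul_of_nonneg_right ?_ (kap_nonneg hr _)
    rw [← dist_eq_norm]
    refine (hd ?_).le
    rwa [dist_comm, dist_eq_norm]

theorem kap_fub {f : ℂ → ℝ} (hf : Continuous f) (hfc : HasCompactSupport f) {r : ℝ} (hr : 0 < r)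
    (ν : Measure ℂ) [IsProbabilityMeasure ν] :
    Integrable (fun z => ∫ c, f c * kap r (z - c)) ν ∧
    ∫ z, (∫ c, f c * kap r (z - c)) ∂ν = ∫ c, f c * ∫ z, kap r (z - c) ∂ν := by
  have kc := kap_cont hr
  have hi : Integrable f := hf.integrable_of_hasCompactSupport hfc
  have h2 : Integrable (fun q : ℂ × ℂ => f q.2 * kap r (q.1 - q.2)) (ν.prod volume) := by
    refine (hi.comp_snd ν).mul_bdd (c := Real.log 2) ?_ (Eventually.of_forall fun q => ?_)
    · exact Continuous.aestronglyMeasurable (by fun_prop)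
    · rw [Real.norm_of_nonneg (kap_nonneg hr _)]; exact kap_le hr _
  refine ⟨h2.integral_prod_left, ?_⟩
  rw [integral_integral_swap (f := fun z c => f c * kap r (z - c)) h2]
  simp_rw [integral_const_mul]

theorem RepM.unique {D : JordanDomain} {φ ψ : ℂ → ℂ} {a : ℂ} {ν₁ ν₂ : Measure ℂ}
    (P₁ : RepM D a ν₁) (P₂ : RepM D a ν₂) (H : DiscModel D φ ψ) (ha : a ∈ D.G) : ν₁ = ν₂ := by
  have := P₁.prob
  have := P₂.prob
  refine Measure.ext_of_integral_eq_on_compactlySupported fun f => ?_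
  have hf : Continuous f := f.continuous
  have hfc : HasCompactSupport f := f.hasCompactSupport
  obtain ⟨B, hB⟩ := hfc.exists_bound_of_continuous hf
  have key : ∀ ε > 0, |∫ z, f z ∂ν₁ - ∫ z, f z ∂ν₂| ≤ 2 * ε := fun ε hε => by
    obtain ⟨r, hr, hr2⟩ := kap_conv hf hfc hε
    set M := ∫ y, kap r y with hM
    have hMp : 0 < M := kap_pos hr
    have one : ∀ ν : Measure ℂ, IsProbabilityMeasure ν →
        |∫ z, (∫ c, f c * kap r (z - c)) ∂ν - (∫ z, f z ∂ν) * M| ≤ ε * M := fun ν _ => by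
      have hi : Integrable f ν := Integrable.of_bound hf.aestronglyMeasurable B
        (Eventually.of_forall hB)
      rw [← integral_mul_const, ← integral_sub (kap_fub hf hfc hr ν).1 (hi.mul_const M)]
      have := norm_integral_le_of_norm_le_const (μ := ν)
        (f := fun z => (∫ c, f c * kap r (z - c)) - f z * M) (Eventually.of_forall hr2)
      simpa using this
    have h1 := one ν₁ ‹_›
    have h2 := one ν₂ ‹_›
    rw [(kap_fub hf hfc hr _).2] at h1 h2
    simp_rw [P₁.kap_eq P₂ H ha hr] at h1
    rw [abs_le] at h1 h2 ⊢
    constructor <;> nlinarith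
  have h0 : |∫ z, f z ∂ν₁ - ∫ z, f z ∂ν₂| ≤ 0 := le_of_forall_pos_le_add fun ε hε => by
    have := key (ε / 2) (by linarith)
    linarith
  exact sub_eq_zero.1 (abs_nonpos_iff.1 h0)

theorem hb_sub {E : Type*} [AddCommGroup E] [Module ℝ E] (N : E → ℝ)
    (h1 : ∀ c : ℝ, 0 < c → ∀ x, N (c • x) = c * N x) (h2 : ∀ x y, N (x + y) ≤ N x + N y)
    (h0 : N 0 = 0) (u : E) : ∃ g : E →ₗ[ℝ] ℝ, g u = N u ∧ ∀ v, g v ≤ N v := by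
  by_cases hu : u = 0
  · obtain ⟨g, -, hg⟩ := exists_extension_of_le_sublinear (⟨⊥, 0⟩ : E →ₗ.[ℝ] ℝ) N h1 h2
      (fun ⟨x, hx⟩ => by
        have : x = 0 := by simpa using hx
        subst this
        exact h0.ge)
    exact ⟨g, by rw [hu, map_zero, h0], hg⟩
  · obtain ⟨g, hg0, hg⟩ := exists_extension_of_le_sublinear
      (LinearPMap.mkSpanSingleton (σ := RingHom.id ℝ) u (N u) hu) N h1 h2 (fun ⟨x, hx⟩ => by
        obtain ⟨c, rfl⟩ := Submodule.mem_span_singleton.1 hx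
        rw [LinearPMap.mkSpanSingleton'_apply]
        simp only [RingHom.id_apply, smul_eq_mul]
        rcases lt_trichotomy c 0 with hc | hc | hc
        · have h3 := h2 (c • u) ((-c) • u)
          rw [h1 (-c) (by linarith), ← add_smul, add_neg_cancel, zero_smul, h0] at h3
          linarith
        · simp [hc, h0]
        · rw [h1 c hc])
    refine ⟨g, ?_, hg⟩
    have := hg0 ⟨u, Submodule.mem_span_singleton_self u⟩
    rw [this]
    exact LinearPMap.mkSpanSingleton_apply ℝ ℝ hu (N u)

namespace DiscModel
variable {D : JordanDomain} {φ ψ : ℂ → ℂ}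

theorem om0_int (H : DiscModel D φ ψ) {f : ℂ → ℝ} (hf : Continuous f) :
    ∫ z, f z ∂(om ψ 0) = (2 * Real.pi)⁻¹ * ∫ θ in (0:ℝ)..(2 * Real.pi), f (ψ (eI θ)) := by
  rw [H.om_int (by simp) hf, ← intervalIntegral.integral_const_mul]
  simp [eI_norm]

theorem om0_re (H : DiscModel D φ ψ) (Q : Polynomial ℂ) :
    (Q.eval (ψ 0)).re = (2 * Real.pi)⁻¹ *
      ∫ θ in (0:ℝ)..(2 * Real.pi), (Q.eval (ψ (eI θ))).re := by
  have P := H.om_rep (w := 0) (by simp)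
  have := P.prob
  have hi : Integrable (fun z => Q.eval z) (om ψ 0) := by
    obtain ⟨M, hM⟩ := (DiscModel.cptK D).exists_bound_of_continuousOn Q.continuous.continuousOn
    exact P.int_of_bdd Q.continuous.aestronglyMeasurable hM
  rw [← P.rep Q, ← H.om0_int (f := fun z => (Q.eval z).re)
    (Complex.continuous_re.comp Q.continuous)]
  exact (integral_re hi).symm

/-- the upper envelope -/
noncomputable def NN (D : JordanDomain) (a : ℂ) (u : CompactlySupportedContinuousMap (frontier D.G) ℝ) : ℝ :=
  sInf {x | ∃ Q : Polynomial ℂ, (∀ z : frontier D.G, u z ≤ (Q.eval (z:ℂ)).re) ∧ x = (Q.eval a).re}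

instance cptL (D : JordanDomain) : CompactSpace (frontier D.G) :=
  isCompact_iff_compactSpace.1 ((cptK D).of_isClosed_subset isClosed_frontier
    frontier_subset_closure)

/-- restriction to the boundary -/
noncomputable def rsL (D : JordanDomain) (u : ℂ → ℝ) (hu : Continuous u) :
    CompactlySupportedContinuousMap (frontier D.G) ℝ where
  toFun := fun z => u z
  continuous_toFun := hu.comp continuous_subtype_val
  hasCompactSupport' := HasCompactSupport.of_compactSpace _

theorem NN_lb (H : DiscModel D φ ψ) (u : CompactlySupportedContinuousMap (frontier D.G) ℝ)
    (Q : Polynomial ℂ) (hQ : ∀ z : frontier D.G, u z ≤ (Q.eval (z:ℂ)).re) :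
    (2 * Real.pi)⁻¹ * (∫ θ in (0:ℝ)..(2 * Real.pi), u ⟨ψ (eI θ), H.sψ (eI_sphere θ)⟩) ≤
      (Q.eval (ψ 0)).re := by
  have hp := Real.two_pi_pos
  rw [H.om0_re]
  refine mul_le_mul_of_nonneg_left ?_ (by positivity)
  refine intervalIntegral.integral_mono_on hp.le ?_ ?_ fun θ _ => hQ _
  · exact (u.continuous.comp (H.E_cont.subtype_mk _)).intervalIntegrable _ _
  · exact (Complex.continuous_re.comp (Q.continuous.comp H.E_cont)).intervalIntegrable _ _

theorem NN_bdd (H : DiscModel D φ ψ) (u : CompactlySupportedContinuousMap (frontier D.G) ℝ) :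
    BddBelow {x | ∃ Q : Polynomial ℂ, (∀ z : frontier D.G, u z ≤ (Q.eval (z:ℂ)).re) ∧
      x = (Q.eval (ψ 0)).re} := by
  refine ⟨(2 * Real.pi)⁻¹ * (∫ θ in (0:ℝ)..(2 * Real.pi), u ⟨ψ (eI θ), H.sψ (eI_sphere θ)⟩), ?_⟩
  rintro x ⟨Q, hQ, rfl⟩
  exact H.NN_lb u Q hQ

theorem NN_ne (u : CompactlySupportedContinuousMap (frontier D.G) ℝ) (a : ℂ) :
    {x | ∃ Q : Polynomial ℂ, (∀ z : frontier D.G, u z ≤ (Q.eval (z:ℂ)).re) ∧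
      x = (Q.eval a).re}.Nonempty := by
  obtain ⟨M, hM⟩ := isCompact_univ.exists_bound_of_continuousOn u.continuous.continuousOn
  refine ⟨_, Polynomial.C (M:ℂ), fun z => ?_, rfl⟩
  simpa using (le_abs_self _).trans (hM z (mem_univ z))

theorem NN_le (H : DiscModel D φ ψ) {u : CompactlySupportedContinuousMap (frontier D.G) ℝ}
    {Q : Polynomial ℂ} (hQ : ∀ z : frontier D.G, u z ≤ (Q.eval (z:ℂ)).re) :
    NN D (ψ 0) u ≤ (Q.eval (ψ 0)).re := csInf_le (H.NN_bdd u) ⟨Q, hQ, rfl⟩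

theorem NN_ex (H : DiscModel D φ ψ) (u : CompactlySupportedContinuousMap (frontier D.G) ℝ)
    {x : ℝ} (hx : NN D (ψ 0) u < x) : ∃ Q : Polynomial ℂ,
      (∀ z : frontier D.G, u z ≤ (Q.eval (z:ℂ)).re) ∧ (Q.eval (ψ 0)).re < x := by
  obtain ⟨y, ⟨Q, hQ, rfl⟩, hy⟩ := exists_lt_of_csInf_lt (NN_ne u (ψ 0)) hx
  exact ⟨Q, hQ, hy⟩

theorem NN_add (H : DiscModel D φ ψ) (u v : CompactlySupportedContinuousMap (frontier D.G) ℝ) :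
    NN D (ψ 0) (u + v) ≤ NN D (ψ 0) u + NN D (ψ 0) v := by
  refine le_of_forall_pos_le_add fun ε hε => ?_
  obtain ⟨Q, hQ, h1⟩ := H.NN_ex u (show NN D (ψ 0) u < NN D (ψ 0) u + ε / 2 by linarith)
  obtain ⟨S, hS, h2⟩ := H.NN_ex v (show NN D (ψ 0) v < NN D (ψ 0) v + ε / 2 by linarith)
  have := H.NN_le (u := u + v) (Q := Q + S) fun z => by
    simpa using add_le_add (hQ z) (hS z)
  simp at this
  linarith

theorem NN_smul_le (H : DiscModel D φ ψ) (u : CompactlySupportedContinuousMap (frontier D.G) ℝ)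
    {c : ℝ} (hc : 0 < c) : NN D (ψ 0) (c • u) ≤ c * NN D (ψ 0) u := by
  refine le_of_forall_pos_le_add fun ε hε => ?_
  obtain ⟨Q, hQ, h1⟩ := H.NN_ex u (show NN D (ψ 0) u < NN D (ψ 0) u + ε / c by
    have := div_pos hε hc; linarith)
  have := H.NN_le (u := c • u) (Q := Polynomial.C (c:ℂ) * Q) fun z => by
    simpa using mul_le_mul_of_nonneg_left (hQ z) hc.le
  simp at this
  have h3 := mul_lt_mul_of_pos_left h1 hc
  rw [mul_add, mul_div_cancel₀ _ hc.ne'] at h3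
  linarith

theorem NN_smul (H : DiscModel D φ ψ) (u : CompactlySupportedContinuousMap (frontier D.G) ℝ)
    {c : ℝ} (hc : 0 < c) : NN D (ψ 0) (c • u) = c * NN D (ψ 0) u := by
  refine le_antisymm (H.NN_smul_le u hc) ?_
  have := H.NN_smul_le (c • u) (inv_pos.2 hc)
  rw [smul_smul, inv_mul_cancel₀ hc.ne', one_smul, inv_mul_eq_div, le_div_iff₀ hc] at this
  linarith

theorem NN_zero (H : DiscModel D φ ψ) : NN D (ψ 0) 0 = 0 := by
  have h1 := H.NN_add 0 0
  rw [add_zero] at h1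
  have h2 := H.NN_le (u := 0) (Q := 0) (fun z => by simp)
  simp at h2
  linarith

theorem NN_fun (H : DiscModel D φ ψ) (u : CompactlySupportedContinuousMap (frontier D.G) ℝ) :
    ∃ g : CompactlySupportedContinuousMap (frontier D.G) ℝ →ₗ[ℝ] ℝ,
      g u = NN D (ψ 0) u ∧ ∀ v, g v ≤ NN D (ψ 0) v := by
  have h1 : ∀ c : ℝ, 0 < c → ∀ x : CompactlySupportedContinuousMap (frontier D.G) ℝ,
      NN D (ψ 0) (c • x) = c * NN D (ψ 0) x := fun c hc x => H.NN_smul x hc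
  refine hb_sub (E := CompactlySupportedContinuousMap (frontier D.G) ℝ) (NN D (ψ 0)) ?_ ?_ ?_ u
  · exact h1
  · exact H.NN_add
  · exact H.NN_zero

theorem walsh (H : DiscModel D φ ψ) {u : ℂ → ℝ} (hu : Continuous u) {ε : ℝ} (hε : 0 < ε) :
    ∃ Q : Polynomial ℂ, (∀ z ∈ frontier D.G, u z ≤ (Q.eval z).re) ∧
      (Q.eval (ψ 0)).re ≤ (2 * Real.pi)⁻¹ * (∫ θ in (0:ℝ)..(2 * Real.pi), u (ψ (eI θ))) + ε := by
  obtain ⟨g, hg0, hg⟩ := H.NN_fun (rsL D u hu)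
  have hpos : ∀ x, 0 ≤ x → 0 ≤ g x := fun x hx => by
    have := hg (-x)
    have h2 := H.NN_le (u := -x) (Q := 0) (fun z => by simpa using hx z)
    simp at h2 this
    linarith
  have hre : ∀ Q : Polynomial ℂ, g (rsL D (fun z => (Q.eval z).re)
      (Complex.continuous_re.comp Q.continuous)) = (Q.eval (ψ 0)).re := fun Q => by
    have h1 := (hg (rsL D (fun z => (Q.eval z).re)
      (Complex.continuous_re.comp Q.continuous))).trans (H.NN_le (Q := Q) fun z => le_rfl)
    have h2 := (hg (-rsL D (fun z => (Q.eval z).re)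
      (Complex.continuous_re.comp Q.continuous))).trans (H.NN_le (Q := -Q) fun z => by simp [rsL])
    simp at h2
    linarith
  set Λ := PositiveLinearMap.mk₀ g hpos
  set μ := RealRMK.rieszMeasure Λ with hμ
  have hint : ∀ (f : ℂ → ℝ) (hf : Continuous f), ∫ z : frontier D.G, f z ∂μ = g (rsL D f hf) :=
    fun f hf => RealRMK.integral_rieszMeasure Λ (rsL D f hf)
  have hprob : IsProbabilityMeasure μ := by
    have h1 := hint (fun z => ((1 : Polynomial ℂ).eval z).re)
      (Complex.continuous_re.comp (1 : Polynomial ℂ).continuous)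
    rw [hre] at h1
    simp [Measure.real] at h1
    constructor
    rwa [ENNReal.toReal_eq_one_iff] at h1
  have hm : ∀ {E : Type} [NormedAddCommGroup E] [NormedSpace ℝ E] [SecondCountableTopology E]
      {f : ℂ → E}, Continuous f → ∫ z, f z ∂(μ.map Subtype.val) = ∫ z : frontier D.G, f z ∂μ :=
    fun hf => integral_map measurable_subtype_coe.aemeasurable hf.aestronglyMeasurable
  have P : RepM D (ψ 0) (μ.map Subtype.val) := by
    refine ⟨Measure.isProbabilityMeasure_map measurable_subtype_coe.aemeasurable, ?_, fun Q => ?_⟩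
    · exact (ae_map_iff (p := fun z => z ∈ frontier D.G) measurable_subtype_coe.aemeasurable
        isClosed_frontier.measurableSet).2 (Eventually.of_forall fun z => z.2)
    · rw [hm Q.continuous]
      have hi : ∀ Q : Polynomial ℂ, (∫ z : frontier D.G, Q.eval (z:ℂ) ∂μ).re = (Q.eval (ψ 0)).re :=
        fun Q => by
        have hc : Continuous fun z : frontier D.G => Q.eval (z:ℂ) :=
          Q.continuous.comp continuous_subtype_val
        have hI : Integrable (fun z : frontier D.G => Q.eval (z:ℂ)) μ := by
          obtain ⟨M, hM⟩ := isCompact_univ.exists_bound_of_continuousOn hc.continuousOn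
          exact Integrable.of_bound hc.aestronglyMeasurable M
            (Eventually.of_forall fun z => hM z (mem_univ z))
        rw [← hre Q, ← hint]
        exact (integral_re hI).symm
      apply Complex.ext (hi Q)
      have := hi (Polynomial.C (-I) * Q)
      simp only [Polynomial.eval_mul, Polynomial.eval_C, integral_const_mul] at this
      simpa using this
  have hU := P.unique (H.om_rep (w := 0) (by simp)) H (H.mψ (by simp))
  have hN : NN D (ψ 0) (rsL D u hu) =
      (2 * Real.pi)⁻¹ * (∫ θ in (0:ℝ)..(2 * Real.pi), u (ψ (eI θ))) := by
    rw [← hg0, ← hint, ← hm hu, hU, H.om0_int hu]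
  obtain ⟨Q, hQ, h⟩ := H.NN_ex (rsL D u hu) (lt_add_of_pos_right _ hε)
  exact ⟨Q, fun z hz => hQ ⟨z, hz⟩, by rw [← hN]; exact h.le⟩

end DiscModel

namespace JordanDomain.IsONPolys
variable {D : JordanDomain} {p : ℕ → Polynomial ℂ}

theorem inner (hp : D.IsONPolys p) (j k : ℕ) : ∫ s in (0:ℝ)..D.l,
    (p j).eval (D.γ s) * (starRingEnd ℂ) ((p k).eval (D.γ s)) = if j = k then (D.l : ℂ) else 0 := by
  have h := hp.2.2 j k
  have hl : (D.l : ℂ) ≠ 0 := ofReal_ne_zero.2 D.l_pos.ne'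
  rw [one_div, inv_mul_eq_iff_eq_mul₀ hl] at h
  rw [h]; split_ifs <;> simp

theorem pc (q : Polynomial ℂ) : Continuous fun s => q.eval (D.γ s) := q.continuous.comp D.γ_cont

theorem norm_sum (hp : D.IsONPolys p) (n : ℕ) (c : ℕ → ℂ) :
    ∫ s in (0:ℝ)..D.l, ‖∑ k ∈ Finset.range n, c k * (p k).eval (D.γ s)‖ ^ 2 =
      D.l * ∑ k ∈ Finset.range n, ‖c k‖ ^ 2 := by
  rw [← Complex.ofReal_inj, ← intervalIntegral.integral_ofReal]
  have e : ∀ s : ℝ, ((‖∑ k ∈ Finset.range n, c k * (p k).eval (D.γ s)‖ ^ 2 : ℝ) : ℂ) =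
      ∑ j ∈ Finset.range n, ∑ k ∈ Finset.range n, (c j * (starRingEnd ℂ) (c k)) *
        ((p j).eval (D.γ s) * (starRingEnd ℂ) ((p k).eval (D.γ s))) := fun s => by
    rw [ofReal_pow, ← Complex.mul_conj', map_sum, Finset.sum_mul_sum]
    refine Finset.sum_congr rfl fun j _ => Finset.sum_congr rfl fun k _ => ?_
    rw [map_mul]; ring
  simp_rw [e]
  have ic : ∀ j k : ℕ, IntervalIntegrable (fun s => (c j * (starRingEnd ℂ) (c k)) *
        ((p j).eval (D.γ s) * (starRingEnd ℂ) ((p k).eval (D.γ s)))) volume 0 D.l := fun j k => by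
    have h1 := pc (D := D) (p j)
    have h2 := pc (D := D) (p k)
    exact Continuous.intervalIntegrable (by fun_prop) _ _
  rw [intervalIntegral.integral_finsetSum fun j _ =>
    (Continuous.intervalIntegrable (by
      have h1 := fun j => pc (D := D) (p j)
      exact continuous_finsetSum _ fun k _ => continuous_const.mul
        ((h1 j).mul (Complex.continuous_conj.comp (h1 k)))) _ _)]
  simp_rw [intervalIntegral.integral_finsetSum fun k _ => ic _ k,
    intervalIntegral.integral_const_mul, hp.inner]
  push_cast
  rw [Finset.mul_sum]
  refine Finset.sum_congr rfl fun j hj => ?_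
  rw [Finset.sum_eq_single_of_mem j hj (fun k _ hk => by simp [hk.symm])]
  rw [if_pos rfl, Complex.mul_conj']; ring

theorem span (hp : D.IsONPolys p) (n : ℕ) : ∀ q : Polynomial ℂ, q.degree < n →
    ∃ c : ℕ → ℂ, ∀ z, q.eval z = ∑ k ∈ Finset.range n, c k * (p k).eval z := by
  induction n with
  | zero =>
    intro q hq
    have : q = 0 := by simpa using hq
    exact ⟨0, by simp [this]⟩
  | succ n ih =>
    intro q hq
    obtain ⟨b, hb, hb2⟩ := hp.2.1 n
    have hb3 : (p n).coeff n = b := by rw [← hb2, Polynomial.leadingCoeff, hp.1 n]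
    have hb0 : (b:ℂ) ≠ 0 := ofReal_ne_zero.2 hb.ne'
    set a := q.coeff n / b with ha
    have h2 : (q - Polynomial.C a * p n).degree < n := by
      rw [Polynomial.degree_lt_iff_coeff_zero]
      intro m hm
      rcases hm.eq_or_lt with rfl | hm
      · simp [hb3, ha, hb0]
      · have h3 : q.coeff m = 0 := (Polynomial.degree_lt_iff_coeff_zero q (n+1)).1
          (by exact_mod_cast hq) m hm
        have h4 : (p n).coeff m = 0 := Polynomial.coeff_eq_zero_of_natDegree_lt (by rwa [hp.1 n])
        simp [h3, h4]
    obtain ⟨c, hc⟩ := ih _ h2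
    refine ⟨fun k => if k = n then a else c k, fun z => ?_⟩
    beta_reduce
    rw [Finset.sum_range_succ, if_pos rfl, Finset.sum_congr rfl
      (g := fun k => c k * (p k).eval z) (fun k hk => by rw [if_neg (Finset.mem_range.1 hk).ne]),
      ← hc z]
    simp

theorem eval_le (hp : D.IsONPolys p) (ζ : ℂ) (q : Polynomial ℂ) : ∃ n : ℕ,
    D.l * ‖q.eval ζ‖ ^ 2 ≤ (∑ k ∈ Finset.range n, ‖(p k).eval ζ‖ ^ 2) *
      ∫ s in (0:ℝ)..D.l, ‖q.eval (D.γ s)‖ ^ 2 := by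
  obtain ⟨c, hc⟩ := hp.span (q.natDegree + 1) q
    (Polynomial.degree_le_natDegree.trans_lt (by exact_mod_cast Nat.lt_succ_self _))
  refine ⟨q.natDegree + 1, ?_⟩
  simp_rw [hc]
  rw [hp.norm_sum]
  have h1 : ‖∑ k ∈ Finset.range (q.natDegree + 1), c k * (p k).eval ζ‖ ≤
      ∑ k ∈ Finset.range (q.natDegree + 1), ‖c k‖ * ‖(p k).eval ζ‖ :=
    (norm_sum_le _ _).trans (by simp)
  have h2 := Finset.sum_mul_sq_le_sq_mul_sq (Finset.range (q.natDegree + 1)) (fun k => ‖c k‖)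
    (fun k => ‖(p k).eval ζ‖)
  have h3 := pow_le_pow_left₀ (norm_nonneg _) h1 2
  have := mul_le_mul_of_nonneg_left (h3.trans h2) D.l_pos.le
  linarith

/-- the partial sum as polynomial -/
noncomputable def Kp (p : ℕ → Polynomial ℂ) (ζ : ℂ) (n : ℕ) : Polynomial ℂ :=
  ∑ k ∈ Finset.range n, Polynomial.C ((starRingEnd ℂ) ((p k).eval ζ)) * p k

theorem Kp_eval (ζ : ℂ) (n : ℕ) (z : ℂ) : (Kp p ζ n).eval z =
    ∑ k ∈ Finset.range n, (starRingEnd ℂ) ((p k).eval ζ) * (p k).eval z := by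
  simp [Kp, Polynomial.eval_finsetSum]

theorem Kp_norm (hp : D.IsONPolys p) (ζ : ℂ) (n : ℕ) :
    ∫ s in (0:ℝ)..D.l, ‖(Kp p ζ n).eval (D.γ s)‖ ^ 2 =
      D.l * ∑ k ∈ Finset.range n, ‖(p k).eval ζ‖ ^ 2 := by
  simp_rw [Kp_eval]
  rw [hp.norm_sum]
  simp

theorem Kp_self (ζ : ℂ) (n : ℕ) : (Kp p ζ n).eval ζ =
    ((∑ k ∈ Finset.range n, ‖(p k).eval ζ‖ ^ 2 : ℝ) : ℂ) := by
  rw [Kp_eval]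
  push_cast
  exact Finset.sum_congr rfl fun k _ => Complex.conj_mul' _

theorem p0 (hp : D.IsONPolys p) (ζ : ℂ) : ‖(p 0).eval ζ‖ ^ 2 = 1 := by
  have h := hp.norm_sum 1 1
  have h0 := Polynomial.eq_C_of_natDegree_eq_zero (hp.1 0)
  have h1 : ∀ z, (p 0).eval z = (p 0).coeff 0 := fun z => by rw [h0]; simp
  simp [h1] at h
  rw [h1]
  exact mul_left_cancel₀ D.l_pos.ne' (by linarith)

end JordanDomain.IsONPolys

theorem mean_r {f : ℂ → ℂ} (hf : DifferentiableOn ℂ f (ball 0 1)) {r : ℝ} (h0 : 0 ≤ r) (h1 : r < 1) :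
    ∫ θ in (0:ℝ)..(2 * Real.pi), f (r * eI θ) = (2 * Real.pi : ℝ) * f 0 := by
  have hm : ∀ w ∈ closedBall (0:ℂ) 1, (r:ℂ) * w ∈ ball (0:ℂ) 1 := fun w hw => by
    rw [mem_closedBall_zero_iff] at hw
    rw [mem_ball_zero_iff, norm_mul, Complex.norm_real, Real.norm_of_nonneg h0]
    nlinarith [norm_nonneg w]
  have hd : DifferentiableOn ℂ (fun w => f (r * w)) (ball 0 1) :=
    hf.comp (differentiableOn_id.const_mul _) fun w hw => hm w (ball_subset_closedBall hw)
  have hc : ContinuousOn (fun w => f (r * w)) (closure (ball 0 1)) := by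
    rw [closure_ball _ one_ne_zero]
    exact hf.continuousOn.comp (continuous_const.mul continuous_id).continuousOn hm
  have := poi_avg (w := 0) (by simp) (f := fun w => f (r * w)) ⟨hd, hc⟩
  simpa [eI_norm] using this

theorem r_cont {f : ℂ → ℂ} (hf : DifferentiableOn ℂ f (ball 0 1)) {r : ℝ} (h0 : 0 ≤ r) (h1 : r < 1) :
    Continuous fun θ : ℝ => f (r * eI θ) :=
  hf.continuousOn.comp_continuous (continuous_const.mul eI_cont) fun θ => r_eI_mem h0 h1 θ

theorem le_of_r {a b : ℝ} (h : ∀ r : ℝ, 0 < r → r < 1 → r * a ≤ b) : a ≤ b := by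
  have h1 : Tendsto (fun r : ℝ => r * a) (nhdsWithin 1 (Iio 1)) (nhds (1 * a)) :=
    (tendsto_id.mono_left nhdsWithin_le_nhds).mul_const a
  rw [one_mul] at h1
  refine le_of_tendsto h1 ?_
  filter_upwards [Ioo_mem_nhdsLT (show (0:ℝ) < 1 by norm_num)] with r hr using h r hr.1 hr.2

namespace DiscModel
variable {D : JordanDomain} {φ ψ : ℂ → ℂ} {p : ℕ → Polynomial ℂ}

theorem eval_up (H : DiscModel D φ ψ) (q : Polynomial ℂ) :
    2 * Real.pi * (‖q.eval (ψ 0)‖ ^ 2 * ‖deriv ψ 0‖) ≤ ∫ s in (0:ℝ)..D.l, ‖q.eval (D.γ s)‖ ^ 2 := by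
  have hp := Real.two_pi_pos
  refine le_of_r fun r h0 h1 => ?_
  refine le_trans ?_ (H.hardy (q := fun z => q.eval z) q.differentiable h0.le h1)
  have hd : DifferentiableOn ℂ (fun w => q.eval (ψ w) ^ 2 * deriv ψ w) (ball 0 1) :=
    ((q.differentiable.comp_differentiableOn H.dψ).pow 2).mul (H.dψ.deriv isOpen_ball)
  have e := mean_r hd h0.le h1
  have hn : 2 * Real.pi * (‖q.eval (ψ 0)‖ ^ 2 * ‖deriv ψ 0‖) ≤
      ∫ θ in (0:ℝ)..(2 * Real.pi), ‖q.eval (ψ (r * eI θ)) ^ 2 * deriv ψ (r * eI θ)‖ := by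
    have h2 := intervalIntegral.norm_integral_le_integral_norm (μ := volume)
      (f := fun θ : ℝ => q.eval (ψ (r * eI θ)) ^ 2 * deriv ψ (r * eI θ)) hp.le
    rw [e, norm_mul, Complex.norm_real, Real.norm_of_nonneg hp.le, norm_mul, norm_pow] at h2
    exact h2
  have e2 : ∫ t in (0:ℝ)..(2 * Real.pi), ‖q.eval (ψ (r * eI t))‖ ^ 2 * (r * ‖deriv ψ (r * eI t)‖) =
      r * ∫ θ in (0:ℝ)..(2 * Real.pi), ‖q.eval (ψ (r * eI θ)) ^ 2 * deriv ψ (r * eI θ)‖ := by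
    rw [← intervalIntegral.integral_const_mul]
    congr 1; ext t
    rw [norm_mul, norm_pow]; ring
  rw [e2]
  exact mul_le_mul_of_nonneg_left hn h0.le

theorem k_up (H : DiscModel D φ ψ) (hp : D.IsONPolys p) (n : ℕ) :
    2 * Real.pi * ‖deriv ψ 0‖ * (∑ k ∈ Finset.range n, ‖(p k).eval (ψ 0)‖ ^ 2) ≤ D.l := by
  have h := H.eval_up (JordanDomain.IsONPolys.Kp p (ψ 0) n)
  rw [hp.Kp_norm, JordanDomain.IsONPolys.Kp_self, Complex.norm_real] at h
  set K := ∑ k ∈ Finset.range n, ‖(p k).eval (ψ 0)‖ ^ 2 with hK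
  have hK0 : 0 ≤ K := Finset.sum_nonneg fun k _ => by positivity
  rw [Real.norm_of_nonneg hK0] at h
  rcases hK0.eq_or_lt with h0 | h0
  · rw [← h0, mul_zero]; exact D.l_pos.le
  · refine le_of_mul_le_mul_right ?_ h0
    nlinarith

theorem k_sum (H : DiscModel D φ ψ) (hp : D.IsONPolys p) (hd : deriv ψ 0 ≠ 0) :
    Summable fun k => ‖(p k).eval (ψ 0)‖ ^ 2 := by
  have h1 : 0 < 2 * Real.pi * ‖deriv ψ 0‖ := mul_pos Real.two_pi_pos (norm_pos_iff.2 hd)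
  refine summable_of_sum_range_le (c := D.l / (2 * Real.pi * ‖deriv ψ 0‖)) (fun k => by positivity)
    fun n => ?_
  rw [le_div_iff₀ h1]
  have := H.k_up hp n
  linarith

theorem γ_cl (D : JordanDomain) (s : ℝ) (h : s ∈ Icc 0 D.l) : D.γ s ∈ frontier D.G := by
  rcases h.2.eq_or_lt with h2 | h2
  · have := D.γ_periodic 0
    rw [zero_add] at this
    rw [h2, this, ← D.γ_boundary]
    exact ⟨0, ⟨le_rfl, D.l_pos⟩, rfl⟩
  · rw [← D.γ_boundary]; exact ⟨s, ⟨h.1, h2⟩, rfl⟩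

theorem eval_pa (hp : D.IsONPolys p) {a : ℂ} (ha : a ∈ D.G)
    (hs : Summable fun k => ‖(p k).eval a‖ ^ 2) {f : ℂ → ℂ} (hf : PA (closure D.G) f)
     :
    D.l * ‖f a‖ ^ 2 ≤ (∑' k, ‖(p k).eval a‖ ^ 2) * ∫ s in (0:ℝ)..D.l, ‖f (D.γ s)‖ ^ 2 := by
  obtain ⟨M, hM, hfM⟩ := hf.bdd (cptK D)
  choose q hq using fun n : ℕ => hf (1 / (n + 1)) Nat.one_div_pos_of_nat
  have hl : ∀ z ∈ closure D.G, Tendsto (fun n => ‖(q n).eval z‖ ^ 2) atTop (nhds (‖f z‖ ^ 2)) :=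
    fun z hz => by
    refine ((tendsto_iff_norm_sub_tendsto_zero.2 ?_).norm).pow 2
    refine squeeze_zero (fun _ => norm_nonneg _) (fun n => ?_) tendsto_one_div_add_atTop_nhds_zero_nat
    rw [norm_sub_rev]
    exact hq n z hz
  have h1 := (hl a (subset_closure ha)).const_mul D.l
  have hγ : ∀ s ∈ uIoc 0 D.l, D.γ s ∈ closure D.G := fun s hs => by
    rw [uIoc_of_le D.l_pos.le] at hs
    exact frontier_subset_closure (γ_cl D s ⟨hs.1.le, hs.2⟩)
  have h2 : Tendsto (fun n => ∫ s in (0:ℝ)..D.l, ‖(q n).eval (D.γ s)‖ ^ 2) atTop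
      (nhds (∫ s in (0:ℝ)..D.l, ‖f (D.γ s)‖ ^ 2)) := by
    refine intervalIntegral.tendsto_integral_filter_of_dominated_convergence (l := atTop)
      (fun _ => (M + 1) ^ 2) ?_ ?_ intervalIntegrable_const ?_
    · exact Eventually.of_forall fun n => Continuous.aestronglyMeasurable
        ((JordanDomain.IsONPolys.pc (q n)).norm.pow 2)
    · refine Eventually.of_forall fun n => Eventually.of_forall fun s hs => ?_
      rw [Real.norm_of_nonneg (by positivity)]
      refine pow_le_pow_left₀ (norm_nonneg _) ?_ 2
      have h3 := hq n _ (hγ s hs)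
      have h4 := hfM _ (hγ s hs)
      have h5 : (1:ℝ) / (n + 1) ≤ 1 := by
        rw [div_le_one (by positivity)]; linarith [Nat.cast_nonneg (α := ℝ) n]
      have h6 := norm_sub_norm_le ((q n).eval (D.γ s)) (f (D.γ s))
      rw [norm_sub_rev] at h6
      linarith
    · exact Eventually.of_forall fun s hs => hl _ (hγ s hs)
  refine le_of_tendsto_of_tendsto' h1 (h2.const_mul _) fun n => ?_
  obtain ⟨m, hm⟩ := hp.eval_le a (q n)
  refine hm.trans (mul_le_mul_of_nonneg_right ?_ ?_)
  · exact hs.sum_le_tsum _ fun k _ => by positivity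
  · exact intervalIntegral.integral_nonneg D.l_pos.le fun s _ => by positivity

end DiscModel

namespace Smir
variable {D : JordanDomain} {φ ψ : ℂ → ℂ} {p : ℕ → Polynomial ℂ} {h : ℝ → ℝ}

theorem low_u (S : Smir ψ h) (H : DiscModel D φ ψ) (hp : D.IsONPolys p)
    (hs : Summable fun k => ‖(p k).eval (ψ 0)‖ ^ 2) {u : ℂ → ℝ} (hu : Continuous u) :
    D.l * Real.exp (-(2 * ((2 * Real.pi)⁻¹ * ∫ θ in (0:ℝ)..(2 * Real.pi), u (ψ (eI θ))))) ≤
    (∑' k, ‖(p k).eval (ψ 0)‖ ^ 2) *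
      ∫ θ in (0:ℝ)..(2 * Real.pi), Real.exp (-(2 * u (ψ (eI θ)))) * Real.exp (h θ) := by
  set m := (2 * Real.pi)⁻¹ * ∫ θ in (0:ℝ)..(2 * Real.pi), u (ψ (eI θ)) with hm
  set κ := ∑' k, ‖(p k).eval (ψ 0)‖ ^ 2 with hκ
  have hκ0 : 0 ≤ κ := tsum_nonneg fun k => by positivity
  have hl := D.l_pos
  have key : ∀ ε > 0, D.l * Real.exp (-(2 * (m + ε))) ≤ κ *
      ∫ θ in (0:ℝ)..(2 * Real.pi), Real.exp (-(2 * u (ψ (eI θ)))) * Real.exp (h θ) := fun ε hε => by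
    obtain ⟨Q, hQ, hQ2⟩ := H.walsh hu hε
    have hpa : PA (closure D.G) fun z => Complex.exp ((-Q).eval z) :=
      (PA.poly (-Q)).exp (DiscModel.cptK D)
    have h1 := DiscModel.eval_pa hp (H.mψ (show (0:ℂ) ∈ ball (0:ℂ) 1 by simp)) hs hpa
    have en : ∀ z, ‖Complex.exp ((-Q).eval z)‖ ^ 2 = Real.exp (-(2 * (Q.eval z).re)) := fun z => by
      rw [Complex.norm_exp, ← Real.exp_nat_mul]; congr 1; simp
    simp_rw [en] at h1
    have h2 : D.l * Real.exp (-(2 * (m + ε))) ≤ D.l * Real.exp (-(2 * (Q.eval (ψ 0)).re)) := by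
      refine mul_le_mul_of_nonneg_left (Real.exp_le_exp.2 ?_) hl.le
      linarith
    refine (h2.trans h1).trans (mul_le_mul_of_nonneg_left ?_ hκ0)
    have h3 : ∫ s in (0:ℝ)..D.l, Real.exp (-(2 * (Q.eval (D.γ s)).re)) ≤
        ∫ s in (0:ℝ)..D.l, Real.exp (-(2 * u (D.γ s))) := by
      have hq := JordanDomain.IsONPolys.pc (D := D) Q
      have hg := D.γ_cont
      refine intervalIntegral.integral_mono_on hl.le
        (Continuous.intervalIntegrable (by fun_prop) _ _)
        (Continuous.intervalIntegrable (by fun_prop) _ _) fun s hs => Real.exp_le_exp.2 ?_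
      linarith [hQ _ (DiscModel.γ_cl D s hs)]
    refine h3.trans (S.len H (f := fun z => Real.exp (-(2 * u z))) (by fun_prop) fun z =>
      (Real.exp_pos _).le)
  have ht : Tendsto (fun ε : ℝ => D.l * Real.exp (-(2 * (m + ε)))) (nhdsWithin 0 (Ioi 0))
      (nhds (D.l * Real.exp (-(2 * (m + 0))))) :=
    Tendsto.mono_left (Continuous.tendsto (by fun_prop) 0) nhdsWithin_le_nhds
  rw [add_zero] at ht
  exact le_of_tendsto ht (eventually_mem_nhdsWithin.mono fun ε hε => key ε hε)

theorem low_v (S : Smir ψ h) (H : DiscModel D φ ψ) (hp : D.IsONPolys p)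
    (hs : Summable fun k => ‖(p k).eval (ψ 0)‖ ^ 2) {v : ℂ → ℝ} (hv : ContinuousOn v (closedBall 0 1)) :
    D.l * Real.exp (-((2 * Real.pi)⁻¹ * ∫ θ in (0:ℝ)..(2 * Real.pi), v (eI θ))) ≤
    (∑' k, ‖(p k).eval (ψ 0)‖ ^ 2) *
      ∫ θ in (0:ℝ)..(2 * Real.pi), Real.exp (-(v (eI θ))) * Real.exp (h θ) := by
  have hc : ContinuousOn (fun z => v (φ z) / 2) (closure D.G) :=
    (hv.comp H.cφ H.mcφ).div_const 2
  obtain ⟨g, hg⟩ := ContinuousMap.exists_restrict_eq isClosed_closure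
    (⟨_, hc.domRestrict⟩ : C(closure D.G, ℝ))
  have hg2 : ∀ z ∈ closure D.G, g z = v (φ z) / 2 := fun z hz => by
    have := congrArg (fun f => f ⟨z, hz⟩) hg
    simpa using this
  have e : ∀ θ : ℝ, 2 * g (ψ (eI θ)) = v (eI θ) := fun θ => by
    rw [hg2 _ (H.mcψ (eI_cb θ)), H.r _ (eI_cb θ)]; ring
  have := S.low_u H hp hs g.continuous
  rw [mul_left_comm, ← intervalIntegral.integral_const_mul] at this
  simpa only [e] using this

theorem low_M (S : Smir ψ h) (H : DiscModel D φ ψ) (hp : D.IsONPolys p)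
    (hs : Summable fun k => ‖(p k).eval (ψ 0)‖ ^ 2) {M : ℝ} (hM : 0 ≤ M) :
    D.l * Real.exp (-((2 * Real.pi)⁻¹ * ∫ θ in (0:ℝ)..(2 * Real.pi), max (-M) (min M (h θ)))) ≤
    (∑' k, ‖(p k).eval (ψ 0)‖ ^ 2) *
      ∫ θ in (0:ℝ)..(2 * Real.pi), Real.exp (-(max (-M) (min M (h θ)))) * Real.exp (h θ) := by
  have hpp := Real.two_pi_pos
  set v : ℕ → ℂ → ℝ := fun n w => max (-M) (min M (Real.log ‖deriv ψ (rn n * w)‖)) with hv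
  have hm : ∀ n, ∀ w ∈ closedBall (0:ℂ) 1, (rn n:ℂ) * w ∈ ball (0:ℂ) 1 := fun n w hw => by
    obtain ⟨h0, h1⟩ := rn_mem n
    rw [mem_closedBall_zero_iff] at hw
    rw [mem_ball_zero_iff, norm_mul, Complex.norm_real, Real.norm_of_nonneg (by linarith)]
    nlinarith [norm_nonneg w]
  have hvc : ∀ n, ContinuousOn (v n) (closedBall 0 1) := fun n => by
    have h1 : ContinuousOn (fun w => Real.log ‖deriv ψ (rn n * w)‖) (closedBall 0 1) :=
      ((H.dψc.comp (continuous_const.mul continuous_id).continuousOn (hm n)).norm).log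
        fun w hw => norm_ne_zero_iff.2 (S.nz _ (hm n w hw))
    exact (continuous_const.max (continuous_const.min continuous_id)).comp_continuousOn h1
  have hve : ∀ n, Continuous fun θ => v n (eI θ) := fun n =>
    (hvc n).comp_continuous eI_cont eI_cb
  have hvM : ∀ n w, |v n w| ≤ M := fun n w =>
    abs_le.2 ⟨le_max_left _ _, max_le (by linarith) (min_le_left _ _)⟩
  have hlim : ∀ᵐ θ ∂volume, θ ∈ uIoc 0 (2 * Real.pi) →
      Tendsto (fun n => v n (eI θ)) atTop (nhds (max (-M) (min M (h θ)))) := by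
    rw [← ae_restrict_iff' measurableSet_uIoc, uIoc_of_le hpp.le]
    filter_upwards [S.lim] with θ hθ
    exact tendsto_const_nhds.max (tendsto_const_nhds.min (hθ.comp rn_lim))
  have t1 : Tendsto (fun n => ∫ θ in (0:ℝ)..(2 * Real.pi), v n (eI θ)) atTop
      (nhds (∫ θ in (0:ℝ)..(2 * Real.pi), max (-M) (min M (h θ)))) := by
    refine intervalIntegral.tendsto_integral_filter_of_dominated_convergence (l := atTop)
      (fun _ => M) (Eventually.of_forall fun n => (hve n).aestronglyMeasurable)
      (Eventually.of_forall fun n => Eventually.of_forall fun θ _ => hvM n _)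
      intervalIntegrable_const hlim
  have hei := S.exp_int H
  have t2 : Tendsto (fun n => ∫ θ in (0:ℝ)..(2 * Real.pi), Real.exp (-(v n (eI θ))) * Real.exp (h θ))
      atTop (nhds (∫ θ in (0:ℝ)..(2 * Real.pi), Real.exp (-(max (-M) (min M (h θ)))) *
        Real.exp (h θ))) := by
    refine intervalIntegral.tendsto_integral_filter_of_dominated_convergence (l := atTop)
      (fun θ => Real.exp M * Real.exp (h θ)) (Eventually.of_forall fun n => ?_)
      (Eventually.of_forall fun n => Eventually.of_forall fun θ _ => ?_)
      (hei.const_mul _) ?_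
    · exact ((Real.continuous_exp.comp (hve n).neg).aestronglyMeasurable).mul
        hei.def'.aestronglyMeasurable
    · rw [Real.norm_of_nonneg (by positivity)]
      refine mul_le_mul_of_nonneg_right (Real.exp_le_exp.2 ?_) (Real.exp_pos _).le
      linarith [(abs_le.1 (hvM n (eI θ))).1]
    · filter_upwards [hlim] with θ hθ hm
      exact ((Real.continuous_exp.tendsto _).comp (hθ hm).neg).mul_const _
  refine le_of_tendsto_of_tendsto' (((Real.continuous_exp.tendsto _).comp
    (t1.const_mul _).neg).const_mul _) (t2.const_mul _) fun n => S.low_v H hp hs (hvc n)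

theorem low (S : Smir ψ h) (H : DiscModel D φ ψ) (hp : D.IsONPolys p)
    (hs : Summable fun k => ‖(p k).eval (ψ 0)‖ ^ 2) :
    D.l ≤ 2 * Real.pi * ‖deriv ψ 0‖ * ∑' k, ‖(p k).eval (ψ 0)‖ ^ 2 := by
  have hpp := Real.two_pi_pos
  have hei := S.exp_int H
  have hlim : ∀ θ : ℝ, Tendsto (fun n : ℕ => max (-(n:ℝ)) (min n (h θ))) atTop (nhds (h θ)) :=
    fun θ => by
    refine tendsto_const_nhds.congr' ?_
    filter_upwards [eventually_ge_atTop ⌈|h θ|⌉₊] with n hn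
    have h1 := abs_le.1 (Nat.ceil_le.1 hn)
    rw [min_eq_right h1.2, max_eq_right h1.1]
  have hmM : ∀ n : ℕ, AEStronglyMeasurable (fun θ => max (-(n:ℝ)) (min n (h θ)))
      (volume.restrict (uIoc 0 (2 * Real.pi))) := fun n =>
    (continuous_const.max (continuous_const.min continuous_id)).comp_aestronglyMeasurable
      S.ii.def'.aestronglyMeasurable
  have t1 : Tendsto (fun n : ℕ => ∫ θ in (0:ℝ)..(2 * Real.pi), max (-(n:ℝ)) (min n (h θ))) atTop
      (nhds (∫ θ in (0:ℝ)..(2 * Real.pi), h θ)) := by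
    refine intervalIntegral.tendsto_integral_filter_of_dominated_convergence (l := atTop)
      (fun θ => |h θ|) (Eventually.of_forall hmM)
      (Eventually.of_forall fun n => Eventually.of_forall fun θ _ => ?_)
      S.ii.abs (Eventually.of_forall fun θ _ => hlim θ)
    have hn : (0:ℝ) ≤ n := Nat.cast_nonneg n
    have := neg_abs_le (h θ)
    have := le_abs_self (h θ)
    rw [Real.norm_eq_abs, abs_le]
    constructor
    · rcases le_total (n:ℝ) (h θ) with h1 | h1
      · rw [min_eq_left h1]; exact le_max_of_le_right (by linarith [abs_nonneg (h θ)])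
      · rw [min_eq_right h1]; exact le_max_of_le_right (by linarith)
    · exact max_le (by linarith [abs_nonneg (h θ)]) ((min_le_right _ _).trans this)
  have t2 : Tendsto (fun n : ℕ => ∫ θ in (0:ℝ)..(2 * Real.pi),
      Real.exp (-(max (-(n:ℝ)) (min n (h θ)))) * Real.exp (h θ))
      atTop (nhds (∫ θ in (0:ℝ)..(2 * Real.pi), Real.exp (-(h θ)) * Real.exp (h θ))) := by
    refine intervalIntegral.tendsto_integral_filter_of_dominated_convergence (l := atTop)
      (fun θ => 1 + Real.exp (h θ)) (Eventually.of_forall fun n => ?_)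
      (Eventually.of_forall fun n => Eventually.of_forall fun θ _ => ?_)
      (intervalIntegrable_const.add hei) (Eventually.of_forall fun θ _ =>
        ((Real.continuous_exp.tendsto _).comp (hlim θ).neg).mul_const _)
    · exact (Real.continuous_exp.comp_aestronglyMeasurable (hmM n).neg).mul
        hei.def'.aestronglyMeasurable
    · have hn : (0:ℝ) ≤ n := Nat.cast_nonneg n
      rw [Real.norm_of_nonneg (by positivity), ← Real.exp_add]
      rcases le_total (n:ℝ) (h θ) with h1 | h1
      · rw [min_eq_left h1, max_eq_right (by linarith)]
        have : Real.exp (-(n:ℝ) + h θ) ≤ Real.exp (h θ) := Real.exp_le_exp.2 (by linarith)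
        linarith
      · rw [min_eq_right h1]
        have : Real.exp (-(max (-(n:ℝ)) (h θ)) + h θ) ≤ 1 :=
          Real.exp_le_one_iff.2 (by linarith [le_max_right (-(n:ℝ)) (h θ)])
        linarith [Real.exp_pos (h θ)]
  have hf := le_of_tendsto_of_tendsto' (((Real.continuous_exp.tendsto _).comp
    (t1.const_mul (2 * Real.pi)⁻¹).neg).const_mul D.l) (t2.const_mul (∑' k, ‖(p k).eval (ψ 0)‖ ^ 2))
      fun n => S.low_M H hp hs (Nat.cast_nonneg n)
  have hd : 0 < ‖deriv ψ 0‖ := norm_pos_iff.2 (S.nz 0 (by simp))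
  rw [S.mean, ← mul_assoc, inv_mul_cancel₀ hpp.ne', one_mul, Real.exp_neg, Real.exp_log hd] at hf
  simp_rw [← Real.exp_add, neg_add_cancel, Real.exp_zero] at hf
  simp at hf
  rw [← div_eq_mul_inv, div_le_iff₀ hd] at hf
  linarith

end Smir

theorem real_mem {r x : ℝ} (h1 : r < 1) (hx : x ∈ Icc (-r) r) : (x:ℂ) ∈ ball (0:ℂ) 1 := by
  rw [mem_ball_zero_iff, Complex.norm_real, Real.norm_eq_abs]
  exact (abs_le.2 hx).trans_lt h1

theorem eI_neg (t : ℝ) : (starRingEnd ℂ) (eI t) = eI (-t) := by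
  unfold eI; rw [← Complex.exp_conj]; simp

theorem fr0 {Y : ℂ → ℂ} (hY : DifferentiableOn ℂ Y (ball 0 1)) {r : ℝ} (h0 : 0 < r) (h1 : r < 1) :
    ∫ x in (-r)..r, ‖Y x‖ ^ 2 ≤ r / 2 * ∫ θ in (0:ℝ)..(2 * Real.pi), ‖Y (r * eI θ)‖ ^ 2 := by
  set Z : ℂ → ℂ := fun z => Y z * (starRingEnd ℂ) (Y ((starRingEnd ℂ) z)) with hZ
  have cm : ∀ z ∈ ball (0:ℂ) 1, (starRingEnd ℂ) z ∈ ball (0:ℂ) 1 := fun z hz => by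
    rw [mem_ball_zero_iff] at hz ⊢; rwa [RCLike.norm_conj]
  have hZd : DifferentiableOn ℂ Z (ball 0 1) := fun z hz => by
    have h2 := (hY.differentiableAt (isOpen_ball.mem_nhds hz))
    have h3 := (hY.differentiableAt (isOpen_ball.mem_nhds (cm z hz))).conj_conj
    rw [Complex.conj_conj] at h3
    exact (h2.mul h3).differentiableWithinAt
  obtain ⟨W, hW⟩ := hZd.isExactOn_ball
  have hle : -r ≤ r := by linarith
  have e1 : ∫ x in (-r)..r, ((‖Y x‖ ^ 2 : ℝ) : ℂ) = W r - W (-r) := by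
    have := intervalIntegral.integral_eq_sub_of_hasDerivAt (a := -r) (b := r)
      (f := fun x : ℝ => W x) (f' := fun x : ℝ => ((‖Y x‖ ^ 2 : ℝ) : ℂ)) (fun x hx => by
        rw [uIcc_of_le hle] at hx
        have h2 := (hW x (real_mem h1 hx)).comp_ofReal
        have he : ((‖Y x‖ ^ 2 : ℝ) : ℂ) = Z x := by
          rw [hZ]; simp only [Complex.conj_ofReal, Complex.mul_conj', ofReal_pow]
        rw [he]; exact h2)
      (ContinuousOn.intervalIntegrable (by
        rw [uIcc_of_le hle]
        have : ContinuousOn (fun x : ℝ => Y x) (Icc (-r) r) :=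
          hY.continuousOn.comp Complex.continuous_ofReal.continuousOn fun x hx => real_mem h1 hx
        exact Complex.continuous_ofReal.comp_continuousOn (this.norm.pow 2)))
    simpa using this
  have hZc := r_cont hZd h0.le h1
  have hYc := r_cont hY h0.le h1
  have e2 : ∫ t in (0:ℝ)..Real.pi, Z (r * eI t) * (r * (eI t * I)) = W (-r) - W r := by
    have := intervalIntegral.integral_eq_sub_of_hasDerivAt (a := 0) (b := Real.pi)
      (f := fun t : ℝ => W (r * eI t)) (f' := fun t : ℝ => Z (r * eI t) * (r * (eI t * I)))
      (fun t _ => (hW _ (r_eI_mem h0.le h1 t)).comp t ((eI_hasDeriv t).const_mul (r:ℂ)))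
      (Continuous.intervalIntegrable (hZc.mul (continuous_const.mul (eI_cont.mul continuous_const))) _ _)
    rw [this]; simp [eI, Complex.exp_pi_mul_I]
  have e3 : ‖∫ x in (-r)..r, ((‖Y x‖ ^ 2 : ℝ) : ℂ)‖ = ∫ x in (-r)..r, ‖Y x‖ ^ 2 := by
    rw [intervalIntegral.integral_ofReal, Complex.norm_real, Real.norm_of_nonneg]
    exact intervalIntegral.integral_nonneg hle fun x _ => by positivity
  rw [← e3, e1, ← norm_neg, neg_sub, ← e2]
  have hpi := Real.pi_pos
  have hn : Continuous fun t : ℝ => ‖Y (r * eI t)‖ ^ 2 := hYc.norm.pow 2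
  have hn' : Continuous fun t : ℝ => ‖Y (r * eI (-t))‖ ^ 2 := hn.comp continuous_neg
  refine (intervalIntegral.norm_integral_le_of_norm_le hpi.le (g := fun t =>
    r / 2 * (‖Y (r * eI t)‖ ^ 2 + ‖Y (r * eI (-t))‖ ^ 2)) (Eventually.of_forall fun t _ => ?_)
    (Continuous.intervalIntegrable (by fun_prop) _ _)).trans (le_of_eq ?_)
  · have : ‖Z (r * eI t)‖ = ‖Y (r * eI t)‖ * ‖Y (r * eI (-t))‖ := by
      rw [hZ]; simp only [norm_mul, RCLike.norm_conj, map_mul, Complex.conj_ofReal, eI_neg]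
    rw [norm_mul, this, norm_mul, norm_mul, eI_norm, Complex.norm_real, Real.norm_of_nonneg h0.le,
      Complex.norm_I]
    nlinarith [sq_nonneg (‖Y (r * eI t)‖ - ‖Y (r * eI (-t))‖)]
  · rw [intervalIntegral.integral_const_mul, intervalIntegral.integral_add
      (hn.intervalIntegrable _ _) (hn'.intervalIntegrable _ _),
      intervalIntegral.integral_comp_neg (fun t => ‖Y (r * eI t)‖ ^ 2), neg_zero, add_comm,
      intervalIntegral.integral_add_adjacent_intervals (hn.intervalIntegrable _ _)
        (hn.intervalIntegrable _ _)]
    have hper : Function.Periodic (fun t : ℝ => ‖Y (r * eI t)‖ ^ 2) (2 * Real.pi) := fun t => by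
      simp only [eI_per]
    have := hper.intervalIntegral_add_eq (-Real.pi) 0
    rw [zero_add, show -Real.pi + 2 * Real.pi = Real.pi by ring] at this
    rw [this]

theorem fr {X : ℂ → ℂ} (hX : DifferentiableOn ℂ X (ball 0 1)) {r : ℝ} {w : ℂ} (hw : ‖w‖ ≤ r)
    (h0 : 0 < r) (h1 : r < 1) :
    ‖w‖ * ∫ t in (0:ℝ)..1, ‖X (t * w)‖ ^ 2 ≤
      r / 2 * ∫ θ in (0:ℝ)..(2 * Real.pi), ‖X (r * eI θ)‖ ^ 2 := by
  obtain ⟨α, hα⟩ : ∃ α : ℝ, w = ‖w‖ * eI α := ⟨w.arg, by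
    unfold eI; exact (Complex.norm_mul_exp_arg_mul_I w).symm⟩
  set ρ := ‖w‖ with hρ
  have hρ0 : 0 ≤ ρ := norm_nonneg w
  have hY : DifferentiableOn ℂ (fun z => X (eI α * z)) (ball 0 1) :=
    hX.comp (differentiableOn_id.const_mul _) fun z hz => by
      rw [mem_ball_zero_iff] at hz ⊢; rwa [norm_mul, eI_norm, one_mul]
  have h := fr0 hY h0 h1
  have hs : ∫ θ in (0:ℝ)..(2 * Real.pi), ‖X (eI α * (r * eI θ))‖ ^ 2 =
      ∫ θ in (0:ℝ)..(2 * Real.pi), ‖X (r * eI θ)‖ ^ 2 := by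
    have e : ∀ θ : ℝ, eI α * (r * eI θ) = r * eI (θ + α) := fun θ => by rw [eI_add]; ring
    simp_rw [e]
    rw [intervalIntegral.integral_comp_add_right (fun θ => ‖X (r * eI θ)‖ ^ 2)]
    have hper : Function.Periodic (fun t : ℝ => ‖X (r * eI t)‖ ^ 2) (2 * Real.pi) := fun t => by
      simp only [eI_per]
    have := hper.intervalIntegral_add_eq α 0
    rw [zero_add] at this
    rw [zero_add, add_comm, this]
  rw [hs] at h
  refine le_trans ?_ h
  have hc : ContinuousOn (fun x : ℝ => ‖X (eI α * x)‖ ^ 2) (Icc (-r) r) :=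
    (hY.continuousOn.comp Complex.continuous_ofReal.continuousOn fun x hx => real_mem h1 hx).norm.pow 2
  have e1 : ρ * ∫ t in (0:ℝ)..1, ‖X (t * w)‖ ^ 2 = ∫ x in (0:ℝ)..ρ, ‖X (eI α * x)‖ ^ 2 := by
    have := intervalIntegral.mul_integral_comp_mul_right (a := 0) (b := 1)
      (f := fun x : ℝ => ‖X (eI α * x)‖ ^ 2) ρ
    rw [zero_mul, one_mul] at this
    rw [← this]
    congr 1
    refine intervalIntegral.integral_congr fun t _ => ?_
    have : (t:ℂ) * w = eI α * ((t * ρ : ℝ) : ℂ) := by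
      push_cast; linear_combination (t:ℂ) * hα
    beta_reduce
    rw [this]
  rw [e1]
  refine intervalIntegral.integral_mono_interval (by linarith) hρ0 hw
    (Eventually.of_forall fun x => by positivity) (ContinuousOn.intervalIntegrable (by
      rwa [uIcc_of_le (by linarith)]))

theorem cs01 {f g : ℝ → ℂ} (hf : ContinuousOn f (Icc 0 1)) (hg : ContinuousOn g (Icc 0 1)) :
    ‖∫ t in (0:ℝ)..1, f t * g t‖ ^ 2 ≤
      (∫ t in (0:ℝ)..1, ‖f t‖ ^ 2) * ∫ t in (0:ℝ)..1, ‖g t‖ ^ 2 := by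
  have i1 : IntervalIntegrable (fun t => ‖f t‖ ^ 2) volume 0 1 :=
    ContinuousOn.intervalIntegrable (by rw [uIcc_of_le zero_le_one]; exact hf.norm.pow 2)
  have i2 : IntervalIntegrable (fun t => ‖g t‖ ^ 2) volume 0 1 :=
    ContinuousOn.intervalIntegrable (by rw [uIcc_of_le zero_le_one]; exact hg.norm.pow 2)
  set A := ∫ t in (0:ℝ)..1, ‖f t‖ ^ 2 with hA
  set B := ∫ t in (0:ℝ)..1, ‖g t‖ ^ 2 with hB
  set C := ‖∫ t in (0:ℝ)..1, f t * g t‖ with hC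
  have hA0 : 0 ≤ A := intervalIntegral.integral_nonneg zero_le_one fun x _ => by positivity
  have hB0 : 0 ≤ B := intervalIntegral.integral_nonneg zero_le_one fun x _ => by positivity
  have hC0 : 0 ≤ C := norm_nonneg _
  have key : ∀ s : ℝ, 0 < s → 2 * C ≤ s * A + s⁻¹ * B := fun s hs => by
    have h1 : C ≤ ∫ t in (0:ℝ)..1, (s / 2 * ‖f t‖ ^ 2 + s⁻¹ / 2 * ‖g t‖ ^ 2) := by
      refine intervalIntegral.norm_integral_le_of_norm_le zero_le_one
        (Eventually.of_forall fun t _ => ?_) ((i1.const_mul _).add (i2.const_mul _))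
      rw [norm_mul]
      have h2 := mul_nonneg (inv_pos.2 hs).le (sq_nonneg (s * ‖f t‖ - ‖g t‖))
      have h3 : s⁻¹ * (s * ‖f t‖ - ‖g t‖) ^ 2 =
        s * ‖f t‖ ^ 2 - 2 * (‖f t‖ * ‖g t‖) + s⁻¹ * ‖g t‖ ^ 2 := by field_simp; ring
      linarith
    rw [intervalIntegral.integral_add (i1.const_mul _) (i2.const_mul _),
      intervalIntegral.integral_const_mul, intervalIntegral.integral_const_mul] at h1
    linarith
  rcases hC0.eq_or_lt with h | hCp
  · rw [← h]; simpa using mul_nonneg hA0 hB0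
  rcases hA0.eq_or_lt with h | hAp
  · exfalso
    have h2 := key ((B + 1) / C) (by positivity)
    rw [← h, mul_zero, zero_add, inv_div, div_mul_eq_mul_div, le_div_iff₀ (by positivity)] at h2
    nlinarith
  · have h2 := key (C / A) (by positivity)
    rw [div_mul_cancel₀ _ hAp.ne', inv_div, div_mul_eq_mul_div] at h2
    have h3 : C ≤ A * B / C := by linarith
    rw [le_div_iff₀ hCp] at h3
    nlinarith

theorem sqrt_branch {F : ℂ → ℂ} (hF : DifferentiableOn ℂ F (ball 0 1))
    (hnz : ∀ w ∈ ball (0:ℂ) 1, F w ≠ 0) {c : ℝ} (hc : 0 < c) (h0 : F 0 = c) :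
    ∃ g : ℂ → ℂ, DifferentiableOn ℂ g (ball 0 1) ∧ (∀ w ∈ ball (0:ℂ) 1, g w ^ 2 = F w) ∧
      g 0 = (Real.sqrt c : ℂ) := by
  have hq : DifferentiableOn ℂ (fun w => deriv F w / F w) (ball 0 1) :=
    (hF.deriv isOpen_ball).div hF hnz
  obtain ⟨L0, hL0⟩ := hq.isExactOn_ball
  set L : ℂ → ℂ := fun w => L0 w - L0 0 with hLd
  have hL : ∀ w ∈ ball (0:ℂ) 1, HasDerivAt L (deriv F w / F w) w := fun w hw =>
    (hL0 w hw).sub_const _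
  have hm : (0:ℂ) ∈ ball (0:ℂ) 1 := by simp
  have hL00 : L 0 = 0 := by simp [hLd]
  have hd : ∀ w ∈ ball (0:ℂ) 1, HasDerivAt (fun w => F w * exp (-L w)) 0 w := fun w hw => by
    have h1 := (hF.differentiableAt (isOpen_ball.mem_nhds hw)).hasDerivAt
    have h2 := h1.mul (hL w hw).neg.cexp
    have e : deriv F w * exp (-L w) + F w * (exp (-L w) * -(deriv F w / F w)) = 0 := by
      field_simp [hnz w hw]; ring
    exact h2.congr_deriv e
  have hconst : ∀ w ∈ ball (0:ℂ) 1, F w * exp (-L w) = c := fun w hw => by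
    have := isOpen_ball.is_const_of_deriv_eq_zero (convex_ball (0:ℂ) 1).isPreconnected
      (fun w hw => (hd w hw).differentiableAt.differentiableWithinAt)
      (fun w hw => (hd w hw).deriv) hw hm
    rw [this, hL00, h0]; simp
  refine ⟨fun w => (Real.sqrt c : ℂ) * exp (L w / 2), fun w hw => ?_, fun w hw => ?_, ?_⟩
  · exact (((hL w hw).div_const 2).cexp.const_mul _).differentiableAt.differentiableWithinAt
  · rw [mul_pow, ← ofReal_pow, Real.sq_sqrt hc.le, ← hconst w hw, ← Complex.exp_nat_mul, mul_assoc,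
      ← Complex.exp_add]
    have : -L w + (2:ℕ) * (L w / 2) = 0 := by push_cast; ring
    rw [this, Complex.exp_zero, mul_one]
  · simp [hL00]

theorem pm_int {B : ℂ → ℂ} (hB : DifferentiableOn ℂ B (ball 0 1)) {b : ℝ} (hb : B 0 = b) {r : ℝ}
    (h0 : 0 ≤ r) (h1 : r < 1) (σ : ℝ) (hσ : σ ^ 2 = 1) :
    ∫ θ in (0:ℝ)..(2 * Real.pi), ‖1 + σ * B (r * eI θ)‖ ^ 2 =
      2 * Real.pi * (1 + 2 * σ * b) + ∫ θ in (0:ℝ)..(2 * Real.pi), ‖B (r * eI θ)‖ ^ 2 := by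
  have hc := r_cont hB h0 h1
  have e : ∀ z : ℂ, ‖1 + σ * z‖ ^ 2 = (1 + 2 * σ * z.re) + ‖z‖ ^ 2 := fun z => by
    rw [Complex.sq_norm, Complex.sq_norm, Complex.normSq_apply, Complex.normSq_apply]
    simp
    linear_combination (z.re * z.re + z.im * z.im) * hσ
  have hre : Continuous fun θ : ℝ => (B (r * eI θ)).re := Complex.continuous_re.comp hc
  have hm : ∫ θ in (0:ℝ)..(2 * Real.pi), (B (r * eI θ)).re = 2 * Real.pi * b := by
    have := congrArg Complex.re (mean_r hB h0 h1)
    rw [hb, ← ofReal_mul, ofReal_re] at this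
    rw [← this]
    exact intervalIntegral.intervalIntegral_re (𝕜 := ℂ) (hc.intervalIntegrable _ _)
  simp_rw [e]
  rw [intervalIntegral.integral_add (Continuous.intervalIntegrable (by fun_prop) _ _)
    (Continuous.intervalIntegrable (u := fun θ : ℝ => ‖B (r * eI θ)‖ ^ 2) (hc.norm.pow 2) _ _), intervalIntegral.integral_add
    (Continuous.intervalIntegrable (by fun_prop) _ _)
    (Continuous.intervalIntegrable (by fun_prop) _ _), intervalIntegral.integral_const_mul, hm]
  simp
  ring

theorem final_disc {B Φ : ℂ → ℂ} (hB : DifferentiableOn ℂ B (ball 0 1)) {b : ℝ} (hb : B 0 = b)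
    (hn : ∀ r : ℝ, 0 < r → r < 1 → r * ∫ θ in (0:ℝ)..(2 * Real.pi), ‖B (r * eI θ)‖ ^ 2 ≤ 2 * Real.pi)
    (hΦ0 : Φ 0 = 0) (hΦ : ∀ w ∈ ball (0:ℂ) 1, HasDerivAt Φ (1 - B w ^ 2) w) {w : ℂ}
    (hw : w ∈ ball (0:ℂ) 1) : ‖Φ w‖ ^ 2 ≤ 4 * Real.pi ^ 2 * (1 - b ^ 2) := by
  have hs : ∀ t ∈ Icc (0:ℝ) 1, (t:ℂ) * w ∈ ball (0:ℂ) 1 := fun t ht => by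
    rw [mem_ball_zero_iff] at hw ⊢
    rw [norm_mul, Complex.norm_real, Real.norm_of_nonneg ht.1]
    nlinarith [ht.1, ht.2, norm_nonneg w]
  have hp : ∀ σ : ℝ, DifferentiableOn ℂ (fun w => 1 + σ * B w) (ball 0 1) := fun σ =>
    (hB.const_mul _).const_add _
  have hcσ : ∀ σ : ℝ, ContinuousOn (fun t : ℝ => 1 + σ * B (t * w)) (Icc 0 1) := fun σ =>
    (hp σ).continuousOn.comp (by fun_prop) hs
  have hint : Φ w = w * ∫ t in (0:ℝ)..1, (1 + (-1:ℝ) * B (t * w)) * (1 + (1:ℝ) * B (t * w)) := by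
    have := intervalIntegral.integral_eq_sub_of_hasDerivAt (a := 0) (b := 1)
      (f := fun t : ℝ => Φ (t * w))
      (f' := fun t : ℝ => w * ((1 + (-1:ℝ) * B (t * w)) * (1 + (1:ℝ) * B (t * w)))) (fun t ht => by
        rw [uIcc_of_le zero_le_one] at ht
        have h2 : HasDerivAt (fun t : ℝ => (t:ℂ) * w) (1 * w) t :=
          (Complex.ofRealCLM.hasDerivAt).mul_const w
        have h3 := (hΦ _ (hs t ht)).comp t h2
        have e : (1 - B (t * w) ^ 2) * (1 * w) =
          w * ((1 + (-1:ℝ) * B (t * w)) * (1 + (1:ℝ) * B (t * w))) := by push_cast; ring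
        rw [e] at h3; exact h3)
      (ContinuousOn.intervalIntegrable (by
        rw [uIcc_of_le zero_le_one]
        exact continuousOn_const.mul ((hcσ _).mul (hcσ _))))
    rw [intervalIntegral.integral_const_mul] at this
    rw [this]; simp [hΦ0]
  have h1 := cs01 (hcσ (-1)) (hcσ 1)
  set A1 := ∫ t in (0:ℝ)..1, ‖1 + (-1:ℝ) * B (t * w)‖ ^ 2 with hA1
  set A2 := ∫ t in (0:ℝ)..1, ‖1 + (1:ℝ) * B (t * w)‖ ^ 2 with hA2
  have key : ∀ σ : ℝ, σ ^ 2 = 1 → ‖w‖ * ∫ t in (0:ℝ)..1, ‖1 + σ * B (t * w)‖ ^ 2 ≤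
      Real.pi * (2 + 2 * σ * b) := fun σ hσ => by
    have h2 : ∀ r : ℝ, ‖w‖ ≤ r → 0 < r → r < 1 →
        ‖w‖ * ∫ t in (0:ℝ)..1, ‖1 + σ * B (t * w)‖ ^ 2 ≤ r * Real.pi * (1 + 2 * σ * b) + Real.pi :=
      fun r hr h0 h1 => by
        have h3 := fr (hp σ) hr h0 h1
        rw [pm_int hB hb h0.le h1 σ hσ] at h3
        have h4 := hn r h0 h1
        linarith
    have ht : Tendsto (fun r : ℝ => r * Real.pi * (1 + 2 * σ * b) + Real.pi)
        (nhdsWithin 1 (Iio 1)) (nhds (1 * Real.pi * (1 + 2 * σ * b) + Real.pi)) :=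
      ((Continuous.tendsto (by fun_prop) 1).mono_left nhdsWithin_le_nhds)
    have h5 := ge_of_tendsto ht (b := ‖w‖ * ∫ t in (0:ℝ)..1, ‖1 + σ * B (t * w)‖ ^ 2) (by
      have hw' : ‖w‖ < 1 := mem_ball_zero_iff.1 hw
      filter_upwards [Ioo_mem_nhdsLT hw'] with r hr using
        h2 r hr.1.le ((norm_nonneg w).trans_lt hr.1) hr.2)
    linarith
  have k1 := key (-1) (by norm_num)
  have k2 := key 1 (by norm_num)
  have hA10 : 0 ≤ A1 := intervalIntegral.integral_nonneg zero_le_one fun x _ => by positivity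
  have hA20 : 0 ≤ A2 := intervalIntegral.integral_nonneg zero_le_one fun x _ => by positivity
  have hn0 := norm_nonneg w
  rw [hint, norm_mul, mul_pow]
  calc _ ≤ ‖w‖ ^ 2 * (A1 * A2) := mul_le_mul_of_nonneg_left h1 (by positivity)
    _ = (‖w‖ * A1) * (‖w‖ * A2) := by ring
    _ ≤ (Real.pi * (2 + 2 * (-1) * b)) * (Real.pi * (2 + 2 * 1 * b)) :=
      mul_le_mul k1 k2 (by positivity) ((by positivity : 0 ≤ ‖w‖ * A1).trans k1)
    _ = _ := by ring

open JordanDomain.IsONPolys in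
theorem Jfun_eq (D : JordanDomain) (p : ℕ → Polynomial ℂ) (ζ : ℂ) (n : ℕ) (z : ℂ) :
    Jfun D p ζ n z = ((2 * Real.pi / D.l / (∑ k ∈ Finset.range (n + 1), ‖(p k).eval ζ‖ ^ 2) : ℝ) : ℂ) *
      ∑ i ∈ Finset.range (((Kp p ζ (n + 1)) ^ 2).natDegree + 1),
        ((Kp p ζ (n + 1)) ^ 2).coeff i * ((z ^ (i + 1) - ζ ^ (i + 1)) / ((i : ℂ) + 1)) := by
  unfold Jfun Kp; push_cast; rfl

open JordanDomain.IsONPolys in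
theorem Jfun_deriv (D : JordanDomain) (p : ℕ → Polynomial ℂ) (ζ : ℂ) (n : ℕ) (z : ℂ) :
    HasDerivAt (Jfun D p ζ n)
      (((2 * Real.pi / D.l / (∑ k ∈ Finset.range (n + 1), ‖(p k).eval ζ‖ ^ 2) : ℝ) : ℂ) *
        (Kp p ζ (n + 1)).eval z ^ 2) z := by
  have e : Jfun D p ζ n = _ := funext (Jfun_eq D p ζ n)
  rw [e, ← Polynomial.eval_pow, Polynomial.eval_eq_sum_range]
  refine HasDerivAt.const_mul _ (HasDerivAt.fun_sum fun i _ => HasDerivAt.const_mul _ ?_)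
  have h := ((hasDerivAt_pow (i + 1) z).sub_const (ζ ^ (i + 1))).div_const ((i:ℂ) + 1)
  have hi : (i:ℂ) + 1 ≠ 0 := Nat.cast_add_one_ne_zero i
  refine h.congr_deriv ?_
  push_cast
  field_simp

theorem Jfun_zero (D : JordanDomain) (p : ℕ → Polynomial ℂ) (ζ : ℂ) (n : ℕ) :
    Jfun D p ζ n ζ = 0 := by
  rw [Jfun_eq]; simp

open JordanDomain.IsONPolys in
theorem bound_disc {D : JordanDomain} {φ ψ : ℂ → ℂ} {p : ℕ → Polynomial ℂ} {h : ℝ → ℝ}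
    (S : Smir ψ h) (H : DiscModel D φ ψ) (hp : D.IsONPolys p) {c : ℝ} (hc : 0 < c)
    (hd : deriv ψ 0 = c) (n : ℕ) {w : ℂ} (hw : w ∈ ball (0:ℂ) 1) :
    ‖w - Jfun D p (ψ 0) n (ψ w)‖ ≤
      8 * Real.pi * Real.sqrt (∑' k : ℕ, ‖(p (n + 1 + k)).eval (ψ 0)‖ ^ 2) := by
  have hpi := Real.pi_pos
  have hl := D.l_pos
  have hdn : ‖deriv ψ 0‖ = c := by rw [hd, Complex.norm_real, Real.norm_of_nonneg hc.le]
  have hs : Summable fun k => ‖(p k).eval (ψ 0)‖ ^ 2 :=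
    H.k_sum hp (by rw [hd]; exact_mod_cast hc.ne')
  have hlow := S.low H hp hs
  have hsp := hs.sum_add_tsum_nat_add (n + 1)
  have hcomm : (fun k => ‖(p (k + (n + 1))).eval (ψ 0)‖ ^ 2) =
      fun k => ‖(p (n + 1 + k)).eval (ψ 0)‖ ^ 2 := by funext k; rw [add_comm]
  rw [hcomm] at hsp
  rw [← hsp, hdn] at hlow
  set T := ∑' k : ℕ, ‖(p (n + 1 + k)).eval (ψ 0)‖ ^ 2 with hT
  have hT0 : 0 ≤ T := tsum_nonneg fun k => by positivity
  set k := ∑ k ∈ Finset.range (n + 1), ‖(p k).eval (ψ 0)‖ ^ 2 with hk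
  have hk1 : 1 ≤ k := by
    rw [← hp.p0 (ψ 0)]
    exact Finset.single_le_sum (f := fun k => ‖(p k).eval (ψ 0)‖ ^ 2) (fun i _ => by positivity)
      (Finset.mem_range.2 n.succ_pos)
  have hk0 : 0 < k := by linarith
  have hm0 : (0:ℂ) ∈ ball (0:ℂ) 1 := by simp
  obtain ⟨g, hg, hg2, hg0⟩ := sqrt_branch (H.dψ.deriv isOpen_ball) S.nz hc hd
  set m := 2 * Real.pi / D.l / k with hm
  have hmp : 0 < m := by positivity
  set K := Kp p (ψ 0) (n + 1) with hK
  set B : ℂ → ℂ := fun w => (Real.sqrt m : ℂ) * (K.eval (ψ w) * g w) with hBd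
  have hB : DifferentiableOn ℂ B (ball 0 1) :=
    ((K.differentiable.comp_differentiableOn H.dψ).mul hg).const_mul _
  have hsm : (Real.sqrt m : ℂ) ^ 2 = m := by rw [← ofReal_pow, Real.sq_sqrt hmp.le]
  have hb0 : B 0 = ((Real.sqrt m * (k * Real.sqrt c) : ℝ) : ℂ) := by
    rw [hBd]; beta_reduce; rw [hg0, hK, Kp_self, ← hk, ofReal_mul, ofReal_mul]
  have hsq : ∀ w ∈ ball (0:ℂ) 1, B w ^ 2 = m * (K.eval (ψ w) ^ 2 * deriv ψ w) := fun w hw => by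
    rw [hBd]; beta_reduce; rw [mul_pow, mul_pow, hg2 w hw, hsm]
  have hn : ∀ r : ℝ, 0 < r → r < 1 →
      r * ∫ θ in (0:ℝ)..(2 * Real.pi), ‖B (r * eI θ)‖ ^ 2 ≤ 2 * Real.pi := fun r h0 h1 => by
    have h2 := H.hardy K.differentiable h0.le h1
    rw [hK, hp.Kp_norm, ← hK] at h2
    have h3 : r * ∫ θ in (0:ℝ)..(2 * Real.pi), ‖B (r * eI θ)‖ ^ 2 = m * ∫ t in (0:ℝ)..(2 * Real.pi),
        ‖K.eval (ψ (r * eI t))‖ ^ 2 * (r * ‖deriv ψ (r * eI t)‖) := by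
      rw [← intervalIntegral.integral_const_mul, ← intervalIntegral.integral_const_mul]
      refine intervalIntegral.integral_congr fun t _ => ?_
      beta_reduce
      rw [← norm_pow, hsq _ (r_eI_mem h0.le h1 t), norm_mul, norm_mul, norm_pow, Complex.norm_real,
        Real.norm_of_nonneg hmp.le]
      ring
    rw [h3]
    refine (mul_le_mul_of_nonneg_left h2 hmp.le).trans (le_of_eq ?_)
    rw [← hk, hm]; field_simp
  have hΦ : ∀ w ∈ ball (0:ℂ) 1, HasDerivAt (fun w => w - Jfun D p (ψ 0) n (ψ w)) (1 - B w ^ 2) w :=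
    fun w hw => by
      have h2 := (H.dψ.differentiableAt (isOpen_ball.mem_nhds hw)).hasDerivAt
      have h3 := (hasDerivAt_id w).sub ((Jfun_deriv D p (ψ 0) n (ψ w)).comp w h2)
      refine h3.congr_deriv ?_
      rw [hsq w hw, mul_assoc]
  have hfin := final_disc hB hb0 hn (by rw [Jfun_zero, sub_zero]) hΦ hw
  have hb2 : (Real.sqrt m * (k * Real.sqrt c)) ^ 2 = 2 * Real.pi * c * k / D.l := by
    rw [mul_pow, mul_pow, Real.sq_sqrt hmp.le, Real.sq_sqrt hc.le, hm]; field_simp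
  rw [hb2] at hfin
  have hup := H.k_up hp (n + 1)
  have hup1 := H.k_up hp 1
  rw [Finset.sum_range_one, hp.p0, hdn] at hup1
  have h5 : 1 - 2 * Real.pi * c * k / D.l ≤ T := by
    rw [sub_le_iff_le_add, ← sub_le_iff_le_add', le_div_iff₀ hl]
    have : T * (2 * Real.pi * c) ≤ T * D.l := mul_le_mul_of_nonneg_left (by linarith) hT0
    nlinarith
  refine le_of_sq_le_sq ?_ (by positivity)
  rw [mul_pow, Real.sq_sqrt hT0]
  have h6 : 4 * Real.pi ^ 2 * (1 - 2 * Real.pi * c * k / D.l) ≤ 4 * Real.pi ^ 2 * T :=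
    mul_le_mul_of_nonneg_left h5 (by positivity)
  have h7 : 0 ≤ Real.pi ^ 2 * T := by positivity
  nlinarith

/-- Theorem 1.1 restated via Parseval. Let `G` be a Smirnov domain and
`ζ ∈ G`. Then for every `n`, `‖φ - J_{2n+1}‖_∞ ≤ 8π·(Σ_{k=n+1}^∞ |p_k(ζ)|²)^{1/2}`,
and the right-hand side tends to `0` as `n → ∞`. -/
theorem szegoKernelMethod_uniform_convergence_tail
    (D : JordanDomain) (hSmirnov : IsSmirnovDomain D.G)
    (p : ℕ → Polynomial ℂ) (hp : D.IsONPolys p)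
    (ζ : ℂ) (hζ : ζ ∈ D.G)
    (φ : ℂ → ℂ) (hφ : ConformalOnto D.G φ ζ) (hφc : ContinuousOn φ (closure D.G)) :
    (∀ n : ℕ,
      supNormOn (closure D.G) (fun z => φ z - Jfun D p ζ n z) ≤
        8 * Real.pi * Real.sqrt (∑' k : ℕ, ‖(p (n + 1 + k)).eval ζ‖ ^ 2)) ∧
    Tendsto (fun n : ℕ => Real.sqrt (∑' k : ℕ, ‖(p (n + 1 + k)).eval ζ‖ ^ 2))
      atTop (nhds 0) := by
  obtain ⟨ψ0, a1, a2, a3, a4⟩ := aux_inv_holo D.isOpen D.connected.isPreconnected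
    hφ.differentiable hφ.bijOn
  obtain ⟨ψ, H⟩ := ConfPair.model (D := D) (φ := φ) ⟨a1, a2, a3, a4, hφ.bijOn.mapsTo, hφc⟩
  have hψ0 : ψ 0 = ζ := by rw [← hφ.map_center]; exact H.l ζ (subset_closure hζ)
  have hdd : ∀ w ∈ ball (0:ℂ) 1, DifferentiableAt ℂ ψ w := fun w hw =>
    H.dψ.differentiableAt (isOpen_ball.mem_nhds hw)
  have hch : ∀ w ∈ ball (0:ℂ) 1, deriv φ (ψ w) * deriv ψ w = 1 := fun w hw => by
    have h1 := (hφ.differentiable _ (H.mψ hw)).hasDerivAt.comp w (hdd w hw).hasDerivAt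
    have h2 : φ ∘ ψ =ᶠ[nhds w] id := by
      filter_upwards [isOpen_ball.mem_nhds hw] with v hv using H.r v (ball_subset_closedBall hv)
    exact (h1.congr_of_eventuallyEq h2.symm).unique (hasDerivAt_id w)
  have hm0 : (0:ℂ) ∈ ball (0:ℂ) 1 := by simp
  obtain ⟨c, hc, hdc⟩ := hφ.deriv_center_pos
  have hd0 : deriv ψ 0 = ((c⁻¹ : ℝ) : ℂ) := by
    have := hch 0 hm0
    rw [hψ0, hdc] at this
    rw [ofReal_inv]; exact eq_inv_of_mul_eq_one_right this
  have hbij : BijOn ψ (ball (0 : ℂ) 1) D.G := ⟨H.mψ, fun a ha b hb hab => by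
      rw [← H.r a (ball_subset_closedBall ha), hab, H.r b (ball_subset_closedBall hb)],
    fun z hz => ⟨φ z, H.mφ hz, H.l z (subset_closure hz)⟩⟩
  obtain ⟨h, s1, s2, s3⟩ := hSmirnov ψ hdd hbij
  have S : Smir ψ h := ⟨s1, s2, s3, fun w hw h0 => by
    have := hch w hw
    rw [h0, mul_zero] at this
    exact zero_ne_one this⟩
  subst hψ0
  have hs : Summable fun k => ‖(p k).eval (ψ 0)‖ ^ 2 :=
    H.k_sum hp (S.nz 0 hm0)
  refine ⟨fun n => Real.iSup_le (fun z => ?_) (by positivity), ?_⟩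
  · have hcJ : ContinuousOn (fun z => ‖φ z - Jfun D p (ψ 0) n z‖) (closure D.G) :=
      (hφc.sub (fun z _ => (Jfun_deriv D p (ψ 0) n z).continuousAt.continuousWithinAt)).norm
    have hcl : ∀ x ∈ D.G, ‖φ x - Jfun D p (ψ 0) n x‖ ≤ 8 * Real.pi *
        Real.sqrt (∑' k : ℕ, ‖(p (n + 1 + k)).eval (ψ 0)‖ ^ 2) := fun x hx => by
      have := bound_disc S H hp (inv_pos.2 hc) hd0 n (H.mφ hx)
      rwa [H.l x (subset_closure hx)] at this
    exact le_on_closure hcl hcJ continuousOn_const z.2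
  · have h1 := (tendsto_sum_nat_add fun k => ‖(p k).eval (ψ 0)‖ ^ 2).comp (tendsto_add_atTop_nat 1)
    have h2 := (Real.continuous_sqrt.tendsto 0).comp h1
    rw [Real.sqrt_zero] at h2
    refine h2.congr fun n => ?_
    simp only [Function.comp]
    congr 2; funext k; rw [add_comm]
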